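/- arXiv:0911.5589 — 4 statements merged into one kernel-verified Lean document; each statement's English description precedes it below -/
import Mathlib

section
/- Let q = p^f be a prime power, G = PSL(2,q), and k = gcd(q−1, 2). Then every nonidentity element of G lies in exactly one of the following: a unique cyclic subgroup of order (q−1)/k, a unique cyclic subgroup of order (q+1)/k, or a unique Sylow p-subgroup of G. -/
open Matrix

namespace PSLTwo

variable {F : Type*} [Field F]

local notation "M₂" => Matrix (Fin 2) (Fin 2) F
local notation "SL₂" => Matrix.SpecialLinearGroup (Fin 2) F
local notation "PSL₂" => ProjectiveSpecialLinearGroup (Fin 2) F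

lemma coe_inj {g h : SL₂} (H : (g : M₂) = h) : g = h := Subtype.ext H

/-- Cayley–Hamilton for `2 × 2` matrices of determinant one. -/
lemma coe_mul_self (g : SL₂) :
    (g : M₂) * g = (-1 : F) • 1 + (g : M₂).trace • (g : M₂) := by
  have hd := g.det_coe
  rw [det_fin_two] at hd
  rw [trace_fin_two]
  ext i j
  fin_cases i <;> fin_cases j <;> simp [mul_apply, Fin.sum_univ_two]
  all_goals first | ring1 | linear_combination -hd

lemma mem_center_of_coe_eq_smul_one {g : SL₂} {r : F}
    (h : (g : M₂) = r • 1) : g ∈ Subgroup.center SL₂ := by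
  refine Subgroup.mem_center_iff.mpr fun B ↦ ?_
  apply coe_inj
  simp [h]

lemma exists_eq_smul_of_mem_center {z : SL₂} (hz : z ∈ Subgroup.center SL₂) :
    ∃ r : F, r ^ 2 = 1 ∧ (z : M₂) = r • 1 := by
  obtain ⟨r, hr, h⟩ := Matrix.SpecialLinearGroup.mem_center_iff.mp hz
  exact ⟨r, by simpa using hr, by rw [← h, smul_one_eq_diagonal]; rfl⟩

/-- The centralizer of a noncentral element `g` consists of linear combinations of `1` and `g`. -/
lemma exists_eq_add_smul_of_commute {g h : SL₂} (hg : g ∉ Subgroup.center SL₂)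
    (hc : Commute h g) : ∃ a b : F, (h : M₂) = a • 1 + b • (g : M₂) := by
  have hm : (h : M₂) * g = g * h := by
    simpa using congrArg (fun u : SL₂ ↦ (u : M₂)) hc.eq
  have e00 := congrFun (congrFun hm 0) 0
  have e01 := congrFun (congrFun hm 0) 1
  have e10 := congrFun (congrFun hm 1) 0
  simp only [mul_apply, Fin.sum_univ_two] at e00 e01 e10
  by_cases hb : g 0 1 = 0
  · by_cases hcc : g 1 0 = 0
    · by_cases hd : g 0 0 = g 1 1
      · refine absurd (mem_center_of_coe_eq_smul_one (r := g 0 0) ?_) hg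
        ext i j
        fin_cases i <;> fin_cases j <;> simp [hb, hcc, hd]
      · have hd' : g 0 0 - g 1 1 ≠ 0 := sub_ne_zero.mpr hd
        have h01 : h 0 1 = 0 := by
          apply (mul_eq_zero.mp (_ : (g 0 0 - g 1 1) * h 0 1 = 0)).resolve_left hd'
          linear_combination (h 0 0 - h 1 1) * hb - e01
        have h10 : h 1 0 = 0 := by
          apply (mul_eq_zero.mp (_ : (g 0 0 - g 1 1) * h 1 0 = 0)).resolve_left hd'
          linear_combination (h 0 0 - h 1 1) * hcc + e10
        refine ⟨h 0 0 - (h 0 0 - h 1 1) / (g 0 0 - g 1 1) * g 0 0,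
          (h 0 0 - h 1 1) / (g 0 0 - g 1 1), ?_⟩
        ext i j
        fin_cases i <;> fin_cases j <;> simp [hb, hcc, h01, h10]
        field_simp
        ring
    · refine ⟨h 0 0 - h 1 0 / g 1 0 * g 0 0, h 1 0 / g 1 0, ?_⟩
      ext i j
      fin_cases i <;> fin_cases j <;> simp <;> field_simp
      · linear_combination e00
      · linear_combination e10
  · refine ⟨h 0 0 - h 0 1 / g 0 1 * g 0 0, h 0 1 / g 0 1, ?_⟩
    ext i j
    fin_cases i <;> fin_cases j <;> simp <;> field_simp
    · linear_combination -e00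
    · linear_combination -e01

lemma commute_of_coe_eq {g h : SL₂} {a b : F}
    (hh : (h : M₂) = a • 1 + b • (g : M₂)) : Commute h g := by
  apply coe_inj
  simp [hh, add_mul, mul_add]

lemma add_smul_mul_add_smul (g : SL₂) (a b c d : F) :
    (a • 1 + b • (g : M₂)) * (c • 1 + d • (g : M₂)) =
      (a * c - b * d) • 1 + (a * d + b * c + b * d * (g : M₂).trace) • (g : M₂) := by
  simp only [add_mul, mul_add, smul_mul_assoc, mul_smul_comm, one_mul, mul_one, coe_mul_self]
  module

lemma eq_and_eq_of_add_smul_eq {g : SL₂} (hg : g ∉ Subgroup.center SL₂) {a b c d : F}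
    (h : a • 1 + b • (g : M₂) = c • 1 + d • (g : M₂)) : a = c ∧ b = d := by
  have h1 : (b - d) • (g : M₂) = (c - a) • 1 := by
    rw [sub_smul, sub_smul, sub_eq_sub_iff_add_eq_add, add_comm, h]
  have hbd : b = d := by
    by_contra hne
    refine hg (mem_center_of_coe_eq_smul_one (r := (b - d)⁻¹ * (c - a)) ?_)
    rw [mul_smul, ← h1, inv_smul_smul₀ (sub_ne_zero.mpr hne)]
  refine ⟨?_, hbd⟩
  have := congrFun (congrFun h 0) 0
  simpa [hbd] using this

lemma commute_of_commute {g h h' : SL₂} (hg : g ∉ Subgroup.center SL₂)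
    (hc : Commute h g) (hc' : Commute h' g) : Commute h h' := by
  obtain ⟨a, b, hh⟩ := exists_eq_add_smul_of_commute hg hc
  obtain ⟨c, d, hh'⟩ := exists_eq_add_smul_of_commute hg hc'
  apply coe_inj
  rw [Matrix.SpecialLinearGroup.coe_mul, Matrix.SpecialLinearGroup.coe_mul, hh, hh',
    add_smul_mul_add_smul, add_smul_mul_add_smul]
  module

lemma det_smul_one_add_smul (g : SL₂) (a b : F) :
    (a • 1 + b • (g : M₂)).det =
      a * a + (g : M₂).trace * a * b + b * b := by
  have hd := g.det_coe
  rw [det_fin_two] at hd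
  simp [det_fin_two, trace_fin_two]
  linear_combination b ^ 2 * hd

lemma trace_smul_one_add_smul (g : SL₂) (a b : F) :
    (a • 1 + b • (g : M₂)).trace =
      2 * a + b * (g : M₂).trace := by
  simp [trace_fin_two]
  ring

/-- If the images of `g` and `h` in `PSL₂` commute, then `h * g = ± g * h`. -/
lemma exists_mul_eq_smul_of_commute_mk {g h : SL₂} (hc : Commute (h : PSL₂) (g : PSL₂)) :
    ∃ r : F, r ^ 2 = 1 ∧ (h : M₂) * g = r • ((g : M₂) * (h : M₂)) := by
  have : ((g * h : SL₂) : PSL₂) = ((h * g : SL₂) : PSL₂) := hc.eq.symm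
  obtain ⟨r, hr, hz⟩ := exists_eq_smul_of_mem_center (QuotientGroup.eq.mp this)
  refine ⟨r, hr, ?_⟩
  have h1 : ((h * g : SL₂) : M₂) = (g * h : SL₂) * ((g * h)⁻¹ * (h * g) : SL₂) := by
    rw [← Matrix.SpecialLinearGroup.coe_mul, mul_inv_cancel_left]
  rw [hz] at h1
  simpa using h1

/-- Any lift of an element commuting with the image of `g`, of trace `± 2`, commutes with `g`. -/
lemma commute_of_commute_mk {g h : SL₂} (ht : (g : M₂).trace ^ 2 = 4)
    (hc : Commute (h : PSL₂) (g : PSL₂)) : Commute h g := by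
  obtain ⟨r, hr, hm⟩ := exists_mul_eq_smul_of_commute_mk hc
  suffices r = 1 by
    apply coe_inj
    simpa [this] using hm
  have h1 : (h : M₂) * g * (h⁻¹ : SL₂) = r • (g : M₂) := by
    rw [hm, smul_mul_assoc, mul_assoc, ← Matrix.SpecialLinearGroup.coe_mul h, mul_inv_cancel]
    simp
  have h2 : (g : M₂).trace = r * (g : M₂).trace := by
    rw [← smul_eq_mul, ← trace_smul, ← h1, trace_mul_comm, ← mul_assoc,
      ← Matrix.SpecialLinearGroup.coe_mul h⁻¹, inv_mul_cancel]
    simp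
  by_cases h0 : (g : M₂).trace = 0
  · have h4 : (2 : F) ^ 2 = 0 := by rw [h0] at ht; linear_combination -ht
    have h5 : (2 : F) = 0 := by simpa using h4
    have : (r - 1) ^ 2 = 0 := by linear_combination hr + (1 - r) * h5
    exact sub_eq_zero.mp (by simpa using this)
  · exact (mul_right_cancel₀ h0 (by rw [← h2, one_mul])).symm

lemma trace_sq_eq_four_of_commute {g h : SL₂} (hg : g ∉ Subgroup.center SL₂)
    (ht : (g : M₂).trace ^ 2 = 4) (hc : Commute h g) :
    (h : M₂).trace ^ 2 = 4 := by
  obtain ⟨a, b, hh⟩ := exists_eq_add_smul_of_commute hg hc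
  have hd := h.det_coe
  rw [hh, det_smul_one_add_smul] at hd
  rw [hh, trace_smul_one_add_smul]
  linear_combination 4 * hd + b ^ 2 * ht

lemma pow_char_mem_center {p : ℕ} [Fact p.Prime] [CharP F p] {h : SL₂}
    (ht : (h : M₂).trace ^ 2 = 4) : h ^ p ∈ Subgroup.center SL₂ := by
  obtain ⟨r, hr2, hr⟩ : ∃ r : F, r ^ 2 = 1 ∧ (h : M₂).trace = 2 * r := by
    by_cases h2 : (2 : F) = 0
    · refine ⟨1, by simp, ?_⟩
      have : (h : M₂).trace ^ 2 = 0 := by linear_combination ht + 2 * h2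
      rw [h2, zero_mul]
      simpa using this
    · refine ⟨(h : M₂).trace / 2, ?_, by field_simp⟩
      rw [div_pow, ht]
      field_simp
      norm_num
  have hN : ((h : M₂) - r • 1) ^ 2 = 0 := by
    have := coe_mul_self h
    rw [sq, sub_mul, mul_sub, mul_sub, this, hr]
    simp only [smul_mul_assoc, mul_smul_comm, one_mul, mul_one, smul_smul, ← sq r, hr2]
    module
  refine mem_center_of_coe_eq_smul_one (r := r ^ p) ?_
  have hc : Commute ((h : M₂) - r • 1) (r • 1) := by
    simp [Commute, SemiconjBy]
  have := add_pow_char_of_commute p hc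
  rw [sub_add_cancel, pow_eq_zero_of_le (Fact.out : p.Prime).two_le hN, zero_add, smul_pow,
    one_pow] at this
  exact (Matrix.SpecialLinearGroup.coe_pow h p).trans this

/-- The image in `PSL₂` of the centralizer of `g`. -/
def centralizerImage (g : SL₂) : Subgroup PSL₂ :=
  (Subgroup.centralizer {g}).map (QuotientGroup.mk' (Subgroup.center SL₂))

lemma mk_mem_centralizerImage {g h : SL₂} (hc : Commute h g) :
    (h : PSL₂) ∈ centralizerImage g :=
  ⟨h, Subgroup.mem_centralizer_singleton_iff.mpr hc, rfl⟩

lemma card_centralizerImage [Finite F] (g : SL₂) :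
    Nat.card (Subgroup.centralizer {g}) =
      Nat.card (Subgroup.center SL₂) * Nat.card (centralizerImage g) := by
  have hi : (centralizerImage g).index = (Subgroup.centralizer {g}).index := by
    refine Subgroup.index_map_eq _ (QuotientGroup.mk'_surjective _) ?_
    rw [QuotientGroup.ker_mk']
    exact Subgroup.center_le_centralizer _
  have h1 := (Subgroup.centralizer {g}).card_mul_index
  have h2 := (centralizerImage g).card_mul_index
  have h3 := Subgroup.card_eq_card_quotient_mul_card_subgroup (Subgroup.center SL₂)
  have h4 : (Subgroup.centralizer {g}).index ≠ 0 := Subgroup.index_ne_zero_of_finite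
  apply Nat.eq_of_mul_eq_mul_right (Nat.pos_of_ne_zero h4)
  rw [h1, h3, ← h2, hi]
  ring

lemma card_center [Finite F] :
    Nat.card (Subgroup.center SL₂) = Nat.gcd (Nat.card F - 1) 2 := by
  rw [← Nat.card_units, ← IsCyclic.card_powMonoidHom_ker,
    Nat.card_congr (Matrix.SpecialLinearGroup.center_equiv_rootsOfUnity' (0 : Fin 2)).toEquiv]
  rfl

lemma le_centralizerImage_of_isCyclic {g : SL₂} {C : Subgroup PSL₂} (hC : IsCyclic C)
    (hx : (g : PSL₂) ∈ C) : C ≤ centralizerImage g := by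
  intro y hy
  obtain ⟨⟨z, hz⟩, hgen⟩ := hC.exists_generator
  obtain ⟨w, rfl⟩ := QuotientGroup.mk_surjective z
  have key : ∀ {u : SL₂}, (u : PSL₂) ∈ C → ∃ n : ℤ, (w ^ n)⁻¹ * u ∈ Subgroup.center SL₂ := by
    intro u hu
    obtain ⟨n, hn⟩ := hgen ⟨_, hu⟩
    exact ⟨n, QuotientGroup.eq.mp (by simpa using congrArg Subtype.val hn)⟩
  have hcomm : ∀ {u v : SL₂}, u ∈ Subgroup.center SL₂ → Commute u v := fun hu ↦
    (Subgroup.mem_center_iff.mp hu _).symm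
  obtain ⟨u, rfl⟩ := QuotientGroup.mk_surjective y
  obtain ⟨n, hn⟩ := key hx
  obtain ⟨m, hm⟩ := key hy
  refine mk_mem_centralizerImage ?_
  rw [← mul_inv_cancel_left (w ^ n) g, ← mul_inv_cancel_left (w ^ m) u]
  exact ((Commute.refl w).zpow_zpow m n |>.mul_left (hcomm hm)).mul_right (hcomm hn).symm

/-- If the centralizer of `g` is cyclic, its image is the unique cyclic subgroup of its order
through the image of `g`. -/
lemma existsUnique_isCyclic [Finite F] {g : SL₂} {n : ℕ}
    (hc : IsCyclic (Subgroup.centralizer {g}))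
    (hn : Nat.card (Subgroup.centralizer {g}) = n) :
    ∃! C : Subgroup PSL₂, IsCyclic C ∧
      Nat.card C = n / Nat.gcd (Nat.card F - 1) 2 ∧ (g : PSL₂) ∈ C := by
  have hcard : Nat.card (centralizerImage g) = n / Nat.gcd (Nat.card F - 1) 2 := by
    rw [← hn, card_centralizerImage, card_center, Nat.mul_div_cancel_left]
    exact Nat.gcd_pos_of_pos_right _ two_pos
  refine ⟨centralizerImage g,
    ⟨?_, hcard, mk_mem_centralizerImage (Commute.refl g)⟩, fun C ⟨h1, h2, h3⟩ ↦ ?_⟩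
  · exact isCyclic_of_surjective _ (MonoidHom.subgroupMap_surjective _ _)
  · exact Subgroup.eq_of_le_of_card_ge (le_centralizerImage_of_isCyclic h1 h3)
      (by rw [hcard, h2])

lemma isCyclic_and_card_centralizer {M : Type*} [Group M] [IsCyclic M] {g : SL₂} (ψ : M →* SL₂)
    (hinj : Function.Injective ψ) (hψ : ∀ h, Commute h g ↔ ∃ m, ψ m = h) :
    IsCyclic (Subgroup.centralizer {g}) ∧ Nat.card (Subgroup.centralizer {g}) = Nat.card M := by
  have : Subgroup.centralizer {g} = ψ.range := by
    ext h
    rw [Subgroup.mem_centralizer_singleton_iff, MonoidHom.mem_range]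
    exact hψ h
  rw [this]
  exact ⟨isCyclic_of_surjective _ ψ.rangeRestrict_surjective,
    Nat.card_congr (MonoidHom.ofInjective hinj).toEquiv.symm⟩

/-- The element with eigenvalues `μ` and `μ⁻¹` on the eigenspaces of `g` for the distinct roots
`r` and `s` of its characteristic polynomial. -/
def splitTorus (g : SL₂) {r s : F} (hrs : r * s = 1) (ht : (g : M₂).trace = r + s)
    (hne : r - s ≠ 0) : Fˣ →* SL₂ where
  toFun μ := ⟨((r * ↑μ⁻¹ - s * μ) / (r - s)) • 1 + ((μ - ↑μ⁻¹) / (r - s)) • (g : M₂), by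
    rw [det_smul_one_add_smul, ht]
    have := μ.mul_inv
    generalize ((μ⁻¹ : Fˣ) : F) = ν at *
    field_simp
    linear_combination (r - s) ^ 2 * this - (μ - ν) ^ 2 * hrs⟩
  map_one' := by
    apply coe_inj
    simp [hne]
  map_mul' μ ν := by
    apply coe_inj
    refine Eq.trans ?_ (add_smul_mul_add_smul g _ _ _ _).symm
    simp only [ht, mul_inv, Units.val_mul]
    generalize ((μ⁻¹ : Fˣ) : F) = μ'
    generalize ((ν⁻¹ : Fˣ) : F) = ν'
    congr 2
    · field_simp
      linear_combination -(μ - μ') * (ν - ν') * hrs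
    · field_simp
      ring

lemma coe_splitTorus (g : SL₂) {r s : F} (hrs : r * s = 1) (ht : (g : M₂).trace = r + s)
    (hne : r - s ≠ 0) (μ : Fˣ) :
    (splitTorus g hrs ht hne μ : M₂) =
      ((r * ↑μ⁻¹ - s * μ) / (r - s)) • 1 + ((μ - ↑μ⁻¹) / (r - s)) • (g : M₂) :=
  rfl

lemma isCyclic_and_card_centralizer_of_split [Finite F] {g : SL₂}
    (hg : g ∉ Subgroup.center SL₂) {r s : F} (hrs : r * s = 1)
    (ht : (g : M₂).trace = r + s) (hne : r - s ≠ 0) :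
    IsCyclic (Subgroup.centralizer {g}) ∧
      Nat.card (Subgroup.centralizer {g}) = Nat.card F - 1 := by
  rw [← Nat.card_units]
  refine isCyclic_and_card_centralizer (splitTorus g hrs ht hne) (fun μ ν h ↦ ?_) fun h ↦ ⟨?_, ?_⟩
  · have h' := congrArg (fun u : SL₂ ↦ (u : M₂)) h
    simp only [coe_splitTorus] at h'
    obtain ⟨h1, h2⟩ := eq_and_eq_of_add_smul_eq hg h'
    have h3 (μ : Fˣ) : (μ : F) = (r * ↑μ⁻¹ - s * μ) / (r - s) + r * ((μ - ↑μ⁻¹) / (r - s)) := by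
      generalize ((μ⁻¹ : Fˣ) : F) = μ'
      field_simp
      ring
    ext
    rw [h3 μ, h3 ν, h1, h2]
  · intro hc
    obtain ⟨a, b, hh⟩ := exists_eq_add_smul_of_commute hg hc
    have hd := h.det_coe
    rw [hh, det_smul_one_add_smul, ht] at hd
    have h1 : (a + b * r) * (a + b * s) = 1 := by linear_combination hd + b ^ 2 * hrs
    refine ⟨⟨a + b * r, a + b * s, h1, by rw [mul_comm, h1]⟩, coe_inj ?_⟩
    rw [hh, coe_splitTorus]
    simp only [Units.inv_mk]
    congr 2 <;> field_simp <;> ring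
  · rintro ⟨μ, rfl⟩
    exact commute_of_coe_eq (coe_splitTorus g hrs ht hne μ)

/-- The group of elements of norm one in `F[g]`, as matrices. -/
noncomputable def normOneTorus (g : SL₂) :
    (Units.map (Algebra.norm F (S := QuadraticAlgebra F (-1) (g : M₂).trace))).ker →* SL₂ where
  toFun z := ⟨z.1.1.re • 1 + z.1.1.im • (g : M₂), by
    refine Eq.trans ?_ (congrArg Units.val z.2)
    refine Eq.trans ?_ (QuadraticAlgebra.det_toLinearMap_eq_norm z.1.1).symm
    rw [det_smul_one_add_smul, QuadraticAlgebra.norm_def]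
    ring⟩
  map_one' := by
    apply coe_inj
    simp [QuadraticAlgebra.re_one, QuadraticAlgebra.im_one]
  map_mul' z w := by
    apply coe_inj
    refine Eq.trans ?_ (add_smul_mul_add_smul g _ _ _ _).symm
    simp only [Subgroup.coe_mul, Units.val_mul, QuadraticAlgebra.re_mul, QuadraticAlgebra.im_mul]
    module

lemma isCyclic_and_card_centralizer_of_nonsplit [Finite F] {g : SL₂}
    (hg : g ∉ Subgroup.center SL₂) (hirr : ∀ r : F, r ^ 2 ≠ -1 + (g : M₂).trace * r) :
    IsCyclic (Subgroup.centralizer {g}) ∧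
      Nat.card (Subgroup.centralizer {g}) = Nat.card F + 1 := by
  have : Fact (∀ r : F, r ^ 2 ≠ -1 + (g : M₂).trace * r) := ⟨hirr⟩
  let K := QuadraticAlgebra F (-1) (g : M₂).trace
  have : Finite K := Finite.of_equiv _ (QuadraticAlgebra.equivProd _ _).symm
  have hK : Nat.card K = Nat.card F * Nat.card F := by
    rw [Nat.card_congr (QuadraticAlgebra.equivProd _ _), Nat.card_prod]
  have hcard : Nat.card (Units.map (Algebra.norm F (S := K))).ker = Nat.card F + 1 := by
    have h1 := (Units.map (Algebra.norm F (S := K))).ker.card_mul_index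
    rw [Subgroup.index_ker, MonoidHom.range_eq_top.mpr (FiniteField.unitsMap_norm_surjective F K),
      Subgroup.card_top, Nat.card_units, Nat.card_units, hK] at h1
    have h2 : 0 < Nat.card F - 1 := Nat.sub_pos_of_lt Finite.one_lt_card
    apply Nat.eq_of_mul_eq_mul_right h2
    rw [h1, ← Nat.mul_self_sub_mul_self_eq]
  rw [← hcard]
  refine isCyclic_and_card_centralizer (normOneTorus g) (fun z w h ↦ ?_) fun h ↦ ⟨?_, ?_⟩
  · obtain ⟨h1, h2⟩ := eq_and_eq_of_add_smul_eq hg (congrArg (fun u : SL₂ ↦ (u : M₂)) h)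
    exact Subtype.ext (Units.ext (QuadraticAlgebra.ext h1 h2))
  · intro hc
    obtain ⟨a, b, hh⟩ := exists_eq_add_smul_of_commute hg hc
    have hd := h.det_coe
    rw [hh, det_smul_one_add_smul] at hd
    let z : K := ⟨a, b⟩
    have hz : Algebra.norm F z = 1 := by
      refine ((QuadraticAlgebra.det_toLinearMap_eq_norm z).trans ?_).trans hd
      rw [QuadraticAlgebra.norm_def]
      ring
    have hz0 : z ≠ 0 := by
      rintro h0
      simp [h0] at hz
    exact ⟨⟨Units.mk0 z hz0, Units.ext hz⟩, coe_inj hh.symm⟩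
  · rintro ⟨z, rfl⟩
    exact commute_of_coe_eq rfl

lemma isPGroup_centralizerImage {p : ℕ} [Fact p.Prime] [CharP F p] {g : SL₂}
    (hg : g ∉ Subgroup.center SL₂) (ht : (g : M₂).trace ^ 2 = 4) :
    IsPGroup p (centralizerImage g) := by
  rintro ⟨_, h, hh, rfl⟩
  refine ⟨1, Subtype.ext ?_⟩
  rw [pow_one]
  exact (QuotientGroup.eq_one_iff _).mpr (pow_char_mem_center
    (trace_sq_eq_four_of_commute hg ht (Subgroup.mem_centralizer_singleton_iff.mp hh)))

lemma le_centralizerImage_of_isPGroup [Finite F] {p : ℕ} [Fact p.Prime] {g : SL₂}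
    (hg : g ∉ Subgroup.center SL₂) (ht : (g : M₂).trace ^ 2 = 4) {P : Subgroup PSL₂}
    (hP : IsPGroup p P) (hx : (g : PSL₂) ∈ P) : P ≤ centralizerImage g := by
  have hne : (g : PSL₂) ≠ 1 := fun h ↦ hg ((QuotientGroup.eq_one_iff _).mp h)
  have : Nontrivial P := ⟨⟨_, hx⟩, 1, fun h ↦ hne (congrArg Subtype.val h)⟩
  have := hP.center_nontrivial
  obtain ⟨⟨⟨z, hzP⟩, hz⟩, hz1⟩ := exists_ne (1 : Subgroup.center P)
  obtain ⟨w, rfl⟩ := QuotientGroup.mk_surjective z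
  have hw : w ∉ Subgroup.center SL₂ := fun h ↦
    hz1 (Subtype.ext (Subtype.ext ((QuotientGroup.eq_one_iff _).mpr h)))
  have hcomm : ∀ y ∈ P, Commute y (w : PSL₂) := fun y hy ↦
    congrArg Subtype.val (Subgroup.mem_center_iff.mp hz ⟨y, hy⟩)
  have hwg : Commute w g := commute_of_commute_mk ht (hcomm _ hx).symm
  intro y hy
  obtain ⟨u, rfl⟩ := QuotientGroup.mk_surjective y
  exact mk_mem_centralizerImage (commute_of_commute hw
    (commute_of_commute_mk (trace_sq_eq_four_of_commute hg ht hwg) (hcomm _ hy)) hwg.symm)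

lemma existsUnique_sylow [Finite F] {p : ℕ} [Fact p.Prime] [CharP F p] {g : SL₂}
    (hg : g ∉ Subgroup.center SL₂) (ht : (g : M₂).trace ^ 2 = 4) :
    ∃! P : Sylow p PSL₂, (g : PSL₂) ∈ (P : Subgroup PSL₂) := by
  have hC := isPGroup_centralizerImage (p := p) hg ht
  obtain ⟨P, hP⟩ := hC.exists_le_sylow
  refine ⟨P, hP (mk_mem_centralizerImage (Commute.refl g)), fun Q hQ ↦ Sylow.ext ?_⟩
  have hQC := le_centralizerImage_of_isPGroup hg ht Q.isPGroup' hQ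
  exact (Q.is_maximal' P.isPGroup' (hQC.trans hP)).symm

/-- Every nonidentity element of `PSL₂` lies in a unique subgroup of one of the three kinds. -/
lemma exists_cases [Finite F] (p : ℕ) [Fact p.Prime] [CharP F p] {x : PSL₂} (hx : x ≠ 1) :
    (∃! C : Subgroup PSL₂, IsCyclic C ∧
      Nat.card C = (Nat.card F - 1) / Nat.gcd (Nat.card F - 1) 2 ∧ x ∈ C) ∨
    (∃! C : Subgroup PSL₂, IsCyclic C ∧
      Nat.card C = (Nat.card F + 1) / Nat.gcd (Nat.card F - 1) 2 ∧ x ∈ C) ∨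
    (∃! P : Sylow p PSL₂, x ∈ (P : Subgroup PSL₂)) := by
  obtain ⟨g, rfl⟩ := QuotientGroup.mk_surjective x
  have hg : g ∉ Subgroup.center SL₂ := fun h ↦ hx ((QuotientGroup.eq_one_iff _).mpr h)
  by_cases ht : (g : M₂).trace ^ 2 = 4
  · exact .inr (.inr (existsUnique_sylow hg ht))
  by_cases hirr : ∀ r : F, r ^ 2 ≠ -1 + (g : M₂).trace * r
  · obtain ⟨h1, h2⟩ := isCyclic_and_card_centralizer_of_nonsplit hg hirr
    exact .inr (.inl (existsUnique_isCyclic h1 h2))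
  · push Not at hirr
    obtain ⟨r, hr⟩ := hirr
    have hrs : r * ((g : M₂).trace - r) = 1 := by linear_combination -hr
    obtain ⟨h1, h2⟩ := isCyclic_and_card_centralizer_of_split hg hrs (by ring) fun h ↦
      ht (by linear_combination (r - ((g : M₂).trace - r)) * h + 4 * hrs)
    exact .inl (existsUnique_isCyclic h1 h2)

end PSLTwo

lemma Nat.coprime_sub_one_div_add_one_div {q : ℕ} (hq : 2 ≤ q) :
    Nat.Coprime ((q - 1) / Nat.gcd (q - 1) 2) ((q + 1) / Nat.gcd (q - 1) 2) := by
  obtain ⟨m, rfl⟩ : ∃ m, q = m + 1 := ⟨q - 1, by omega⟩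
  rw [Nat.add_sub_cancel]
  rcases Nat.even_or_odd' m with ⟨n, rfl | rfl⟩
  · rw [Nat.gcd_eq_right (by simp), show (2 * n + 1 + 1) / 2 = n + 1 by omega,
      Nat.mul_div_cancel_left _ two_pos]
    simp
  · have h : Nat.gcd (2 * n + 1) 2 = 1 := by simp
    rw [h, Nat.div_one, Nat.div_one]
    simp [show 2 * n + 1 + 1 + 1 = 2 + (2 * n + 1) by omega, Nat.coprime_comm]

/-- every nonidentity element of `G = PSL(2,q)`, `q = p^f`, lies in
exactly one of: a unique cyclic subgroup of order `(q−1)/k`, a unique cyclic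
subgroup of order `(q+1)/k`, or a unique Sylow `p`-subgroup of `G`, where
`k = gcd(q−1, 2)`. -/
theorem stmt_9 (p f : ℕ) [Fact p.Prime] (hf : f ≠ 0)
    (q : ℕ) (hq : q = p ^ f) (k : ℕ) (hk : k = Nat.gcd (q - 1) 2)
    (x : ProjectiveSpecialLinearGroup (Fin 2) (GaloisField p f)) (hx : x ≠ 1) :
    letI G := ProjectiveSpecialLinearGroup (Fin 2) (GaloisField p f)
    letI A : Prop := ∃! C : Subgroup G, IsCyclic C ∧ Nat.card C = (q - 1) / k ∧ x ∈ C
    letI B : Prop := ∃! C : Subgroup G, IsCyclic C ∧ Nat.card C = (q + 1) / k ∧ x ∈ C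
    letI S : Prop := ∃! P : Sylow p G, x ∈ (P : Subgroup G)
    (A ∧ ¬ B ∧ ¬ S) ∨ (¬ A ∧ B ∧ ¬ S) ∨ (¬ A ∧ ¬ B ∧ S) := by
  set A : Prop := ∃! C : Subgroup (ProjectiveSpecialLinearGroup (Fin 2) (GaloisField p f)),
    IsCyclic C ∧ Nat.card C = (q - 1) / k ∧ x ∈ C
  set B : Prop := ∃! C : Subgroup (ProjectiveSpecialLinearGroup (Fin 2) (GaloisField p f)),
    IsCyclic C ∧ Nat.card C = (q + 1) / k ∧ x ∈ C
  set S : Prop := ∃! P : Sylow p (ProjectiveSpecialLinearGroup (Fin 2) (GaloisField p f)),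
    x ∈ (P : Subgroup (ProjectiveSpecialLinearGroup (Fin 2) (GaloisField p f)))
  have hp : p.Prime := Fact.out
  have hcases : A ∨ B ∨ S := by
    have := PSLTwo.exists_cases p hx
    rwa [GaloisField.card p f hf, ← hq, ← hk] at this
  have hx1 : orderOf x ≠ 1 := fun h ↦ hx (orderOf_eq_one_iff.mp h)
  have hpq : p ∣ q := hq ▸ dvd_pow_self p hf
  have hq2 : 2 ≤ q := hp.two_le.trans (Nat.le_of_dvd (hq ▸ pow_pos hp.pos f) hpq)
  have hkq : k ∣ q - 1 := hk ▸ Nat.gcd_dvd_left _ _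
  have hkq' : k ∣ q + 1 := by
    rw [show q + 1 = q - 1 + 2 by omega]
    exact dvd_add hkq (hk ▸ Nat.gcd_dvd_right _ _)
  have hA : A → orderOf x ∣ (q - 1) / k := fun ⟨C, ⟨_, hC, hxC⟩, _⟩ ↦
    hC ▸ Subgroup.orderOf_dvd_natCard _ hxC
  have hB : B → orderOf x ∣ (q + 1) / k := fun ⟨C, ⟨_, hC, hxC⟩, _⟩ ↦
    hC ▸ Subgroup.orderOf_dvd_natCard _ hxC
  have hS : S → p ∣ orderOf x := by
    rintro ⟨P, hxP, _⟩
    obtain ⟨n, hn⟩ := IsPGroup.iff_orderOf.mp P.isPGroup' ⟨x, hxP⟩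
    rw [Subgroup.orderOf_mk] at hn
    rw [hn]
    refine dvd_pow_self p ?_
    rintro rfl
    exact hx1 (by simpa using hn)
  have hAB : ¬ (A ∧ B) := fun ⟨a, b⟩ ↦
    hx1 (Nat.eq_one_of_dvd_coprimes (hk ▸ Nat.coprime_sub_one_div_add_one_div hq2) (hA a) (hB b))
  have hAS : ¬ (A ∧ S) := fun ⟨a, s⟩ ↦ by
    have h1 := ((hS s).trans (hA a)).trans (Nat.div_dvd_of_dvd hkq)
    have h2 := Nat.dvd_sub hpq h1
    rw [Nat.sub_sub_self (by omega)] at h2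
    exact hp.one_lt.ne' (Nat.dvd_one.mp h2)
  have hBS : ¬ (B ∧ S) := fun ⟨b, s⟩ ↦ by
    have h1 := ((hS s).trans (hB b)).trans (Nat.div_dvd_of_dvd hkq')
    exact hp.one_lt.ne' (Nat.dvd_one.mp ((Nat.dvd_add_right hpq).mp h1))
  tauto
end

section
/- Let q = p^f with p prime and f a prime, and let n_sf(q) denote the number of nonidentity elements of G = PSL(2,q) that lie in a proper subfield-type subgroup (a subgroup isomorphic to PSL(2,p^m) for m a proper divisor of f, or PGL(2,p^m) for 2m dividing f). Then n_sf(q) ≤ (2p−1)·q². -/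
open Matrix

/-- The projective general linear group `PGL(2, F)`. -/
abbrev PGLtwo (F : Type*) [Field F] :=
  GeneralLinearGroup (Fin 2) F ⧸ Subgroup.center (GeneralLinearGroup (Fin 2) F)

section PowerScalar

variable {K : Type*} [Field K] {p : ℕ} [Fact p.Prime]

theorem Matrix.mul_self_fin_two {R : Type*} [CommRing R] (B : Matrix (Fin 2) (Fin 2) R) :
    B * B = B.trace • B - B.det • 1 := by
  ext i j
  fin_cases i <;> fin_cases j <;>
    simp [Matrix.mul_apply, Fin.sum_univ_two, Matrix.trace_fin_two, Matrix.det_fin_two] <;> ring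

theorem Matrix.pow_char_eq_smul_one_or_self_of_isRoot [CharP K p] (hK : ∀ y : K, y ^ p = y)
    (B : Matrix (Fin 2) (Fin 2) K) {r : K} (hr : r ^ 2 - B.trace * r + B.det = 0) :
    (∃ c : K, B ^ p = c • 1) ∨ B ^ p = B := by
  have hp : p.Prime := Fact.out
  set N := B - r • (1 : Matrix (Fin 2) (Fin 2) K) with hN
  set δ := B.trace - 2 * r with hδ
  have hN2 : N * N = δ • N := by
    have h1 : N * N = B * B - (2 * r) • B + (r * r) • 1 := by
      simp only [hN, sub_mul, mul_sub, Matrix.smul_mul, Matrix.mul_smul, one_mul, mul_one]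
      module
    have h2 : B.det = B.trace * r - r ^ 2 := by linear_combination hr
    rw [h1, Matrix.mul_self_fin_two, h2, hδ, hN]
    module
  have hNpow : ∀ n : ℕ, N ^ (n + 1) = δ ^ n • N := by
    intro n
    induction n with
    | zero => simp
    | succ n ih => rw [pow_succ, ih, Matrix.smul_mul, hN2, smul_smul, pow_succ]
  have hBN : B = N + r • 1 := by simp [hN]
  have hcomm : Commute N (r • (1 : Matrix (Fin 2) (Fin 2) K)) := (Commute.one_right N).smul_right r
  have hBp : B ^ p = δ ^ (p - 1) • N + r • 1 := by
    rw [hBN, add_pow_char_of_commute p hcomm, smul_pow, one_pow, hK, ← hNpow,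
      Nat.sub_add_cancel hp.one_le]
  by_cases h0 : δ = 0
  · left
    refine ⟨r, ?_⟩
    rw [hBp, h0, zero_pow (Nat.sub_ne_zero_of_lt hp.one_lt), zero_smul, zero_add]
  · right
    have h1 : δ ^ (p - 1) = 1 := by
      apply mul_right_cancel₀ h0
      rw [← pow_succ, Nat.sub_add_cancel hp.one_le, hK, one_mul]
    rw [hBp, h1, one_smul, ← hBN]

open Polynomial in
theorem Matrix.pow_char_eq_self_or_of_irreducible [CharP K p] (hK : ∀ y : K, y ^ p = y)
    (B : Matrix (Fin 2) (Fin 2) K) (hB : Irreducible B.charpoly) :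
    B ^ p = B ∨ B ^ p = B.trace • 1 - B := by
  have hp : p.Prime := Fact.out
  have hP : B.charpoly = X ^ 2 - C B.trace * X + C B.det := Matrix.charpoly_fin_two B
  have hPp : B.charpoly ^ p = (X ^ p) ^ 2 - C B.trace * X ^ p + C B.det := by
    rw [hP, add_pow_char, sub_pow_char, mul_pow, ← C_pow, ← C_pow, hK, hK]
    ring
  have hdvd : B.charpoly ∣ (X ^ p - X) * (X ^ p - (C B.trace - X)) := by
    have h1 : (X ^ p - X) * (X ^ p - (C B.trace - X)) = B.charpoly ^ p - B.charpoly := by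
      rw [hPp, hP]
      ring
    rw [h1]
    exact dvd_sub (dvd_pow_self _ hp.ne_zero) dvd_rfl
  have haeval : ∀ Q : K[X], B.charpoly ∣ Q → aeval B Q = 0 := by
    rintro _ ⟨Q, rfl⟩
    rw [map_mul, Matrix.aeval_self_charpoly, zero_mul]
  rcases hB.prime.dvd_or_dvd hdvd with h | h
  · left
    simpa [sub_eq_zero] using haeval _ h
  · right
    simpa [sub_eq_zero, Algebra.algebraMap_eq_smul_one] using haeval _ h

open Polynomial in
theorem Matrix.exists_pow_eq_smul_one [CharP K p] (hK : ∀ y : K, y ^ p = y)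
    (B : Matrix (Fin 2) (Fin 2) K) (hB : IsUnit B) :
    ∃ k : ℕ, (k = p - 1 ∨ k = p ∨ k = p + 1) ∧ ∃ c : K, B ^ k = c • 1 := by
  have hp : p.Prime := Fact.out
  have hself : B ^ p = B → B ^ (p - 1) = (1 : K) • 1 := by
    intro h
    apply hB.mul_right_cancel
    rw [← pow_succ, Nat.sub_add_cancel hp.one_le, h, one_smul, one_mul]
  by_cases hirr : Irreducible B.charpoly
  · rcases B.pow_char_eq_self_or_of_irreducible hK hirr with h | h
    · exact ⟨_, Or.inl rfl, _, hself h⟩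
    · refine ⟨_, Or.inr (Or.inr rfl), B.det, ?_⟩
      rw [pow_succ, h, sub_mul, Matrix.mul_self_fin_two, Matrix.smul_mul, one_mul]
      abel
  · obtain ⟨r, hr⟩ : ∃ r, B.charpoly.IsRoot r := by
      by_contra! hroot
      refine hirr (irreducible_of_degree_le_three_of_not_isRoot ?_ hroot)
      simp [Matrix.charpoly_natDegree_eq_dim]
    have hr' : r ^ 2 - B.trace * r + B.det = 0 := by
      simpa [Matrix.charpoly_fin_two, IsRoot.def] using hr
    rcases B.pow_char_eq_smul_one_or_self_of_isRoot hK hr' with h | h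
    · exact ⟨_, Or.inr (Or.inl rfl), h⟩
    · exact ⟨_, Or.inl rfl, _, hself h⟩

theorem PGLtwo.exists_pow_eq_one [CharP K p] (hK : ∀ y : K, y ^ p = y) (y : PGLtwo K) :
    ∃ k : ℕ, (k = p - 1 ∨ k = p ∨ k = p + 1) ∧ y ^ k = 1 := by
  obtain ⟨B, rfl⟩ := QuotientGroup.mk_surjective y
  obtain ⟨k, hk, c, hc⟩ := Matrix.exists_pow_eq_smul_one hK (B : Matrix (Fin 2) (Fin 2) K) B.isUnit
  refine ⟨k, hk, ?_⟩
  rw [← QuotientGroup.mk_pow, QuotientGroup.eq_one_iff, Subgroup.mem_center_iff]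
  intro g
  apply Units.ext
  simp [hc]

theorem Matrix.ProjectiveSpecialLinearGroup.exists_pow_eq_one [CharP K p]
    (hK : ∀ y : K, y ^ p = y) (y : ProjectiveSpecialLinearGroup (Fin 2) K) :
    ∃ k : ℕ, (k = p - 1 ∨ k = p ∨ k = p + 1) ∧ y ^ k = 1 := by
  obtain ⟨B, rfl⟩ := QuotientGroup.mk_surjective y
  obtain ⟨k, hk, c, hc⟩ := Matrix.exists_pow_eq_smul_one hK (B : Matrix (Fin 2) (Fin 2) K)
    ((Matrix.isUnit_iff_isUnit_det _).2 (by simp))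
  refine ⟨k, hk, ?_⟩
  rw [← QuotientGroup.mk_pow, QuotientGroup.eq_one_iff, Subgroup.mem_center_iff]
  intro g
  apply Subtype.ext
  simp [hc]

theorem Matrix.SpecialLinearGroup.trace_pow_char [CharP K p] (A : SpecialLinearGroup (Fin 2) K)
    {k : ℕ} (hk : k = p - 1 ∨ k = p ∨ k = p + 1)
    (hA : (QuotientGroup.mk A : ProjectiveSpecialLinearGroup (Fin 2) K) ^ k = 1) :
    A.1.trace ^ p = A.1.trace ∨ A.1.trace ^ p = -A.1.trace := by
  have hp : p.Prime := Fact.out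
  rw [← QuotientGroup.mk_pow, QuotientGroup.eq_one_iff, SpecialLinearGroup.mem_center_iff] at hA
  obtain ⟨ε, hε2, hε⟩ := hA
  have hε2 : ε * ε = 1 := by simpa [sq] using hε2
  have hε1 : ε = 1 ∨ ε = -1 := mul_self_eq_one_iff.1 hε2
  set M : Matrix (Fin 2) (Fin 2) K := A.1 with hM
  set t := M.trace with ht
  have hAk : M ^ k = ε • 1 := by
    rw [hM, ← SpecialLinearGroup.coe_pow, ← hε]
    simp [Matrix.smul_one_eq_diagonal]
  have hM2 : M * M = t • M - 1 := by
    rw [Matrix.mul_self_fin_two, A.2, one_smul]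
  have hMp : M ^ p * M ^ p = t ^ p • M ^ p - 1 := by
    have h := congrArg (· ^ p) hM2
    rw [sub_pow_char_of_commute p (Commute.one_right _), smul_pow, one_pow,
      (Commute.refl M).mul_pow] at h
    exact h
  have hne : M ≠ 0 := by
    intro h0
    have := A.2
    rw [← hM, h0] at this
    simp at this
  have hfinish : t = ε * t ^ p → t ^ p = t ∨ t ^ p = -t := by
    intro h
    rcases hε1 with rfl | rfl
    · left; linear_combination -h
    · right; linear_combination h
  rcases hk with rfl | rfl | rfl
  · have h1 : M ^ p = ε • M := by
      rw [← Nat.sub_add_cancel hp.one_le, pow_succ, hAk, Matrix.smul_mul, one_mul]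
    rw [h1] at hMp
    simp only [Matrix.smul_mul, Matrix.mul_smul, smul_smul, hε2, one_smul, hM2] at hMp
    have h2 : (t - ε * t ^ p) • M = 0 := by
      rw [sub_smul, sub_eq_zero, mul_comm]
      exact sub_left_injective hMp
    exact hfinish (sub_eq_zero.1 ((smul_eq_zero.1 h2).resolve_right hne))
  · rw [hAk] at hMp
    simp only [Matrix.smul_mul, one_mul, smul_smul, hε2, one_smul] at hMp
    have h2 : (1 : K) = t ^ k * ε - 1 := by
      simpa using congrFun (congrFun hMp 0) 0
    have h3 : t ^ k = 2 * ε := by linear_combination (-ε) * h2 - (t ^ k) * hε2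
    have h4 : (2 * ε) ^ k = 2 * ε := by
      rcases hε1 with rfl | rfl
      · have := map_ofNat (frobenius K k) 2
        rw [frobenius_def] at this
        simpa using this
      · have := map_neg (frobenius K k) 2
        rw [map_ofNat, frobenius_def] at this
        simpa using this
    left
    have h5 : t = 2 * ε := frobenius_inj K k (by rw [frobenius_def, frobenius_def, h3, h4])
    rw [h3, h5]
  · have h1 : M ^ p * M = ε • 1 := by rw [← pow_succ, hAk]
    have h1' : M * M ^ p = ε • 1 := by rw [← pow_succ', hAk]
    have h3 : M * (M ^ p * M ^ p) * M = 1 := by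
      rw [← mul_assoc, h1', mul_assoc, h1, Matrix.smul_mul, one_mul, smul_smul, hε2, one_smul]
    rw [hMp, mul_sub, sub_mul, mul_one, Matrix.mul_smul, h1', smul_smul, Matrix.smul_mul, one_mul,
      hM2, sub_sub_eq_add_sub, sub_eq_iff_eq_add, add_comm, add_left_cancel_iff] at h3
    have h2 : (t - ε * t ^ p) • M = 0 := by
      rw [sub_smul, sub_eq_zero, mul_comm ε, h3]
    exact hfinish (sub_eq_zero.1 ((smul_eq_zero.1 h2).resolve_right hne))

end PowerScalar

section Counting

variable {F : Type*} [Field F]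

theorem Matrix.SpecialLinearGroup.eq_or_apply_zero_zero_add_eq
    {A B : SpecialLinearGroup (Fin 2) F} (h01 : A 0 1 = B 0 1) (h10 : A 1 0 = B 1 0)
    (ht : A.1.trace = B.1.trace) : A = B ∨ A 0 0 + B 0 0 = A.1.trace := by
  have hA := A.2
  have hB := B.2
  rw [Matrix.det_fin_two] at hA hB
  change A 0 1 = B 0 1 at h01
  rw [Matrix.trace_fin_two, Matrix.trace_fin_two] at ht
  rw [Matrix.trace_fin_two]
  change A 0 0 * A 1 1 - A 0 1 * A 1 0 = 1 at hA
  change B 0 0 * B 1 1 - B 0 1 * B 1 0 = 1 at hB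
  change A 0 0 + A 1 1 = B 0 0 + B 1 1 at ht
  change A = B ∨ A 0 0 + B 0 0 = A 0 0 + A 1 1
  have key : (A 0 0 - B 0 0) * (A 1 1 - B 0 0) = 0 := by
    rw [h01, h10] at hA
    linear_combination hA - hB - B 0 0 * ht
  rcases mul_eq_zero.1 key with h | h
  · left
    have h00 : A 0 0 = B 0 0 := sub_eq_zero.1 h
    have h11 : A 1 1 = B 1 1 := by linear_combination ht - h00
    ext i j
    fin_cases i <;> fin_cases j <;> assumption
  · right
    linear_combination -h

variable [Fintype F] [DecidableEq F]

theorem Matrix.SpecialLinearGroup.card_filter_trace_mem_le (T : Finset F) :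
    (Finset.univ.filter fun A : SpecialLinearGroup (Fin 2) F => A.1.trace ∈ T).card ≤
      2 * (Fintype.card F ^ 2 * T.card) := by
  classical
  have h := Finset.card_le_mul_card_image_of_maps_to
    (s := Finset.univ.filter fun A : SpecialLinearGroup (Fin 2) F => A.1.trace ∈ T)
    (t := (Finset.univ : Finset (F × F)) ×ˢ T)
    (f := fun A => ((A 0 1, A 1 0), A.1.trace)) (by intro A hA; simpa using hA) 2 ?_
  · simpa [Finset.card_product, sq] using h
  · rintro ⟨⟨b, c⟩, t⟩ -
    by_contra! hlt
    obtain ⟨A, hA, B, hB, C, hC, hAB, hAC, hBC⟩ := Finset.two_lt_card.1 hlt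
    simp only [Finset.mem_filter, Finset.mem_univ, true_and, Prod.mk.injEq] at hA hB hC
    obtain ⟨-, ⟨hA1, hA2⟩, hA3⟩ := hA
    obtain ⟨-, ⟨hB1, hB2⟩, hB3⟩ := hB
    obtain ⟨-, ⟨hC1, hC2⟩, hC3⟩ := hC
    have e1 := (eq_or_apply_zero_zero_add_eq (hA1.trans hB1.symm) (hA2.trans hB2.symm)
      (hA3.trans hB3.symm)).resolve_left hAB
    have e2 := (eq_or_apply_zero_zero_add_eq (hA1.trans hC1.symm) (hA2.trans hC2.symm)
      (hA3.trans hC3.symm)).resolve_left hAC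
    have h00 : B 0 0 = C 0 0 := by linear_combination e1 - e2
    have h11 : B 1 1 = C 1 1 := by
      have := hB3.trans hC3.symm
      rw [Matrix.trace_fin_two, Matrix.trace_fin_two] at this
      change B 0 0 + B 1 1 = C 0 0 + C 1 1 at this
      linear_combination this - h00
    have h01 : B 0 1 = C 0 1 := hB1.trans hC1.symm
    have h10 : B 1 0 = C 1 0 := hB2.trans hC2.symm
    apply hBC
    ext i j
    fin_cases i <;> fin_cases j <;> assumption

theorem Matrix.SpecialLinearGroup.card_filter_trace_eq_zero_le [CharP F 2] :
    (Finset.univ.filter fun A : SpecialLinearGroup (Fin 2) F => A.1.trace = 0).card ≤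
      Fintype.card F ^ 2 := by
  have h := Finset.card_le_card_of_injOn
    (s := Finset.univ.filter fun A : SpecialLinearGroup (Fin 2) F => A.1.trace = 0)
    (t := (Finset.univ : Finset (F × F))) (fun A => (A 0 1, A 1 0)) (by simp) ?_
  · simpa [sq] using h
  · intro A hA B hB hAB
    simp only [Finset.coe_filter, Finset.mem_univ, true_and, Set.mem_ofPred_eq] at hA hB
    simp only [Prod.mk.injEq] at hAB
    rcases eq_or_apply_zero_zero_add_eq hAB.1 hAB.2 (hA.trans hB.symm) with h | h
    · exact h
    · rw [hA] at h
      have h00 : A 0 0 = B 0 0 := CharTwo.add_eq_zero.1 h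
      have h11 : A 1 1 = B 1 1 := by
        have := hA.trans hB.symm
        rw [Matrix.trace_fin_two, Matrix.trace_fin_two] at this
        change A 0 0 + A 1 1 = B 0 0 + B 1 1 at this
        linear_combination this - h00
      have h01 : A 0 1 = B 0 1 := hAB.1
      have h10 : A 1 0 = B 1 0 := hAB.2
      ext i j
      fin_cases i <;> fin_cases j <;> assumption

open Polynomial in
theorem card_filter_pow_eq_self_or_neg_le {p : ℕ} (hp : 2 ≤ p) :
    (Finset.univ.filter fun t : F => t ^ p = t ∨ t ^ p = -t).card ≤ 2 * p - 1 := by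
  have hdeg : (X ^ (2 * p - 1) - X : F[X]).natDegree = 2 * p - 1 :=
    FiniteField.X_pow_card_sub_X_natDegree_eq F (by omega)
  have hne : (X ^ (2 * p - 1) - X : F[X]) ≠ 0 := FiniteField.X_pow_card_sub_X_ne_zero F (by omega)
  calc _ ≤ (X ^ (2 * p - 1) - X : F[X]).roots.toFinset.card := by
        apply Finset.card_le_card
        intro t ht
        simp only [Finset.mem_filter, Finset.mem_univ, true_and] at ht
        rw [Multiset.mem_toFinset, mem_roots hne, IsRoot.def]
        simp only [eval_sub, eval_pow, eval_X]
        by_cases h0 : t = 0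
        · simp [h0, show 2 * p - 1 ≠ 0 by omega]
        · apply mul_right_cancel₀ h0
          rw [sub_mul, ← pow_succ, show 2 * p - 1 + 1 = p + p by omega, pow_add, zero_mul]
          rcases ht with ht | ht <;> rw [ht] <;> ring
    _ ≤ _ := (Multiset.toFinset_card_le _).trans ((card_roots' _).trans hdeg.le)

open Classical in
theorem Matrix.ProjectiveSpecialLinearGroup.card_le_of_trace_pow_char {p : ℕ} [Fact p.Prime]
    [CharP F p] (S : Finset (ProjectiveSpecialLinearGroup (Fin 2) F))
    (hS : ∀ A : SpecialLinearGroup (Fin 2) F,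
      (QuotientGroup.mk A : ProjectiveSpecialLinearGroup (Fin 2) F) ∈ S →
        A.1.trace ^ p = A.1.trace ∨ A.1.trace ^ p = -A.1.trace) :
    S.card ≤ (2 * p - 1) * Fintype.card F ^ 2 := by
  have hp : p.Prime := Fact.out
  set T : Finset F := Finset.univ.filter fun t : F => t ^ p = t ∨ t ^ p = -t with hT
  set U : Finset (SpecialLinearGroup (Fin 2) F) :=
    Finset.univ.filter fun A => A.1.trace ∈ T with hU
  let lift : ProjectiveSpecialLinearGroup (Fin 2) F → SpecialLinearGroup (Fin 2) F := Quotient.out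
  have hlift : ∀ x, (QuotientGroup.mk (lift x) : ProjectiveSpecialLinearGroup (Fin 2) F) = x :=
    fun x => QuotientGroup.out_eq' x
  have hmem : ∀ A : SpecialLinearGroup (Fin 2) F,
      (QuotientGroup.mk A : ProjectiveSpecialLinearGroup (Fin 2) F) ∈ S → A ∈ U := by
    intro A hA
    simpa [hU, hT] using hS A hA
  rcases eq_or_ne p 2 with rfl | hp2
  · have h1 : S.card ≤ U.card :=
      Finset.card_le_card_of_injOn lift (fun x hx => hmem _ (by rw [hlift]; exact hx))
        (Function.LeftInverse.injective hlift).injOn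
    have h2 : U ⊆ (Finset.univ.filter fun A : SpecialLinearGroup (Fin 2) F => A.1.trace = 0) ∪
        (Finset.univ.filter fun A : SpecialLinearGroup (Fin 2) F => A.1.trace ∈ ({1} : Finset F)) := by
      intro A hA
      simp only [hU, hT, Finset.mem_filter, Finset.mem_univ, true_and, CharTwo.neg_eq,
        or_self] at hA
      simp only [Finset.mem_union, Finset.mem_filter, Finset.mem_univ, true_and,
        Finset.mem_singleton]
      have : A.1.trace * (A.1.trace - 1) = 0 := by linear_combination hA
      simpa [sub_eq_zero] using this
    have h3 := (Finset.card_le_card h2).trans (Finset.card_union_le _ _)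
    have h4 := SpecialLinearGroup.card_filter_trace_eq_zero_le (F := F)
    have h5 := SpecialLinearGroup.card_filter_trace_mem_le ({1} : Finset F)
    simp only [Finset.card_singleton, mul_one] at h5
    omega
  · have hneg : (-1 : F) ≠ 1 := Ring.neg_one_ne_one_of_char_ne_two (by
      rw [ringChar.eq F p]; exact hp2)
    have hmk : ∀ A : SpecialLinearGroup (Fin 2) F,
        (QuotientGroup.mk (-A) : ProjectiveSpecialLinearGroup (Fin 2) F) = QuotientGroup.mk A := by
      intro A
      rw [QuotientGroup.eq, SpecialLinearGroup.mem_center_iff]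
      refine ⟨-1, by simp, ?_⟩
      have : (-A)⁻¹ * A = -1 := by
        rw [inv_mul_eq_iff_eq_mul]
        simp
      rw [this]
      ext i j
      fin_cases i <;> fin_cases j <;> simp
    have hne : ∀ A : SpecialLinearGroup (Fin 2) F, A ≠ -A := by
      intro A h
      have h1 : (-1 : SpecialLinearGroup (Fin 2) F) = 1 := by
        apply mul_right_cancel (b := A)
        simpa using h.symm
      apply hneg
      simpa using congrArg (fun B : SpecialLinearGroup (Fin 2) F => B 0 0) h1
    have h1 : (S ×ˢ (Finset.univ : Finset Bool)).card ≤ U.card := by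
      refine Finset.card_le_card_of_injOn (fun z => bif z.2 then lift z.1 else -lift z.1) ?_ ?_
      · rintro ⟨x, b⟩ hx
        have hx : x ∈ S := by simpa using hx
        apply hmem
        cases b <;> simpa [hmk, hlift] using hx
      · rintro ⟨x, b⟩ - ⟨y, c⟩ - hxy
        have hmkz : ∀ (x : ProjectiveSpecialLinearGroup (Fin 2) F) (b : Bool),
            (QuotientGroup.mk (bif b then lift x else -lift x) :
              ProjectiveSpecialLinearGroup (Fin 2) F) = x := by
          intro x b
          cases b <;> simp [hmk, hlift]
        have hx : x = y := by
          rw [← hmkz x b, ← hmkz y c]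
          exact congrArg _ hxy
        subst hx
        cases b <;> cases c <;> simp only [cond_true, cond_false] at hxy
        · rfl
        · exact (hne _ hxy.symm).elim
        · exact (hne _ hxy).elim
        · rfl
    have h2 := SpecialLinearGroup.card_filter_trace_mem_le T
    have h3 : T.card ≤ 2 * p - 1 := card_filter_pow_eq_self_or_neg_le hp.two_le
    rw [Finset.card_product, Finset.card_univ, Fintype.card_bool] at h1
    have h4 : Fintype.card F ^ 2 * T.card ≤ Fintype.card F ^ 2 * (2 * p - 1) :=
      Nat.mul_le_mul_left _ h3
    rw [mul_comm (2 * p - 1)]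
    have h5 : S.card * 2 ≤ 2 * (Fintype.card F ^ 2 * T.card) := by
      convert h1.trans h2
    omega

end Counting

theorem GaloisField.pow_char_eq_self (p : ℕ) [Fact p.Prime] (y : GaloisField p 1) : y ^ p = y := by
  have := Fintype.ofFinite (GaloisField p 1)
  have h := FiniteField.pow_card y
  rwa [← Nat.card_eq_fintype_card, GaloisField.card p 1 one_ne_zero, pow_one] at h

/-- for `q = p^f` with `f` prime, the number `n_sf(q)` of
nonidentity elements of `PSL(2,q)` lying in proper subfield-type subgroups
(isomorphic to `PSL(2,p^m)` for `m` a proper divisor of `f`, or `PGL(2,p^m)`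
for `2m ∣ f`) satisfies `n_sf(q) ≤ (2p−1)·q²`. -/
theorem stmt_11 (p f : ℕ) [Fact p.Prime] (hf : f.Prime)
    (q : ℕ) (hq : q = p ^ f) :
    {x : ProjectiveSpecialLinearGroup (Fin 2) (GaloisField p f) | x ≠ 1 ∧
      ∃ H : Subgroup (ProjectiveSpecialLinearGroup (Fin 2) (GaloisField p f)),
        H ≠ ⊤ ∧ x ∈ H ∧
        ((∃ m : ℕ, m ∣ f ∧ m < f ∧
            Nonempty (H ≃* ProjectiveSpecialLinearGroup (Fin 2) (GaloisField p m))) ∨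
         (∃ m : ℕ, 2 * m ∣ f ∧
            Nonempty (H ≃* PGLtwo (GaloisField p m))))}.ncard ≤
      (2 * p - 1) * q ^ 2 := by
  classical
  have := Fintype.ofFinite (GaloisField p f)
  have hcard : Fintype.card (GaloisField p f) = q := by
    rw [← Nat.card_eq_fintype_card, GaloisField.card p f hf.ne_zero, hq]
  have : Finite (ProjectiveSpecialLinearGroup (Fin 2) (GaloisField p f)) :=
    Quotient.finite _
  rw [← hcard, Set.ncard_eq_toFinset_card _ (Set.toFinite _)]
  refine ProjectiveSpecialLinearGroup.card_le_of_trace_pow_char _ fun A hA => ?_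
  rw [Set.Finite.mem_toFinset] at hA
  obtain ⟨-, H, -, hAH, hH⟩ := hA
  have hpow : ∃ k : ℕ, (k = p - 1 ∨ k = p ∨ k = p + 1) ∧
      (⟨QuotientGroup.mk A, hAH⟩ : H) ^ k = 1 := by
    rcases hH with ⟨m, hmf, hlt, ⟨e⟩⟩ | ⟨m, hmf, ⟨e⟩⟩
    · obtain rfl : m = 1 := (hf.eq_one_or_self_of_dvd m hmf).resolve_right hlt.ne
      obtain ⟨k, hk, h⟩ := ProjectiveSpecialLinearGroup.exists_pow_eq_one
        (GaloisField.pow_char_eq_self p) (e ⟨QuotientGroup.mk A, hAH⟩)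
      exact ⟨k, hk, e.injective (by rw [map_pow, h, map_one])⟩
    · obtain rfl : m = 1 := by
        refine (hf.eq_one_or_self_of_dvd m (dvd_of_mul_left_dvd hmf)).resolve_right ?_
        rintro rfl
        have := Nat.le_of_dvd hf.pos hmf
        have := hf.pos
        omega
      obtain ⟨k, hk, h⟩ := PGLtwo.exists_pow_eq_one
        (GaloisField.pow_char_eq_self p) (e ⟨QuotientGroup.mk A, hAH⟩)
      exact ⟨k, hk, e.injective (by rw [map_pow, h, map_one])⟩
  obtain ⟨k, hk, h⟩ := hpow
  exact SpecialLinearGroup.trace_pow_char A hk (by simpa using congrArg Subtype.val h)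
end

section
/- Let q = p^f be a prime power, G = PSL(2,q), n_sf(q) the number of nonidentity elements of G lying in proper subgroups of type PSL(2,p^m) (m | f, m < f) or PGL(2,p^m) (2m | f). Then n_sf(q) ≤ q²·((2p/(p−1))·(√q − 1) − 1). -/
open Matrix

open Polynomial

/-- Over an algebraically closed field, a `2 × 2` matrix has two eigenvalues (with multiplicity),
whose sum is the trace and whose product is the determinant. -/
lemma exists_eigenvalues_fin_two {L : Type*} [Field L] [IsAlgClosed L]
    (A : Matrix (Fin 2) (Fin 2) L) :
    ∃ α β : L, A.charpoly = (X - C α) * (X - C β) ∧ A.trace = α + β ∧ A.det = α * β := by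
  obtain ⟨α, hα⟩ := IsAlgClosed.exists_root A.charpoly
    (by rw [charpoly_degree_eq_dim]; simp)
  have h2 : α ^ 2 - A.trace * α + A.det = 0 := by
    simpa [charpoly_fin_two, IsRoot.def] using hα
  have hd : A.det = α * (A.trace - α) := by linear_combination h2
  refine ⟨α, A.trace - α, ?_, by ring, hd⟩
  rw [charpoly_fin_two, hd]
  simp only [map_sub, map_mul]
  ring

/-- If `(X - α) (X - β)` is the characteristic polynomial with `α ≠ β` and `α ^ N = β ^ N`, then
the `N`-th power of the matrix is scalar. -/
lemma pow_eq_scalar_of_eigenvalues {L : Type*} [Field L]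
    {A : Matrix (Fin 2) (Fin 2) L} {α β : L} (hA : A.charpoly = (X - C α) * (X - C β))
    (hne : α ≠ β) {N : ℕ} (hN : α ^ N = β ^ N) :
    A ^ N = algebraMap L _ (α ^ N) := by
  have hdvd : (X - C α) * (X - C β) ∣ (X ^ N - C (α ^ N) : L[X]) :=
    (isCoprime_X_sub_C_of_isUnit_sub (sub_ne_zero.2 hne).isUnit).mul_dvd
      (dvd_iff_isRoot.2 (by simp)) (dvd_iff_isRoot.2 (by simp [hN]))
  obtain ⟨g, hg⟩ := hdvd
  have := congrArg (aeval A) hg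
  rw [← hA, map_mul, aeval_self_charpoly, zero_mul] at this
  simpa [sub_eq_zero] using this

/-- Some power of an invertible `2 × 2` matrix over the field of size `p ^ m`, with exponent
`p`, `p ^ m - 1` or `p ^ m + 1`, is central. -/
lemma exists_pow_commute {K : Type*} [Field K] [Fintype K] {p m : ℕ} [Fact p.Prime] [CharP K p]
    (hK : Fintype.card K = p ^ m) (Y : Matrix (Fin 2) (Fin 2) K) (hY : Y.det ≠ 0) :
    ∃ N, (N = p ∨ N = p ^ m - 1 ∨ N = p ^ m + 1) ∧ ∀ M, Commute (Y ^ N) M := by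
  set φ := algebraMap K (AlgebraicClosure K)
  have : CharP (AlgebraicClosure K) p := charP_of_injective_algebraMap φ.injective p
  suffices h : ∃ N, (N = p ∨ N = p ^ m - 1 ∨ N = p ^ m + 1) ∧
      ∃ c, (φ.mapMatrix Y) ^ N = algebraMap (AlgebraicClosure K) _ c by
    obtain ⟨N, hN, c, hc⟩ := h
    refine ⟨N, hN, fun M ↦ ?_⟩
    have hinj : Function.Injective (φ.mapMatrix (m := Fin 2)) :=
      Matrix.map_injective φ.injective
    apply hinj
    rw [map_mul, map_mul, map_pow, hc]
    exact Algebra.commutes _ _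
  obtain ⟨α, β, hA, htr, hdet⟩ := exists_eigenvalues_fin_two (φ.mapMatrix Y)
  have htr' : φ Y.trace = α + β := by rw [← htr]; simp [Matrix.trace_fin_two]
  have hdet' : φ Y.det = α * β := by rw [← hdet, RingHom.map_det]
  have hαβ : α * β ≠ 0 := by rw [← hdet']; simpa using hY
  have hQ : p ^ m ≠ 0 := pow_ne_zero _ (Fact.out : p.Prime).ne_zero
  have hfix (x : K) : φ x ^ p ^ m = φ x := by rw [← map_pow, ← hK, FiniteField.pow_card]
  have hsum : α ^ p ^ m + β ^ p ^ m = α + β := by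
    rw [← add_pow_char_pow, ← htr', hfix]
  have hprod : α ^ p ^ m * β ^ p ^ m = α * β := by
    rw [← mul_pow, ← hdet', hfix]
  obtain rfl | hne := eq_or_ne α β
  · refine ⟨p, .inl rfl, α ^ p, ?_⟩
    have h0 : (φ.mapMatrix Y - algebraMap _ _ α) ^ 2 = 0 := by
      have := aeval_self_charpoly (φ.mapMatrix Y)
      rw [hA] at this
      simpa [sq] using this
    have h1 : (φ.mapMatrix Y - algebraMap _ _ α) ^ p = 0 :=
      pow_eq_zero_of_le (Fact.out : p.Prime).two_le h0
    rw [sub_pow_char_of_commute (p := p) (Algebra.commutes α (φ.mapMatrix Y)).symm] at h1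
    rw [map_pow]
    exact sub_eq_zero.1 h1
  have hcase : (α ^ p ^ m - α) * (α ^ p ^ m - β) = 0 := by
    linear_combination α ^ p ^ m * hsum - hprod
  obtain h | h := mul_eq_zero.1 hcase
  · have hα := sub_eq_zero.1 h
    have hβ : β ^ p ^ m = β := by linear_combination hsum - h
    have key (x : AlgebraicClosure K) (hx : x ≠ 0) (h : x ^ p ^ m = x) : x ^ (p ^ m - 1) = 1 := by
      apply mul_left_cancel₀ hx
      rw [mul_pow_sub_one hQ, h, mul_one]
    exact ⟨_, .inr (.inl rfl), _, pow_eq_scalar_of_eigenvalues hA hne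
      ((key α (left_ne_zero_of_mul hαβ) hα).trans (key β (right_ne_zero_of_mul hαβ) hβ).symm)⟩
  · have hα := sub_eq_zero.1 h
    have hβ : β ^ p ^ m = α := by linear_combination hsum - h
    exact ⟨_, .inr (.inr rfl), _, pow_eq_scalar_of_eigenvalues hA hne
      (by rw [pow_succ, pow_succ, hα, hβ, mul_comm])⟩

/-- A `2 × 2` matrix of determinant one with a power equal to a scalar `z`, `z ^ 2 = 1`, the
exponent being `p` or `p ^ m ± 1`, has a trace fixed up to sign by the `p ^ m`-Frobenius. -/
lemma trace_pow_eq {F : Type*} [Field F] {p m : ℕ} [Fact p.Prime] [CharP F p]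
    {A : Matrix (Fin 2) (Fin 2) F} (hA : A.det = 1) {N : ℕ}
    (hN : N = p ∨ N = p ^ m - 1 ∨ N = p ^ m + 1) {z : F} (hz : z ^ 2 = 1)
    (h : A ^ N = algebraMap F _ z) :
    A.trace ^ p ^ m = z * A.trace ∨ A.trace ^ p ^ m = A.trace := by
  set φ := algebraMap F (AlgebraicClosure F)
  have : CharP (AlgebraicClosure F) p := charP_of_injective_algebraMap φ.injective p
  have hQ : p ^ m ≠ 0 := pow_ne_zero _ (Fact.out : p.Prime).ne_zero
  obtain ⟨α, β, hch, htr, hdet⟩ := exists_eigenvalues_fin_two (φ.mapMatrix A)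
  have htr' : φ A.trace = α + β := by rw [← htr]; simp [Matrix.trace_fin_two]
  have hαβ : α * β = 1 := by rw [← hdet, ← RingHom.map_det, hA, map_one]
  have hpow : (φ.mapMatrix A) ^ N = algebraMap _ _ (φ z) := by
    rw [← map_pow, h]
    ext i j
    simp [Matrix.algebraMap_matrix_apply, apply_ite φ]
  have hroot (x : AlgebraicClosure F) (hx : (φ.mapMatrix A).charpoly.IsRoot x) : x ^ N = φ z := by
    have h1 := spectrum.pow_mem_pow (φ.mapMatrix A) N (Matrix.mem_spectrum_iff_isRoot_charpoly.2 hx)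
    rw [hpow, spectrum.scalar_eq] at h1
    exact h1
  have hα := hroot α (by rw [hch]; simp)
  have hβ := hroot β (by rw [hch]; simp)
  have hz' : φ z ^ 2 = 1 := by rw [← map_pow, hz, map_one]
  rw [← φ.injective.eq_iff, ← φ.injective.eq_iff, map_pow, map_mul, htr', add_pow_char_pow]
  obtain rfl | rfl | rfl := hN
  · have hzz : φ z ^ N = φ z ∧ φ z ^ N ^ m = φ z := by
      obtain h | h := mul_self_eq_one_iff.1 ((sq _).symm.trans hz')
      · simp [h]
      · simp [h, neg_one_pow_char, neg_one_pow_char_pow]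
    have heq (x : AlgebraicClosure F) (hx : x ^ N = φ z) : x = φ z :=
      frobenius_inj _ N (by rw [frobenius_def, frobenius_def, hx, hzz.1])
    rw [heq α hα, heq β hβ, hzz.2]
    exact .inr rfl
  · left
    rw [← mul_pow_sub_one hQ α, ← mul_pow_sub_one hQ β, hα, hβ]; ring
  · left
    rw [pow_succ] at hα hβ
    linear_combination β * hα + α * hβ - (α ^ p ^ m + β ^ p ^ m) * hαβ

/-- A crude bound for the number of matrices in `SL(2, F)` with given trace. -/
lemma card_trace_eq_le {F : Type*} [Field F] [Fintype F] (t : F) :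
    {A : SpecialLinearGroup (Fin 2) F | A.1.trace = t}.ncard ≤
      Fintype.card F ^ 2 + 2 * Fintype.card F := by
  classical
  let R : Finset F := (X ^ 2 - C t * X + C 1 : F[X]).roots.toFinset
  have hdeg : (X ^ 2 - C t * X + C 1 : F[X]).natDegree = 2 := by compute_degree!
  have hR : R.card ≤ 2 :=
    (Multiset.toFinset_card_le _).trans ((card_roots' _).trans hdeg.le)
  let T : Finset (F × F × F) :=
    Finset.univ.image (fun x : F × F ↦ (x.1, x.2, (x.1 * (t - x.1) - 1) / x.2)) ∪
      (R ×ˢ Finset.univ).image (fun x : F × F ↦ (x.1, 0, x.2))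
  have hT : T.card ≤ Fintype.card F ^ 2 + 2 * Fintype.card F := by
    refine (Finset.card_union_le _ _).trans (add_le_add ?_ ?_)
    · refine Finset.card_image_le.trans_eq ?_
      rw [Finset.card_univ, Fintype.card_prod, sq]
    · refine Finset.card_image_le.trans ?_
      rw [Finset.card_product, Finset.card_univ]
      exact Nat.mul_le_mul_right _ hR
  refine le_trans ?_ hT
  rw [← Set.ncard_coe_finset]
  refine Set.ncard_le_ncard_of_injOn (fun A ↦ (A 0 0, A 0 1, A 1 0)) ?_ ?_ (Finset.finite_toSet T)
  · intro A hA
    have hdet := A.det_coe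
    rw [Matrix.det_fin_two] at hdet
    have htr : A 0 0 + A 1 1 = t := by simpa [Matrix.trace_fin_two] using hA
    have hprod : A 0 0 * (t - A 0 0) - 1 = A 1 0 * A 0 1 := by
      linear_combination hdet - A 0 0 * htr
    rw [Finset.mem_coe, Finset.mem_union]
    by_cases hb : A 0 1 = 0
    · right
      refine Finset.mem_image.2 ⟨(A 0 0, A 1 0), ?_, by simp [hb]⟩
      have hne : (X ^ 2 - C t * X + C 1 : F[X]) ≠ 0 := by
        intro h
        rw [h, natDegree_zero] at hdeg
        exact absurd hdeg (by norm_num)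
      have : A 0 0 ^ 2 - t * A 0 0 + 1 = 0 := by
        linear_combination -hprod - A 1 0 * hb
      simpa only [R, Finset.mem_product, Multiset.mem_toFinset, mem_roots hne, IsRoot.def, eval_add,
        eval_sub, eval_mul, eval_pow, eval_X, eval_C, Finset.mem_univ, and_true] using this
    · left
      exact Finset.mem_image.2 ⟨(A 0 0, A 0 1), Finset.mem_univ _, by simp [hprod, hb]⟩
  · intro A hA B hB h
    have hA' : A 0 0 + A 1 1 = t := by simpa [Matrix.trace_fin_two] using hA
    have hB' : B 0 0 + B 1 1 = t := by simpa [Matrix.trace_fin_two] using hB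
    simp only [Prod.mk.injEq] at h
    obtain ⟨h1, h2, h3⟩ := h
    have h4 : A 1 1 = B 1 1 := by linear_combination hA' - hB' - h1
    ext i j
    fin_cases i <;> fin_cases j <;> assumption

/-- The number of matrices in `SL(2, F)` whose trace `t` satisfies `t ^ Q = z * t`. -/
lemma card_trace_pow_eq_le {F : Type*} [Field F] [Fintype F] {Q : ℕ} (hQ : 1 < Q) (z : F) :
    {A : SpecialLinearGroup (Fin 2) F | A.1.trace ^ Q = z * A.1.trace}.ncard ≤
      Q * (Fintype.card F ^ 2 + 2 * Fintype.card F) := by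
  classical
  have hdeg : (X ^ Q - C z * X : F[X]).natDegree = Q := by
    rw [natDegree_sub_eq_left_of_natDegree_lt] <;> rw [natDegree_X_pow]
    exact ((natDegree_C_mul_le _ _).trans natDegree_X_le).trans_lt hQ
  have hne : (X ^ Q - C z * X : F[X]) ≠ 0 := by
    intro h
    rw [h, natDegree_zero] at hdeg
    omega
  let R : Finset F := (X ^ Q - C z * X : F[X]).roots.toFinset
  have hR : R.card ≤ Q :=
    (Multiset.toFinset_card_le _).trans ((card_roots' _).trans hdeg.le)
  have hsub : {A : SpecialLinearGroup (Fin 2) F | A.1.trace ^ Q = z * A.1.trace} ⊆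
      ⋃ t ∈ R, {A : SpecialLinearGroup (Fin 2) F | A.1.trace = t} := by
    intro A hA
    simpa [R, hne, sub_eq_zero] using hA
  calc _ ≤ _ := Set.ncard_le_ncard hsub (Set.toFinite _)
    _ ≤ ∑ t ∈ R, {A : SpecialLinearGroup (Fin 2) F | A.1.trace = t}.ncard :=
      Finset.set_ncard_biUnion_le _ _
    _ ≤ R.card * (Fintype.card F ^ 2 + 2 * Fintype.card F) := by
      rw [← smul_eq_mul]
      exact Finset.sum_le_card_nsmul _ _ _ fun t _ ↦ card_trace_eq_le t
    _ ≤ _ := Nat.mul_le_mul_right _ hR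

/-- Bound for a set of elements of `PSL(2, F)` each of which is killed by one of `p`,
`p ^ m - 1`, `p ^ m + 1` for some `m` in a given set of positive exponents. -/
lemma ncard_le_of_pow_eq_one {F : Type*} [Field F] [Fintype F] {p : ℕ} [Fact p.Prime] [CharP F p]
    (D : Finset ℕ) (hD : ∀ m ∈ D, m ≠ 0)
    (S : Set (ProjectiveSpecialLinearGroup (Fin 2) F))
    (hS : ∀ x ∈ S, ∃ m ∈ D, ∃ N, (N = p ∨ N = p ^ m - 1 ∨ N = p ^ m + 1) ∧ x ^ N = 1) :
    S.ncard ≤ (∑ m ∈ D, p ^ m) * (Fintype.card F ^ 2 + 2 * Fintype.card F) := by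
  classical
  let Z := Subgroup.center (SpecialLinearGroup (Fin 2) F)
  have hcard : ((QuotientGroup.mk : _ → SpecialLinearGroup (Fin 2) F ⧸ Z) ⁻¹' S).ncard =
      Nat.card Z * S.ncard := by
    rw [← Nat.card_coe_set_eq, Nat.card_congr (QuotientGroup.preimageMkEquivSubgroupProdSet Z S),
      Nat.card_prod, Nat.card_coe_set_eq]
  have hsub : ((QuotientGroup.mk : _ → SpecialLinearGroup (Fin 2) F ⧸ Z) ⁻¹' S) ⊆
      ⋃ y ∈ D ×ˢ (Finset.univ : Finset Z), {A : SpecialLinearGroup (Fin 2) F |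
        A.1.trace ^ p ^ y.1 = (y.2 : SpecialLinearGroup (Fin 2) F) 0 0 * A.1.trace} := by
    intro A hA
    obtain ⟨m, hm, N, hN, hpow⟩ := hS _ hA
    have hmem : A ^ N ∈ Z := (QuotientGroup.eq_one_iff _).1 hpow
    obtain ⟨r, hr, hrA⟩ := Matrix.SpecialLinearGroup.mem_center_iff.1 hmem
    have htr := trace_pow_eq (p := p) (m := m) A.2 hN (z := r) (by simpa using hr)
      (by rw [← Matrix.SpecialLinearGroup.coe_pow, ← hrA]; rfl)
    simp only [Set.mem_iUnion]
    obtain h | h := htr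
    · refine ⟨(m, ⟨_, hmem⟩), by simp [hm], ?_⟩
      rw [Set.mem_ofPred_eq, h, ← hrA]
      simp
    · exact ⟨(m, 1), by simp [hm], by simpa using h⟩
  have hpos : 0 < Nat.card Z := Nat.card_pos
  refine Nat.le_of_mul_le_mul_left ?_ hpos
  rw [← hcard]
  calc _ ≤ _ := Set.ncard_le_ncard hsub (Set.toFinite _)
    _ ≤ _ := Finset.set_ncard_biUnion_le _ _
    _ ≤ ∑ y ∈ D ×ˢ (Finset.univ : Finset Z),
        p ^ y.1 * (Fintype.card F ^ 2 + 2 * Fintype.card F) :=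
      Finset.sum_le_sum fun y hy ↦ card_trace_pow_eq_le
        (Nat.one_lt_pow (hD _ (Finset.mem_product.1 hy).1) (Fact.out : p.Prime).one_lt) _
    _ = _ := by
      rw [Finset.sum_product]
      simp only [Finset.sum_const, Finset.card_univ, smul_eq_mul, Nat.card_eq_fintype_card,
        ← Finset.sum_mul, ← Finset.mul_sum]

/-- Elements of `PSL(2, K)` are killed by `p`, `p ^ m - 1` or `p ^ m + 1`, where `|K| = p ^ m`. -/
lemma psl_exists_pow_eq_one {K : Type*} [Field K] [Fintype K] {p m : ℕ} [Fact p.Prime] [CharP K p]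
    (hK : Fintype.card K = p ^ m) (y : ProjectiveSpecialLinearGroup (Fin 2) K) :
    ∃ N, (N = p ∨ N = p ^ m - 1 ∨ N = p ^ m + 1) ∧ y ^ N = 1 := by
  obtain ⟨A, rfl⟩ := QuotientGroup.mk_surjective y
  obtain ⟨N, hN, hcomm⟩ := exists_pow_commute hK A.1 (by simp)
  refine ⟨N, hN, (QuotientGroup.eq_one_iff (A ^ N)).2 (Subgroup.mem_center_iff.2 fun B ↦ ?_)⟩
  apply Subtype.ext
  simpa using (hcomm B.1).eq.symm

/-- Elements of `PGL(2, K)` are killed by `p`, `p ^ m - 1` or `p ^ m + 1`, where `|K| = p ^ m`. -/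
lemma pgl_exists_pow_eq_one {K : Type*} [Field K] [Fintype K] {p m : ℕ} [Fact p.Prime] [CharP K p]
    (hK : Fintype.card K = p ^ m) (y : PGLtwo K) :
    ∃ N, (N = p ∨ N = p ^ m - 1 ∨ N = p ^ m + 1) ∧ y ^ N = 1 := by
  obtain ⟨A, rfl⟩ := QuotientGroup.mk_surjective y
  obtain ⟨N, hN, hcomm⟩ := exists_pow_commute hK A.1 (A.isUnit.map Matrix.detMonoidHom).ne_zero
  refine ⟨N, hN, (QuotientGroup.eq_one_iff (A ^ N)).2 (Subgroup.mem_center_iff.2 fun B ↦ ?_)⟩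
  apply Units.ext
  simpa using (hcomm B.1).eq.symm

/-- Geometric bound for the sum of `p ^ m` over the proper divisors of `f`. -/
lemma sum_properDivisors_pow_le {p f : ℕ} (hp : 2 ≤ p) :
    (∑ m ∈ f.properDivisors, (p : ℝ) ^ m) ≤ p / (p - 1) * (√((p : ℝ) ^ f) - 1) := by
  have hp' : (2 : ℝ) ≤ p := by exact_mod_cast hp
  have hsub : f.properDivisors ⊆ Finset.Ico 1 (f / 2 + 1) := by
    intro m hm
    obtain ⟨⟨k, rfl⟩, hlt⟩ := Nat.mem_properDivisors.1 hm
    have hm0 := Nat.pos_of_mem_properDivisors hm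
    have hk : 2 ≤ k := by
      by_contra! hk
      have : m * k ≤ m * 1 := Nat.mul_le_mul_left m (by omega)
      omega
    rw [Finset.mem_Ico]
    refine ⟨hm0, Nat.lt_succ_of_le ((Nat.le_div_iff_mul_le two_pos).2 ?_)⟩
    exact Nat.mul_le_mul_left m hk
  have hsqrt : (p : ℝ) ^ (f / 2) ≤ √((p : ℝ) ^ f) := by
    apply Real.le_sqrt_of_sq_le
    rw [← pow_mul]
    exact pow_le_pow_right₀ (by linarith) (Nat.div_mul_le_self f 2)
  calc _ ≤ ∑ m ∈ Finset.Ico 1 (f / 2 + 1), (p : ℝ) ^ m :=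
      Finset.sum_le_sum_of_subset_of_nonneg hsub fun _ _ _ ↦ by positivity
    _ = p / (p - 1) * ((p : ℝ) ^ (f / 2) - 1) := by
      rw [geom_sum_Ico (by linarith) (by omega)]
      ring
    _ ≤ _ := by
      gcongr
      exact div_nonneg (by linarith) (by linarith)

/-- for `q = p^f`, the number `n_sf(q)` of nonidentity elements of
`PSL(2,q)` lying in proper subgroups of type `PSL(2,p^m)` (`m ∣ f`, `m < f`) or
`PGL(2,p^m)` (`2m ∣ f`) satisfies
`n_sf(q) ≤ q² ⬝ ((2p/(p−1)) ⬝ (√q − 1) − 1)`. -/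
theorem stmt_12 (p f : ℕ) [Fact p.Prime] (hf : f ≠ 0)
    (q : ℕ) (hq : q = p ^ f) :
    (({x : ProjectiveSpecialLinearGroup (Fin 2) (GaloisField p f) | x ≠ 1 ∧
      ∃ H : Subgroup (ProjectiveSpecialLinearGroup (Fin 2) (GaloisField p f)),
        H ≠ ⊤ ∧ x ∈ H ∧
        ((∃ m : ℕ, m ∣ f ∧ m < f ∧
            Nonempty (H ≃* ProjectiveSpecialLinearGroup (Fin 2) (GaloisField p m))) ∨
         (∃ m : ℕ, 2 * m ∣ f ∧
            Nonempty (H ≃* PGLtwo (GaloisField p m))))}.ncard : ℝ)) ≤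
      (q : ℝ) ^ 2 * ((2 * (p : ℝ) / ((p : ℝ) - 1)) * (Real.sqrt q - 1) - 1) := by
  have hp : p.Prime := Fact.out
  have hp2 : (2 : ℝ) ≤ p := by exact_mod_cast hp.two_le
  have : Fintype (GaloisField p f) := Fintype.ofFinite _
  have hcard : Fintype.card (GaloisField p f) = q := by
    rw [← Nat.card_eq_fintype_card, GaloisField.card p f hf, hq]
  set S := {x : ProjectiveSpecialLinearGroup (Fin 2) (GaloisField p f) | x ≠ 1 ∧
      ∃ H : Subgroup (ProjectiveSpecialLinearGroup (Fin 2) (GaloisField p f)),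
        H ≠ ⊤ ∧ x ∈ H ∧
        ((∃ m : ℕ, m ∣ f ∧ m < f ∧
            Nonempty (H ≃* ProjectiveSpecialLinearGroup (Fin 2) (GaloisField p m))) ∨
         (∃ m : ℕ, 2 * m ∣ f ∧
            Nonempty (H ≃* PGLtwo (GaloisField p m))))}
  have hS : ∀ x ∈ S, ∃ m ∈ f.properDivisors, ∃ N,
      (N = p ∨ N = p ^ m - 1 ∨ N = p ^ m + 1) ∧ x ^ N = 1 := by
    rintro x ⟨-, H, -, hx, ⟨m, hmf, hlt, ⟨e⟩⟩ | ⟨m, hmf, ⟨e⟩⟩⟩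
    all_goals
      have hm0 : m ≠ 0 := by
        rintro rfl
        simp_all
      have : Fintype (GaloisField p m) := Fintype.ofFinite _
      have hK : Fintype.card (GaloisField p m) = p ^ m := by
        rw [← Nat.card_eq_fintype_card, GaloisField.card p m hm0]
    · obtain ⟨N, hN, h⟩ := psl_exists_pow_eq_one hK (e ⟨x, hx⟩)
      rw [← map_pow, EmbeddingLike.map_eq_one_iff] at h
      exact ⟨m, Nat.mem_properDivisors.2 ⟨hmf, hlt⟩, N, hN, congrArg Subtype.val h⟩
    · obtain ⟨N, hN, h⟩ := pgl_exists_pow_eq_one hK (e ⟨x, hx⟩)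
      rw [← map_pow, EmbeddingLike.map_eq_one_iff] at h
      have := Nat.le_of_dvd (Nat.pos_of_ne_zero hf) hmf
      exact ⟨m, Nat.mem_properDivisors.2 ⟨dvd_of_mul_left_dvd hmf, by omega⟩, N, hN,
        congrArg Subtype.val h⟩
  have hle := ncard_le_of_pow_eq_one f.properDivisors
    (fun m hm ↦ (Nat.pos_of_mem_properDivisors hm).ne') S hS
  rw [hcard] at hle
  have hsum := sum_properDivisors_pow_le (f := f) hp.two_le
  have hleR : (S.ncard : ℝ) ≤ (∑ m ∈ f.properDivisors, (p : ℝ) ^ m) * ((q : ℝ) ^ 2 + 2 * q) := by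
    exact_mod_cast hle
  have hqR : (q : ℝ) = (p : ℝ) ^ f := by exact_mod_cast hq
  obtain rfl | hf1 := eq_or_ne f 1
  · have h0 : S.ncard = 0 := by simpa using hle
    have hp1 : (0 : ℝ) < p - 1 := by linarith
    have hs : √(q : ℝ) ^ 2 = p := by rw [Real.sq_sqrt (by positivity), hqR, pow_one]
    have hs1 : 1 ≤ √(q : ℝ) := Real.one_le_sqrt.2 (by rw [hqR, pow_one]; linarith)
    have : 1 ≤ 2 * (p : ℝ) / (p - 1) * (√(q : ℝ) - 1) := by
      rw [div_mul_eq_mul_div, le_div_iff₀ hp1, ← hs]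
      nlinarith [mul_nonneg (sub_nonneg.2 hs1) (sub_nonneg.2 hs1)]
    rw [h0, Nat.cast_zero]
    exact mul_nonneg (by positivity) (sub_nonneg.2 this)
  have hq2 : (p : ℝ) ^ 2 ≤ q := by
    rw [hqR]
    exact pow_le_pow_right₀ (by linarith) (by omega)
  rw [← hqR] at hsum
  set B := (p : ℝ) / (p - 1) * (√(q : ℝ) - 1) with hB
  have hB2 : 2 ≤ B := by
    have : (p : ℝ) - 1 ≤ √(q : ℝ) - 1 := by
      gcongr
      exact Real.le_sqrt_of_sq_le hq2
    calc (2 : ℝ) ≤ p := hp2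
      _ = p / (p - 1) * (p - 1) := by field_simp [show (p : ℝ) - 1 ≠ 0 by linarith]
      _ ≤ B := mul_le_mul_of_nonneg_left this (div_nonneg (by linarith) (by linarith))
  have hq4 : (4 : ℝ) ≤ q := by nlinarith
  rw [show (2 * (p : ℝ) / (p - 1)) * (√(q : ℝ) - 1) = 2 * B by rw [hB]; ring]
  refine hleR.trans ((mul_le_mul_of_nonneg_right hsum (by positivity)).trans ?_)
  nlinarith [mul_nonneg (sub_nonneg.2 hB2)
    (mul_nonneg (sub_nonneg.2 hq4) (by linarith : (0 : ℝ) ≤ q))]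
end

section
/- Let q be a prime power, G = PSL(2,q), and s ∈ G an element of order greater than 5. Then the number of g ∈ G with ⟨g, s⟩ = G is greater than |G|/2. -/
open Matrix

namespace FixedPointCount

open MulAction

variable {P X : Type*} [Group P] [MulAction P X]

/-- The identity together with the group elements whose only fixed point is `x`. -/
def parabolicSet (P : Type*) [Group P] {X : Type*} [MulAction P X] (x : X) : Set P :=
  {g | g = 1 ∨ ∀ y, g • y = y ↔ y = x}

/-- Every nontrivial element has exactly one or exactly two fixed points. -/
def HasOneOrTwoFixedPoints (P : Type*) [Group P] (X : Type*) [MulAction P X] : Prop :=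
  ∀ g : P, g ≠ 1 → (∃ x : X, ∀ y, g • y = y ↔ y = x) ∨
    ∃ x x' : X, x ≠ x' ∧ ∀ y, g • y = y ↔ y = x ∨ y = x'

lemma ncard_parabolicSet_smul (g : P) (x : X) :
    (parabolicSet P (g • x)).ncard = (parabolicSet P x).ncard := by
  have : parabolicSet P (g • x) = (MulAut.conj g) '' parabolicSet P x := by
    ext u
    simp only [parabolicSet, Set.mem_ofPred_eq, Set.mem_image, MulAut.conj_apply]
    constructor
    · intro h
      refine ⟨g⁻¹ * u * g, ?_, by group⟩
      rcases h with rfl | h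
      · left; group
      · right
        intro y
        rw [mul_smul, mul_smul, inv_smul_eq_iff, h, smul_left_cancel_iff]
    · rintro ⟨v, hv, rfl⟩
      rcases hv with rfl | hv
      · left; group
      · right
        intro y
        rw [mul_smul, mul_smul, ← eq_inv_smul_iff (g := g), hv, inv_smul_eq_iff]
  rw [this, Set.ncard_image_of_injective _ (MulAut.conj g).injective]

lemma ncard_parabolicSet_of_mem_orbit {x y : X} (h : y ∈ orbit P x) :
    (parabolicSet P y).ncard = (parabolicSet P x).ncard := by
  obtain ⟨g, rfl⟩ := h
  exact ncard_parabolicSet_smul g x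

lemma card_stabilizer_of_mem_orbit [Finite P] {x y : X} (h : y ∈ orbit P x) :
    Nat.card (stabilizer P y) = Nat.card (stabilizer P x) :=
  Nat.card_congr (stabilizerEquivStabilizerOfOrbitRel h).toEquiv

lemma ncard_orbit_mul_card_stabilizer [Finite P] (x : X) :
    (orbit P x).ncard * Nat.card (stabilizer P x) = Nat.card P := by
  have := Nat.card_congr (orbitProdStabilizerEquivGroup P x)
  rwa [Nat.card_prod] at this

lemma one_le_ncard_parabolicSet [Finite P] (x : X) : 1 ≤ (parabolicSet P x).ncard :=
  (Set.ncard_pos (Set.toFinite _)).2 ⟨1, Or.inl rfl⟩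

lemma finite_orbit [Finite P] (x : X) : (orbit P x).Finite := Set.finite_range _

lemma parabolicSet_subset_stabilizer (x : X) :
    parabolicSet P x ⊆ (stabilizer P x : Set P) := by
  rintro g (rfl | h)
  · exact one_mem _
  · exact (h x).2 rfl

/-- Number of nontrivial elements fixing `x`, those fixing only `x` counted twice. -/
noncomputable def weight (P : Type*) [Group P] {X : Type*} [MulAction P X] (x : X) : ℕ :=
  (Nat.card (stabilizer P x) - 1) + ((parabolicSet P x).ncard - 1)

/-- The points fixed by some nontrivial element. -/
def nonfree (P : Type*) [Group P] (X : Type*) [MulAction P X] : Set X :=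
  {x | stabilizer P x ≠ ⊥}

lemma nonfree_finite [Finite P] (hD : HasOneOrTwoFixedPoints P X) : (nonfree P X).Finite := by
  have : nonfree P X ⊆ ⋃ g ∈ {g : P | g ≠ 1}, {x | g • x = x} := by
    intro x hx
    obtain ⟨⟨g, hg⟩, hg1⟩ := (Subgroup.ne_bot_iff_exists_ne_one.1 hx)
    simp only [Set.mem_iUnion]
    exact ⟨g, by simpa [Subtype.ext_iff] using hg1, hg⟩
  refine (Set.Finite.biUnion (Set.toFinite _) fun g hg => ?_).subset this
  rcases hD g hg with ⟨x, h⟩ | ⟨x, x', -, h⟩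
  · exact (Set.finite_singleton x).subset fun y hy => (h y).1 hy
  · exact (Set.toFinite {x, x'}).subset fun y hy => by simpa using (h y).1 hy

lemma weight_eq_zero [Finite P] {x : X} (hx : x ∉ nonfree P X) : weight P x = 0 := by
  have hb : stabilizer P x = ⊥ := by simpa [nonfree] using hx
  have h1 : (parabolicSet P x).ncard ≤ 1 := by
    rw [Set.ncard_le_one_iff]
    intro a b ha hb'
    have ha := parabolicSet_subset_stabilizer x ha
    have hb' := parabolicSet_subset_stabilizer x hb'
    simp only [hb, Subgroup.coe_bot, Set.mem_singleton_iff] at ha hb'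
    rw [ha, hb']
  simp [weight, hb, h1]

open Classical in
lemma sum_weight [Finite P] (hD : HasOneOrTwoFixedPoints P X) :
    ∑ x ∈ (nonfree_finite hD).toFinset, weight P x = 2 * (Nat.card P - 1) := by
  have := Fintype.ofFinite P
  set S := (nonfree_finite hD).toFinset
  set T : Finset P := Finset.univ.erase 1
  have hmem : ∀ g : P, g ≠ 1 → ∀ x : X, g • x = x → x ∈ S := by
    intro g hg x hx
    simp only [S, Set.Finite.mem_toFinset, nonfree, Set.mem_ofPred_eq]
    intro hb
    have : g ∈ stabilizer P x := hx
    rw [hb] at this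
    exact hg this
  have hw : ∀ x : X, weight P x = ∑ g ∈ T, ((if g • x = x then 1 else 0) +
      (if ∀ y : X, g • y = y ↔ y = x then 1 else 0)) := by
    intro x
    rw [Finset.sum_add_distrib, weight]
    congr 1
    · rw [← Finset.card_filter, ← SetLike.coe_sort_coe, Nat.card_coe_set_eq,
        Set.ncard_eq_toFinset_card', ← Finset.card_erase_of_mem (a := 1) (by simp)]
      congr 1
      ext g
      simp [T]
    · rw [← Finset.card_filter, Set.ncard_eq_toFinset_card',
        ← Finset.card_erase_of_mem (a := 1)
          (Set.mem_toFinset.2 (show (1 : P) ∈ parabolicSet P x from Or.inl rfl))]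
      congr 1
      ext g
      simp only [Finset.mem_erase, Set.mem_toFinset, T, Finset.mem_filter, Finset.mem_univ,
        and_true]
      exact and_congr_right fun hg => or_iff_right hg
  simp_rw [hw]
  rw [Finset.sum_comm]
  have : ∀ g ∈ T, ∑ x ∈ S, ((if g • x = x then 1 else 0) +
      (if ∀ y : X, g • y = y ↔ y = x then 1 else 0)) = 2 := by
    intro g hg
    have hg1 : g ≠ 1 := by simpa [T] using hg
    rw [Finset.sum_add_distrib, ← Finset.card_filter, ← Finset.card_filter]
    rcases hD g hg1 with ⟨x, h⟩ | ⟨x, x', hne, h⟩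
    · have e1 : S.filter (fun y => g • y = y) = {x} := by
        ext y
        simp only [Finset.mem_filter, Finset.mem_singleton, h]
        exact ⟨fun h => h.2, fun hy => ⟨hmem g hg1 y ((h y).2 hy), hy⟩⟩
      have e2 : S.filter (fun z => ∀ y, g • y = y ↔ y = z) = {x} := by
        ext z
        simp only [Finset.mem_filter, Finset.mem_singleton, h]
        constructor
        · rintro ⟨-, hz⟩
          exact (hz z).2 rfl
        · rintro rfl
          exact ⟨hmem g hg1 _ ((h _).2 rfl), fun _ => Iff.rfl⟩
      rw [e1, e2]; rfl
    · have e1 : S.filter (fun y => g • y = y) = {x, x'} := by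
        ext y
        simp only [Finset.mem_filter, Finset.mem_singleton, h, Finset.mem_insert]
        exact ⟨fun h => h.2, fun hy => ⟨hmem g hg1 y ((h y).2 hy), hy⟩⟩
      have e2 : S.filter (fun z => ∀ y, g • y = y ↔ y = z) = ∅ := by
        ext z
        simp only [Finset.mem_filter, h, Finset.notMem_empty, iff_false, not_and]
        intro _ hz
        exact hne (((hz x).1 (Or.inl rfl)).trans ((hz x').1 (Or.inr rfl)).symm)
      rw [e1, e2, Finset.card_pair hne]; rfl
  rw [Finset.sum_congr rfl this]
  simp [T, Finset.card_erase_of_mem, mul_comm]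

lemma ncard_orbit_mul_weight [Finite P] (x : X) :
    (orbit P x).ncard * weight P x + 2 * (orbit P x).ncard =
      Nat.card P + (orbit P x).ncard * (parabolicSet P x).ncard := by
  have h1 := ncard_orbit_mul_card_stabilizer (P := P) x
  have h2 := one_le_ncard_parabolicSet (P := P) x
  have h3 : 1 ≤ Nat.card (stabilizer P x) := Nat.card_pos
  rw [← h1, weight]
  zify [h2, h3]
  ring

lemma weight_of_mem_orbit [Finite P] {x y : X} (h : y ∈ orbit P x) :
    weight P y = weight P x := by
  rw [weight, weight, card_stabilizer_of_mem_orbit h, ncard_parabolicSet_of_mem_orbit h]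

open Classical in
lemma sum_biUnion_orbit [Finite P] (T : Finset X)
    (hT : ∀ x ∈ T, ∀ y ∈ T, y ∈ orbit P x → x = y) :
    ∑ y ∈ T.biUnion (fun x => (finite_orbit (P := P) x).toFinset), weight P y =
      ∑ x ∈ T, (orbit P x).ncard * weight P x := by
  rw [Finset.sum_biUnion]
  · refine Finset.sum_congr rfl fun x _ => ?_
    rw [Finset.sum_congr rfl (g := fun _ => weight P x), Finset.sum_const,
      Set.ncard_eq_toFinset_card _ (finite_orbit x), smul_eq_mul]
    intro y hy
    exact weight_of_mem_orbit (by simpa using hy)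
  · intro x hx y hy hxy
    simp only [Function.onFun]
    rw [Finset.disjoint_left]
    intro z hz hz'
    simp only [Set.Finite.mem_toFinset] at hz hz'
    apply hxy (hT x hx y hy _)
    rw [← orbit_eq_iff.2 hz, orbit_eq_iff.2 hz']
    exact mem_orbit_self y

/-- Points in distinct orbits contribute at most the total number of fixed points. -/
lemma sum_orbits_le [Finite P] (hD : HasOneOrTwoFixedPoints P X) (T : Finset X)
    (hT : ∀ x ∈ T, ∀ y ∈ T, y ∈ orbit P x → x = y) :
    ∑ x ∈ T, (orbit P x).ncard * weight P x ≤ 2 * (Nat.card P - 1) := by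
  classical
  rw [← sum_biUnion_orbit T hT, ← sum_weight hD]
  rw [← Finset.sum_subset (s₁ := (T.biUnion (fun x => (finite_orbit (P := P) x).toFinset)).filter
    (fun y => y ∈ nonfree P X)) (Finset.filter_subset _ _)]
  · refine Finset.sum_le_sum_of_subset fun y hy => ?_
    simpa using (Finset.mem_filter.1 hy).2
  · intro y hy hy'
    exact weight_eq_zero fun h => hy' (Finset.mem_filter.2 ⟨hy, h⟩)

/-- Representatives of all non-free orbits account for all fixed points. -/
lemma sum_orbits_eq [Finite P] (hD : HasOneOrTwoFixedPoints P X) (T : Finset X)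
    (hT : ∀ x ∈ T, ∀ y ∈ T, y ∈ orbit P x → x = y)
    (hcov : ∀ y ∈ nonfree P X, ∃ x ∈ T, y ∈ orbit P x) :
    ∑ x ∈ T, (orbit P x).ncard * weight P x = 2 * (Nat.card P - 1) := by
  classical
  refine le_antisymm (sum_orbits_le hD T hT) ?_
  rw [← sum_biUnion_orbit T hT, ← sum_weight hD]
  refine Finset.sum_le_sum_of_subset fun y hy => ?_
  obtain ⟨x, hx, hy'⟩ := hcov y (by simpa using hy)
  exact Finset.mem_biUnion.2 ⟨x, hx, by simpa using hy'⟩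

lemma two_le_card_stabilizer [Finite P] {x : X} (hx : x ∈ nonfree P X) :
    2 ≤ Nat.card (stabilizer P x) := by
  have := (Subgroup.one_lt_card_iff_ne_bot (stabilizer P x)).2 hx
  omega

lemma orderOf_le_card_stabilizer [Finite P] {s : P} {x : X} (h : s • x = x) :
    orderOf s ≤ Nat.card (stabilizer P x) :=
  Subgroup.orderOf_le_card (stabilizer P x) (Set.toFinite _) h

/-- `P` fixes no point, and preserves no pair of points fixed by `s`. -/
structure IsNondegenerate (P X : Type*) [Group P] [MulAction P X] (s : P) : Prop where
  not_fixed : ∀ x : X, ∃ g : P, g • x ≠ x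
  not_pair : ∀ z z' : X, z ≠ z' → s • z = z → s • z' = z' →
    ¬ ∀ g : P, (g • z = z ∨ g • z = z') ∧ (g • z' = z ∨ g • z' = z')

lemma two_le_ncard_orbit [Finite P] {s : P} (hP : IsNondegenerate P X s) (x : X) :
    2 ≤ (orbit P x).ncard := by
  obtain ⟨g, hg⟩ := hP.not_fixed x
  have := (Set.one_lt_ncard_iff (finite_orbit (P := P) x)).2
    ⟨g • x, x, mem_orbit x g, mem_orbit_self x, hg⟩
  omega

lemma ncard_orbit_ne_two [Finite P] {s : P} (hP : IsNondegenerate P X s) {z : X} (hz : s • z = z) :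
    (orbit P z).ncard ≠ 2 := by
  intro h
  obtain ⟨a, b, hab, ho⟩ := Set.ncard_eq_two.1 h
  have hpre : ∀ g : P, ∀ w ∈ orbit P z, g • w = a ∨ g • w = b := by
    intro g w hw
    have : g • w ∈ orbit P z := mem_orbit_of_mem_orbit g hw
    simpa [ho] using this
  have ha : a ∈ orbit P z := by simp [ho]
  have hb : b ∈ orbit P z := by simp [ho]
  have hzab : z = a ∨ z = b := by simpa [ho] using mem_orbit_self (M := P) z
  have hsa : s • a = a ∧ s • b = b := by
    rcases hzab with rfl | rfl
    · refine ⟨hz, (hpre s b hb).resolve_left fun h' => hab ?_⟩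
      rw [← hz] at h'
      exact (smul_left_cancel s h').symm
    · refine ⟨(hpre s a ha).resolve_right fun h' => hab ?_, hz⟩
      rw [← hz] at h'
      exact (smul_left_cancel s h')
  exact hP.not_pair a b hab hsa.1 hsa.2 fun g => ⟨hpre g a ha, hpre g b hb⟩

lemma ncard_orbit_mul_le [Finite P] {x : X} {m : ℕ} (h : m ≤ Nat.card (stabilizer P x)) :
    (orbit P x).ncard * m ≤ Nat.card P := by
  rw [← ncard_orbit_mul_card_stabilizer x]
  exact Nat.mul_le_mul_left _ h

/-- A point outside the orbits of a set of orbit representatives extends this set. -/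
lemma eq_of_mem_orbit_insert [DecidableEq X] {T : Finset X} {w : X}
    (hT : ∀ x ∈ T, ∀ y ∈ T, y ∈ orbit P x → x = y) (hw : ∀ x ∈ T, w ∉ orbit P x) :
    ∀ x ∈ insert w T, ∀ y ∈ insert w T, y ∈ orbit P x → x = y := by
  intro x hx y hy hxy
  rw [Finset.mem_insert] at hx hy
  rcases hx with rfl | hx <;> rcases hy with rfl | hy
  · rfl
  · exact absurd (mem_orbit_symm.1 hxy) (hw y hy)
  · exact absurd hxy (hw x hx)
  · exact hT x hx y hy hxy

lemma exists_parabolic [Finite P] (hD : HasOneOrTwoFixedPoints P X) {s : P}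
    (hs : 6 ≤ orderOf s) (hP : IsNondegenerate P X s) {z : X} (hz : s • z = z) :
    ∃ x : X, 2 ≤ (parabolicSet P x).ncard := by
  classical
  by_contra! hr
  have hr1 : ∀ x : X, (parabolicSet P x).ncard = 1 := fun x => by
    have := hr x
    have := one_le_ncard_parabolicSet (P := P) x
    omega
  have hc : ∀ x : X, (orbit P x).ncard * weight P x + (orbit P x).ncard = Nat.card P := by
    intro x
    have := ncard_orbit_mul_weight (P := P) x
    rw [hr1 x] at this
    omega
  have ha : 6 ≤ Nat.card (stabilizer P z) := hs.trans (orderOf_le_card_stabilizer hz)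
  have h0 := ncard_orbit_mul_le ha
  have h02 := two_le_ncard_orbit hP z
  have h0ne := ncard_orbit_ne_two hP hz
  have hc0 := hc z
  have hT0 : ∀ x ∈ ({z} : Finset X), ∀ y ∈ ({z} : Finset X), y ∈ orbit P x → x = y := by
    intro x hx y hy _
    rw [Finset.mem_singleton.1 hx, Finset.mem_singleton.1 hy]
  have key : ∀ T : Finset X, (∀ x ∈ T, ∀ y ∈ T, y ∈ orbit P x → x = y) →
      (∑ x ∈ T, (orbit P x).ncard * weight P x = 2 * (Nat.card P - 1)) ∨
      ∃ w ∈ nonfree P X, ∀ x ∈ T, w ∉ orbit P x := by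
    intro T hT
    by_cases hcov : ∀ y ∈ nonfree P X, ∃ x ∈ T, y ∈ orbit P x
    · exact Or.inl (sum_orbits_eq hD T hT hcov)
    · push Not at hcov
      exact Or.inr hcov
  rcases key _ hT0 with h | ⟨z1, hz1, hn1⟩
  · rw [Finset.sum_singleton] at h
    omega
  have hT1 := eq_of_mem_orbit_insert hT0 hn1
  have hz1' : z1 ∉ ({z} : Finset X) := fun h => hn1 z1 h (mem_orbit_self z1)
  have ha1 := two_le_card_stabilizer hz1
  have h1 := ncard_orbit_mul_le ha1
  have hc1 := hc z1
  have h11 := two_le_ncard_orbit hP z1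
  rcases key _ hT1 with h | ⟨z2, hz2, hn2⟩
  · rw [Finset.sum_insert hz1', Finset.sum_singleton] at h
    omega
  have hT2 := eq_of_mem_orbit_insert hT1 hn2
  have hz2' : z2 ∉ insert z1 ({z} : Finset X) := fun h => hn2 z2 h (mem_orbit_self z2)
  have ha2 := two_le_card_stabilizer hz2
  have h2 := ncard_orbit_mul_le ha2
  have hc2 := hc z2
  rcases key _ hT2 with h | ⟨z3, hz3, hn3⟩
  · rw [Finset.sum_insert hz2', Finset.sum_insert hz1', Finset.sum_singleton] at h
    rcases ha1.eq_or_lt with e1 | e1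
    · rcases ha2.eq_or_lt with e2 | e2
      · have f1 := ncard_orbit_mul_card_stabilizer (P := P) z1
        have f2 := ncard_orbit_mul_card_stabilizer (P := P) z2
        rw [← e1] at f1
        rw [← e2] at f2
        omega
      · have := ncard_orbit_mul_le (Nat.succ_le_of_lt e2)
        omega
    · have := ncard_orbit_mul_le (Nat.succ_le_of_lt e1)
      omega
  have hT3 := eq_of_mem_orbit_insert hT2 hn3
  have hz3' : z3 ∉ insert z2 (insert z1 ({z} : Finset X)) :=
    fun h => hn3 z3 h (mem_orbit_self z3)
  have ha3 := two_le_card_stabilizer hz3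
  have h3 := ncard_orbit_mul_le ha3
  have hc3 := hc z3
  have := sum_orbits_le hD _ hT3
  rw [Finset.sum_insert hz3', Finset.sum_insert hz2', Finset.sum_insert hz1',
    Finset.sum_singleton] at this
  omega

/-- There are exactly two non-free orbits once some element fixes exactly one point. -/
lemma exists_second_orbit [Finite P] (hD : HasOneOrTwoFixedPoints P X) {s : P}
    (hP : IsNondegenerate P X s) {x : X} (hx : 2 ≤ (parabolicSet P x).ncard) :
    ∃ y, y ∉ orbit P x ∧
      (orbit P y).ncard + 2 * (orbit P x).ncard =
        (orbit P x).ncard * (parabolicSet P x).ncard + 2 ∧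
      ∀ z ∈ nonfree P X, z ∈ orbit P x ∨ z ∈ orbit P y := by
  classical
  set r := (parabolicSet P x).ncard
  have hx0 := ncard_orbit_mul_weight (P := P) x
  have hn2 := two_le_ncard_orbit hP x
  have hrs : r ≤ Nat.card (stabilizer P x) :=
    Set.ncard_le_ncard (parabolicSet_subset_stabilizer x) (Set.toFinite _)
  have hle := ncard_orbit_mul_le hrs
  have hnr : (orbit P x).ncard * 2 ≤ (orbit P x).ncard * r := Nat.mul_le_mul_left _ hx
  have hT0 : ∀ u ∈ ({x} : Finset X), ∀ y ∈ ({x} : Finset X), y ∈ orbit P u → u = y := by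
    intro u hu y hy _
    rw [Finset.mem_singleton.1 hu, Finset.mem_singleton.1 hy]
  by_cases hcov : ∀ y ∈ nonfree P X, ∃ u ∈ ({x} : Finset X), y ∈ orbit P u
  · have h := sum_orbits_eq hD _ hT0 hcov
    rw [Finset.sum_singleton] at h
    change _ = _ + _ * r at hx0
    omega
  push Not at hcov
  obtain ⟨y, hy, hny⟩ := hcov
  have hT1 := eq_of_mem_orbit_insert hT0 hny
  have hy' : y ∉ ({x} : Finset X) := fun h => hny y h (mem_orbit_self y)
  have hy0 := ncard_orbit_mul_weight (P := P) y
  have hay := two_le_card_stabilizer hy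
  have hly := ncard_orbit_mul_le hay
  have hby : (parabolicSet P y).ncard = 1 := by
    by_contra hne
    have h1 := one_le_ncard_parabolicSet (P := P) y
    have h2 : (orbit P y).ncard * 2 ≤ (orbit P y).ncard * (parabolicSet P y).ncard :=
      Nat.mul_le_mul_left _ (by omega)
    have := sum_orbits_le hD _ hT1
    rw [Finset.sum_insert hy', Finset.sum_singleton] at this
    change _ = _ + _ * r at hx0
    omega
  rw [hby] at hy0
  have hxy : ∀ z ∈ nonfree P X, z ∈ orbit P x ∨ z ∈ orbit P y := by
    by_contra! hcon
    obtain ⟨w, hw, hwx, hwy⟩ := hcon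
    have hwT : ∀ u ∈ insert y ({x} : Finset X), w ∉ orbit P u := by
      intro u hu
      rw [Finset.mem_insert, Finset.mem_singleton] at hu
      rcases hu with rfl | rfl <;> assumption
    have hT2 := eq_of_mem_orbit_insert hT1 hwT
    have hw' : w ∉ insert y ({x} : Finset X) := fun h => hwT w h (mem_orbit_self w)
    have haw := two_le_card_stabilizer hw
    have hlw := ncard_orbit_mul_le haw
    have hw0 := ncard_orbit_mul_weight (P := P) w
    have := sum_orbits_le hD _ hT2
    rw [Finset.sum_insert hw', Finset.sum_insert hy', Finset.sum_singleton] at this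
    change _ = _ + _ * r at hx0
    have : (orbit P w).ncard * 1 ≤ (orbit P w).ncard * (parabolicSet P w).ncard :=
      Nat.mul_le_mul_left _ (one_le_ncard_parabolicSet w)
    omega
  refine ⟨y, fun h => hny x (Finset.mem_singleton_self x) h, ?_, hxy⟩
  have h := sum_orbits_eq hD _ hT1 (by
    intro z hz
    rcases hxy z hz with h | h
    · exact ⟨x, by simp, h⟩
    · exact ⟨y, by simp, h⟩)
  rw [Finset.sum_insert hy', Finset.sum_singleton] at h
  change _ = _ + _ * r at hx0
  omega

/-- The arithmetic of the two non-free orbits. Here `r` is the order of the parabolic subgroup, `k`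
its index in the point stabilizer, `1 + r * t` the number of parabolic points and `d` the order of
the other point stabilizer. -/
lemma orbit_arithmetic {r k t d m : ℕ} (hr : 2 ≤ r) (hk : 1 ≤ k) (hkr : k + 1 ≤ r) (ht : 1 ≤ t)
    (hm : m + 2 * (1 + r * t) = (1 + r * t) * r + 2) (hd : m * d = (1 + r * t) * (r * k))
    (h6 : 6 ≤ d ∨ 6 ≤ r) : (r = 2 ∧ m = 2) ∨ (t = 1 ∧ (2 * k = r - 1 ∨ k = r - 1)) := by
  rcases hr.eq_or_lt with rfl | hr3
  · left
    omega
  right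
  obtain ⟨e, rfl⟩ : ∃ e, r = e + 3 := ⟨r - 3, by omega⟩
  have hm' : m = (e + 3) * (1 + (e + 1) * t) := by nlinarith
  have hd' : (1 + (e + 1) * t) * d = (1 + (e + 3) * t) * k := by
    have : (e + 3) * ((1 + (e + 1) * t) * d) = (e + 3) * ((1 + (e + 3) * t) * k) := by
      rw [← mul_assoc, ← hm', hd]; ring
    exact Nat.eq_of_mul_eq_mul_left (by omega) this
  have hdvd : (1 + (e + 1) * t) ∣ 2 * k := by
    have h1 : (1 + (e + 1) * t) ∣ t * (2 * k) := by
      have h2 : (1 + (e + 1) * t) ∣ (1 + (e + 1) * t) * k + t * (2 * k) :=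
        ⟨d, by rw [hd']; ring⟩
      exact (Nat.dvd_add_right (dvd_mul_right _ _)).1 h2
    refine Nat.Coprime.dvd_of_dvd_mul_left ?_ h1
    rw [mul_comm]
    simp
  obtain ⟨j, hj⟩ := hdvd
  have hj0 : 1 ≤ j := by
    rcases Nat.eq_zero_or_pos j with rfl | h
    · omega
    · exact h
  have hle : (1 + (e + 1) * t) * j ≤ 2 * (e + 2) := by omega
  have hj3 : t ≤ 3 := by
    by_contra! h
    have : (e + 1) * 4 ≤ (e + 1) * t := Nat.mul_le_mul_left _ h
    have : (1 + (e + 1) * t) * 1 ≤ (1 + (e + 1) * t) * j := Nat.mul_le_mul_left _ hj0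
    omega
  have hj2 : j ≤ 2 := by
    by_contra! h
    have h1 : (e + 1) * 1 ≤ (e + 1) * t := Nat.mul_le_mul_left _ ht
    have : (1 + (e + 1) * t) * 3 ≤ (1 + (e + 1) * t) * j := Nat.mul_le_mul_left _ h
    omega
  interval_cases t <;> interval_cases j <;> try omega
  have he : e = 0 := by omega
  subst he
  omega

end FixedPointCount

open OnePoint MulAction FixedPointCount

section Moebius

variable {E : Type*} [Field E] [DecidableEq E]

/-- The group of Möbius transformations of the projective line, as permutations. -/
def moebius (E : Type*) [Field E] [DecidableEq E] : Subgroup (Equiv.Perm (OnePoint E)) :=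
  (MulAction.toPermHom (GL (Fin 2) E) (OnePoint E)).range

lemma toPerm_mem_moebius (γ : GL (Fin 2) E) :
    MulAction.toPermHom (GL (Fin 2) E) (OnePoint E) γ ∈ moebius E := ⟨γ, rfl⟩

/-- The permutation `x ↦ a * x + b` of the projective line. -/
def affinePerm (a : Eˣ) (b : E) : Equiv.Perm (OnePoint E) :=
  MulAction.toPermHom (GL (Fin 2) E) (OnePoint E)
    (GeneralLinearGroup.mkOfDetNeZero !![(a : E), b; 0, 1] (by simp))

lemma affinePerm_mem (a : Eˣ) (b : E) : affinePerm a b ∈ moebius E := ⟨_, rfl⟩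

@[simp] lemma affinePerm_infty (a : Eˣ) (b : E) : affinePerm a b ∞ = ∞ := by
  simp [affinePerm, smul_infty_eq_ite, GeneralLinearGroup.mkOfDetNeZero]

@[simp] lemma affinePerm_coe (a : Eˣ) (b x : E) :
    affinePerm a b (x : OnePoint E) = ((a * x + b : E) : OnePoint E) := by
  simp [affinePerm, smul_some_eq_ite, GeneralLinearGroup.mkOfDetNeZero]

lemma affinePerm_mul (a a' : Eˣ) (b b' : E) :
    affinePerm a b * affinePerm a' b' = affinePerm (a * a') (a * b' + b) := by
  ext x
  cases x with
  | infty => simp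
  | coe x =>
    simp only [Equiv.Perm.coe_mul, Function.comp_apply, affinePerm_coe, Units.val_mul]
    congr 1
    ring

@[simp] lemma affinePerm_one_zero : affinePerm (1 : Eˣ) 0 = 1 := by
  ext x
  cases x <;> simp

lemma affinePerm_inj {a a' : Eˣ} {b b' : E} :
    affinePerm a b = affinePerm a' b' ↔ a = a' ∧ b = b' := by
  refine ⟨fun h => ?_, fun h => by rw [h.1, h.2]⟩
  have h0 := congrArg (fun σ => σ ((0 : E) : OnePoint E)) h
  have h1 := congrArg (fun σ => σ ((1 : E) : OnePoint E)) h
  simp only [affinePerm_coe, OnePoint.coe_eq_coe] at h0 h1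
  have hb : b = b' := by simpa using h0
  subst hb
  exact ⟨Units.ext (by simpa using h1), rfl⟩

lemma exists_affinePerm {g : Equiv.Perm (OnePoint E)} (hg : g ∈ moebius E) (h : g ∞ = ∞) :
    ∃ a b, g = affinePerm a b := by
  obtain ⟨γ, rfl⟩ := hg
  have hc : γ 1 0 = 0 := smul_infty_eq_self_iff.1 h
  have hdet := γ.det_ne_zero
  rw [det_fin_two, hc, mul_zero, sub_zero] at hdet
  have ha : γ 0 0 ≠ 0 := left_ne_zero_of_mul hdet
  have hd : γ 1 1 ≠ 0 := right_ne_zero_of_mul hdet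
  refine ⟨Units.mk0 (γ 0 0 / γ 1 1) (div_ne_zero ha hd), γ 0 1 / γ 1 1, ?_⟩
  ext x
  cases x with
  | infty => simpa using h
  | coe x =>
    simp only [MulAction.toPermHom_apply, MulAction.toPerm_apply, smul_some_eq_ite, hc, zero_mul,
      zero_add, hd, if_false, affinePerm_coe, Units.val_mk0]
    congr 2
    field_simp

lemma exists_moebius_infty (x : OnePoint E) : ∃ δ ∈ moebius E, δ x = ∞ := by
  cases x with
  | infty => exact ⟨1, one_mem _, rfl⟩
  | coe x =>
    refine ⟨_, toPerm_mem_moebius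
      (GeneralLinearGroup.mkOfDetNeZero !![0, 1; 1, -x] (by simp)), ?_⟩
    simp [smul_some_eq_ite, GeneralLinearGroup.mkOfDetNeZero]

/-- The Möbius group is transitive on triples of distinct points. -/
lemma exists_moebius_triple {x y z : OnePoint E} (hxy : x ≠ y) (hxz : x ≠ z) (hyz : y ≠ z) :
    ∃ δ ∈ moebius E, δ x = ∞ ∧ δ y = ((0 : E) : OnePoint E) ∧ δ z = ((1 : E) : OnePoint E) := by
  obtain ⟨δ₁, hδ₁, h1⟩ := exists_moebius_infty x
  have hy : δ₁ y ≠ ∞ := fun h => hxy (δ₁.injective (h1.trans h.symm))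
  have hz : δ₁ z ≠ ∞ := fun h => hxz (δ₁.injective (h1.trans h.symm))
  obtain ⟨u, hu⟩ := OnePoint.ne_infty_iff_exists.1 hy
  obtain ⟨v, hv⟩ := OnePoint.ne_infty_iff_exists.1 hz
  have huv : v - u ≠ 0 := fun h => hyz (δ₁.injective (by rw [← hu, ← hv, sub_eq_zero.1 h]))
  refine ⟨affinePerm (Units.mk0 (v - u)⁻¹ (inv_ne_zero huv)) (-((v - u)⁻¹ * u)) * δ₁,
    mul_mem (affinePerm_mem _ _) hδ₁, ?_, ?_, ?_⟩
  · simp [h1]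
  · simp [← hu]
  · simp only [Equiv.Perm.coe_mul, Function.comp_apply, ← hv, affinePerm_coe, Units.val_mk0]
    congr 1
    field_simp
    ring

lemma exists_fixed_point [IsAlgClosed E] (γ : GL (Fin 2) E) : ∃ x : OnePoint E, γ • x = x := by
  by_cases hc : γ 1 0 = 0
  · exact ⟨∞, smul_infty_eq_self_iff.2 hc⟩
  · obtain ⟨x, hx⟩ := IsAlgClosed.exists_root γ.fixpointPolynomial (by
      have h : γ.fixpointPolynomial = Polynomial.C (γ 1 0) * Polynomial.X ^ 2 +
          Polynomial.C (γ 1 1 - γ 0 0) * Polynomial.X + Polynomial.C (-γ 0 1) := by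
        rw [GeneralLinearGroup.fixpointPolynomial, Polynomial.C_neg, sub_eq_add_neg]
      rw [h, Polynomial.degree_quadratic hc]
      decide)
    exact ⟨x, GeneralLinearGroup.fixpointPolynomial_aeval_eq_zero_iff.1 (by
      rwa [Polynomial.coe_aeval_eq_eval])⟩

lemma affinePerm_fixed {a : Eˣ} {b : E} (h : affinePerm a b ≠ 1) :
    (a = 1 ∧ ∀ y, affinePerm a b y = y ↔ y = ∞) ∨
      a ≠ 1 ∧ ∀ y, affinePerm a b y = y ↔ y = ∞ ∨ y = ((b / (1 - a) : E) : OnePoint E) := by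
  by_cases ha : a = 1
  · subst ha
    left
    have hb : b ≠ 0 := fun hb => h (by rw [hb, affinePerm_one_zero])
    refine ⟨rfl, fun y => ?_⟩
    cases y <;> simp [hb]
  · right
    have ha' : (1 - a : E) ≠ 0 := fun h' => ha (Units.ext (by simpa using (sub_eq_zero.1 h').symm))
    refine ⟨ha, fun y => ?_⟩
    cases y with
    | infty => simp
    | coe y =>
      simp only [affinePerm_coe, OnePoint.coe_eq_coe, OnePoint.coe_ne_infty, false_or]
      rw [eq_div_iff ha']
      constructor <;> intro h <;> linear_combination -h

lemma moebius_fixed [IsAlgClosed E] {g : Equiv.Perm (OnePoint E)} (hg : g ∈ moebius E)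
    (h1 : g ≠ 1) : (∃ x, ∀ y, g y = y ↔ y = x) ∨ ∃ x x', x ≠ x' ∧ ∀ y, g y = y ↔ y = x ∨ y = x' := by
  obtain ⟨x, hx⟩ : ∃ x, g x = x := by
    obtain ⟨γ, rfl⟩ := hg
    exact exists_fixed_point γ
  obtain ⟨δ, hδ, hδx⟩ := exists_moebius_infty x
  have hx' : δ⁻¹ ∞ = x := by rw [← hδx]; simp
  obtain ⟨a, b, hab⟩ := exists_affinePerm (mul_mem (mul_mem hδ hg) (inv_mem hδ))
    (show (δ * g * δ⁻¹) ∞ = ∞ by simp only [Equiv.Perm.coe_mul, Function.comp_apply, hx', hx, hδx])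
  have hne : affinePerm a b ≠ 1 := by
    rw [← hab]
    intro h
    exact h1 (by simpa using h)
  have hfix : ∀ y, g y = y ↔ affinePerm a b (δ y) = δ y := by
    intro y
    rw [← hab]
    simp
  rcases affinePerm_fixed hne with ⟨-, h⟩ | ⟨-, h⟩
  · left
    refine ⟨x, fun y => ?_⟩
    rw [hfix, h, ← hδx, δ.apply_eq_iff_eq]
  · right
    refine ⟨x, δ⁻¹ ((b / (1 - a) : E) : OnePoint E), ?_, fun y => ?_⟩
    · intro h'
      rw [h'] at hδx
      simp at hδx
    · rw [hfix, h, ← hδx, δ.apply_eq_iff_eq, Equiv.Perm.eq_inv_iff_eq]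

lemma hasOneOrTwoFixedPoints_of_le [IsAlgClosed E] {P : Subgroup (Equiv.Perm (OnePoint E))}
    (hP : P ≤ moebius E) : FixedPointCount.HasOneOrTwoFixedPoints P (OnePoint E) :=
  fun g hg => moebius_fixed (hP g.2) (by simpa using hg)

lemma sq_trace_div_det_mem {K : Subfield E} {γ : GL (Fin 2) E}
    (h : ∀ x : OnePoint E, (x = ∞ ∨ ∃ k ∈ K, x = ((k : E) : OnePoint E)) →
      (γ • x = ∞ ∨ ∃ k ∈ K, γ • x = ((k : E) : OnePoint E)))
    (h' : γ⁻¹ • (∞ : OnePoint E) = ∞ ∨ ∃ k ∈ K, γ⁻¹ • (∞ : OnePoint E) = ((k : E) : OnePoint E)) :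
    γ.val.trace ^ 2 / γ.val.det ∈ K := by
  have hdet := γ.det_ne_zero
  have hi := h ∞ (Or.inl rfl)
  have h0 := h _ (Or.inr ⟨0, zero_mem _, rfl⟩)
  have h1 := h _ (Or.inr ⟨1, one_mem _, rfl⟩)
  rw [smul_infty_eq_ite] at hi
  rw [smul_some_eq_ite, mul_zero, mul_zero, zero_add, zero_add] at h0
  rw [smul_some_eq_ite, mul_one, mul_one] at h1
  rw [det_fin_two] at hdet
  rw [trace_fin_two, det_fin_two]
  have hd' : γ 1 0 = 0 ∨ γ 1 1 / γ 1 0 ∈ K := by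
    by_cases hc : γ 1 0 = 0
    · exact Or.inl hc
    right
    rcases h' with h' | ⟨k, hk, h'⟩
    · rw [inv_smul_eq_iff, eq_comm, smul_infty_eq_self_iff] at h'
      exact absurd h' hc
    · rw [inv_smul_eq_iff, smul_some_eq_ite] at h'
      split_ifs at h' with h2
      · have : γ 1 1 / γ 1 0 = - k := by
          field_simp
          linear_combination h2
        rw [this]
        exact neg_mem hk
      · exact absurd h' (OnePoint.infty_ne_coe _)
  generalize γ 0 0 = a at *
  generalize γ 0 1 = b at *
  generalize γ 1 0 = c at *
  generalize γ 1 1 = d at *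
  have mem_of : ∀ {u : E}, ((u : OnePoint E) = ∞ ∨ ∃ k ∈ K, (u : OnePoint E) = (k : E)) → u ∈ K := by
    rintro u (hu | ⟨k, hk, hu⟩)
    · exact absurd hu (OnePoint.coe_ne_infty _)
    · rwa [OnePoint.coe_eq_coe.1 hu]
  by_cases hc : c = 0
  · subst hc
    have had : a * d ≠ 0 := by simpa using hdet
    have ha := left_ne_zero_of_mul had
    have hd := right_ne_zero_of_mul had
    rw [if_neg hd] at h0
    rw [zero_add, if_neg hd] at h1
    have h2 : a / d ∈ K := by
      have := sub_mem (mem_of h1) (mem_of h0)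
      rwa [show (a + b) / d - b / d = a / d by ring] at this
    have : (a + d) ^ 2 / (a * d - b * 0) = a / d + 2 + (a / d)⁻¹ := by
      field_simp
      ring
    rw [this]
    exact add_mem (add_mem h2 (ofNat_mem K 2)) (inv_mem h2)
  · rw [if_neg hc] at hi
    have ha := mem_of hi
    have hd := hd'.resolve_left hc
    have hb : b / c ∈ K := by
      by_cases hd0 : d = 0
      · subst hd0
        rw [add_zero, if_neg hc] at h1
        have := sub_mem (mem_of h1) ha
        rwa [show (a + b) / c - a / c = b / c by ring] at this
      · rw [if_neg hd0] at h0
        have := mul_mem (mem_of h0) hd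
        rwa [show b / d * (d / c) = b / c by field_simp] at this
    have : (a + d) ^ 2 / (a * d - b * c) = (a / c + d / c) ^ 2 / (a / c * (d / c) - b / c) := by
      have : a / c * (d / c) - b / c = (a * d - b * c) / c ^ 2 := by field_simp
      rw [this]
      field_simp
    rw [this]
    exact div_mem (pow_mem (add_mem ha hd) 2) (sub_mem (mul_mem ha hd) hb)

end Moebius

section AffinePart

variable {E : Type*} [Field E] [DecidableEq E] (P : Subgroup (Equiv.Perm (OnePoint E)))

/-- The translations contained in a permutation group of the projective line. -/
def translations : AddSubgroup E where
  carrier := {b | affinePerm 1 b ∈ P}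
  zero_mem' := by simp
  add_mem' {b c} hb hc := by
    have := mul_mem (show affinePerm 1 b ∈ P from hb) (show affinePerm 1 c ∈ P from hc)
    rwa [affinePerm_mul, one_mul, Units.val_one, one_mul, add_comm] at this
  neg_mem' {b} hb := by
    have h : affinePerm (1 : Eˣ) (-b) = (affinePerm 1 b)⁻¹ := by
      rw [eq_inv_iff_mul_eq_one, affinePerm_mul]
      simp
    simpa only [Set.mem_ofPred_eq, h] using inv_mem hb

/-- The multipliers of the affine maps contained in a permutation group of the projective line. -/
def multipliers : Subgroup Eˣ where
  carrier := {a | ∃ b, affinePerm a b ∈ P}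
  one_mem' := ⟨0, by simp⟩
  mul_mem' := by
    rintro a a' ⟨b, hb⟩ ⟨b', hb'⟩
    exact ⟨_, by simpa only [affinePerm_mul] using mul_mem hb hb'⟩
  inv_mem' := by
    rintro a ⟨b, hb⟩
    refine ⟨-(a⁻¹ * b), ?_⟩
    have h : affinePerm a⁻¹ (-(a⁻¹ * b)) = (affinePerm a b)⁻¹ := by
      rw [eq_inv_iff_mul_eq_one, affinePerm_mul]
      simp
    rw [h]
    exact inv_mem hb

variable {P}

lemma mem_translations {b : E} : b ∈ translations P ↔ affinePerm 1 b ∈ P := Iff.rfl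

lemma mem_multipliers {a : Eˣ} : a ∈ multipliers P ↔ ∃ b, affinePerm a b ∈ P := Iff.rfl

lemma mul_mem_translations {a : Eˣ} (ha : a ∈ multipliers P) {b : E} (hb : b ∈ translations P) :
    a * b ∈ translations P := by
  obtain ⟨c, hc⟩ := ha
  have h : affinePerm 1 (a * b) = affinePerm a c * affinePerm 1 b * (affinePerm a c)⁻¹ := by
    rw [eq_mul_inv_iff_mul_eq, affinePerm_mul, affinePerm_mul]
    simp [add_comm]
  rw [mem_translations, h]
  exact mul_mem (mul_mem hc hb) (inv_mem hc)

instance [Finite P] : Finite (translations P) :=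
  Finite.of_injective (fun b : translations P => (⟨affinePerm 1 b, b.2⟩ : P)) fun _ _ h =>
    Subtype.ext (affinePerm_inj.1 (congrArg Subtype.val h)).2

instance [Finite P] : Finite (multipliers P) :=
  Finite.of_injective (fun a : multipliers P => (⟨_, a.2.choose_spec⟩ : P)) fun _ _ h =>
    Subtype.ext (affinePerm_inj.1 (congrArg Subtype.val h)).1

lemma card_stabilizer_infty (hPm : P ≤ moebius E) :
    Nat.card (stabilizer P (∞ : OnePoint E)) =
      Nat.card (translations P) * Nat.card (multipliers P) := by
  rw [mul_comm, ← Nat.card_prod]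
  choose f hf using fun a : multipliers P => mem_multipliers.1 a.2
  have key : ∀ x : multipliers P × translations P, affinePerm x.1 (f x.1 + x.2) ∈ P := by
    intro x
    have := mul_mem (mem_translations.1 x.2.2) (hf x.1)
    rwa [affinePerm_mul, one_mul, Units.val_one, one_mul] at this
  refine (Nat.card_eq_of_bijective (fun x => (⟨⟨_, key x⟩, ?_⟩ : stabilizer P (∞ : OnePoint E)))
    ⟨?_, ?_⟩).symm
  · simp [mem_stabilizer_iff, Subgroup.smul_def]
  · rintro ⟨a, b⟩ ⟨a', b'⟩ h
    have h := affinePerm_inj.1 (congrArg Subtype.val (congrArg Subtype.val h))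
    obtain rfl : a = a' := Subtype.ext h.1
    have h2 := h.2
    simp only [add_right_inj, SetLike.coe_eq_coe] at h2
    rw [h2]
  · rintro ⟨⟨g, hg⟩, hg'⟩
    obtain ⟨a, b, rfl⟩ := exists_affinePerm (hPm hg) hg'
    have ha : a ∈ multipliers P := ⟨b, hg⟩
    have hb : b - f ⟨a, ha⟩ ∈ translations P := by
      have h : affinePerm 1 (b - f ⟨a, ha⟩) = affinePerm a b * (affinePerm a (f ⟨a, ha⟩))⁻¹ := by
        rw [eq_mul_inv_iff_mul_eq, affinePerm_mul]
        simp
      rw [mem_translations, h]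
      exact mul_mem hg (inv_mem (hf ⟨a, ha⟩))
    refine ⟨⟨⟨a, ha⟩, ⟨_, hb⟩⟩, ?_⟩
    simp

lemma ncard_parabolicSet_infty (hPm : P ≤ moebius E) :
    (parabolicSet P (∞ : OnePoint E)).ncard = Nat.card (translations P) := by
  symm
  rw [← Nat.card_coe_set_eq]
  refine Nat.card_eq_of_bijective
    (fun b => (⟨⟨affinePerm 1 b, b.2⟩, ?_⟩ : parabolicSet P (∞ : OnePoint E))) ⟨?_, ?_⟩
  · by_cases h : affinePerm (1 : Eˣ) (b : E) = 1
    · exact Or.inl (Subtype.ext h)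
    · exact Or.inr ((affinePerm_fixed h).resolve_right fun h => h.1 rfl).2
  · intro b c h
    exact Subtype.ext (affinePerm_inj.1 (congrArg Subtype.val (congrArg Subtype.val h))).2
  · rintro ⟨⟨g, hg⟩, hg'⟩
    obtain ⟨a, b, rfl⟩ := exists_affinePerm (hPm hg) (parabolicSet_subset_stabilizer _ hg')
    suffices ha : a = 1 by
      subst ha
      exact ⟨⟨b, hg⟩, rfl⟩
    by_contra ha
    have hne : affinePerm a b ≠ 1 := by
      rw [← affinePerm_one_zero, Ne, affinePerm_inj]
      exact fun h => ha h.1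
    rcases hg' with h | h
    · exact hne (congrArg Subtype.val h)
    · have h2 := ((affinePerm_fixed hne).resolve_left fun h => ha h.1).2
      have := (h _).1 ((h2 ((b / (1 - a) : E) : OnePoint E)).2 (Or.inr rfl))
      exact OnePoint.coe_ne_infty _ this

/-- The elements of `E` preserving the translation group form a finite field. -/
def scalarField (P : Subgroup (Equiv.Perm (OnePoint E))) [Finite P] : Subfield E where
  carrier := {x | ∀ y ∈ translations P, x * y ∈ translations P}
  mul_mem' {x x'} h h' y hy := by
    rw [mul_assoc]
    exact h _ (h' _ hy)
  one_mem' y hy := by rwa [one_mul]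
  add_mem' {x x'} h h' y hy := by
    rw [add_mul]
    exact add_mem (h _ hy) (h' _ hy)
  zero_mem' y hy := by
    rw [zero_mul]
    exact zero_mem _
  neg_mem' {x} h y hy := by
    rw [neg_mul]
    exact neg_mem (h _ hy)
  inv_mem' x h y hy := by
    rcases eq_or_ne x 0 with rfl | hx
    · rw [_root_.inv_zero, zero_mul]
      exact zero_mem _
    have hinj : Function.Injective (fun y : translations P => (⟨x * y, h _ y.2⟩ : translations P)) :=
      fun y z hyz => Subtype.ext (mul_left_cancel₀ hx (congrArg Subtype.val hyz))
    obtain ⟨z, hz⟩ := Finite.injective_iff_surjective.1 hinj ⟨y, hy⟩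
    have hz : x * z = y := congrArg Subtype.val hz
    rw [← hz, inv_mul_cancel_left₀ hx]
    exact z.2

lemma scalarField_le [Finite P] (h1 : (1 : E) ∈ translations P) :
    (scalarField P).toAddSubgroup ≤ translations P := fun x hx => by
  simpa using hx 1 h1

lemma card_multipliers_lt [Finite P] (h1 : (1 : E) ∈ translations P) :
    Nat.card (multipliers P) + 1 ≤ Nat.card (scalarField P).toAddSubgroup := by
  have : Finite (scalarField P).toAddSubgroup :=
    Set.Finite.subset (show ((translations P : Set E)).Finite from
      inferInstanceAs (Finite (translations P))) (scalarField_le h1)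
  have hfin : ((fun a : Eˣ => (a : E)) '' (multipliers P : Set Eˣ)).Finite :=
    Set.Finite.image _ (inferInstanceAs (Finite (multipliers P)))
  calc Nat.card (multipliers P) + 1
      = (insert 0 ((fun a : Eˣ => (a : E)) '' (multipliers P : Set Eˣ))).ncard := by
        rw [Set.ncard_insert_of_notMem (by simp) hfin,
          Set.ncard_image_of_injective _ Units.val_injective]
        rfl
    _ ≤ ((scalarField P).toAddSubgroup : Set E).ncard := by
        refine Set.ncard_le_ncard ?_ (Set.toFinite _)
        rintro _ (rfl | ⟨a, ha, rfl⟩)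
        · exact zero_mem _
        · exact fun y hy => mul_mem_translations ha hy
    _ = _ := rfl

lemma exists_ncard_orbit_infty [Finite P] (h0 : ((0 : E) : OnePoint E) ∈ orbit P (∞ : OnePoint E)) :
    ∃ t, 1 ≤ t ∧ (orbit P (∞ : OnePoint E)).ncard = 1 + Nat.card (translations P) * t ∧
      (t = 1 → ∀ x : E, (x : OnePoint E) ∈ orbit P (∞ : OnePoint E) → x ∈ translations P) := by
  set S : Set E := {x | (x : OnePoint E) ∈ orbit P (∞ : OnePoint E)} with hS
  have horb : orbit P (∞ : OnePoint E) = insert ∞ ((fun x : E => (x : OnePoint E)) '' S) := by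
    ext x
    cases x with
    | infty => simp [mem_orbit_self]
    | coe x => simp [hS]
  have hSfin : S.Finite :=
    ((finite_orbit (P := P) (∞ : OnePoint E)).preimage OnePoint.coe_injective.injOn)
  have hstab : ∀ a ∈ translations P, ∀ x ∈ S, x + a ∈ S := by
    intro a ha x hx
    have : (⟨affinePerm 1 a, ha⟩ : P) • (x : OnePoint E) ∈ orbit P (∞ : OnePoint E) :=
      mem_orbit_of_mem_orbit _ hx
    simpa [Subgroup.smul_def, hS] using this
  set T : Set (E ⧸ translations P) := QuotientAddGroup.mk '' S
  have hpre : (QuotientAddGroup.mk ⁻¹' T : Set E) = S := by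
    ext x
    constructor
    · rintro ⟨y, hy, hxy⟩
      have := hstab _ (QuotientAddGroup.eq.1 hxy) y hy
      simpa using this
    · exact fun hx => ⟨x, hx, rfl⟩
  have hcard : S.ncard = Nat.card (translations P) * T.ncard := by
    have := Nat.card_congr (QuotientAddGroup.preimageMkEquivAddSubgroupProdSet (translations P) T)
    rw [hpre, Nat.card_prod] at this
    exact this
  have hTfin : T.Finite := hSfin.image _
  have h0S : (0 : E) ∈ S := h0
  refine ⟨T.ncard, (Set.ncard_pos hTfin).2 ⟨_, 0, h0S, rfl⟩, ?_, fun ht x hx => ?_⟩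
  · rw [horb, Set.ncard_insert_of_notMem (by simp) (hSfin.image _),
      Set.ncard_image_of_injective _ OnePoint.coe_injective, hcard, add_comm]
  · obtain ⟨c, hc⟩ := Set.ncard_eq_one.1 ht
    have h2 : ((0 : E) : E ⧸ translations P) = (x : E) := by
      have ha : ((0 : E) : E ⧸ translations P) ∈ T := ⟨0, h0S, rfl⟩
      have hb : ((x : E) : E ⧸ translations P) ∈ T := ⟨x, hx, rfl⟩
      rw [hc] at ha hb
      exact ha.trans hb.symm
    simpa using QuotientAddGroup.eq.1 h2

/-- An affine map in `P` has order at most the order of the translation group. -/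
lemma orderOf_le_card_translations [Finite P] (hPm : P ≤ moebius E)
    (h1 : (1 : E) ∈ translations P) {g : P} (hg : g • (∞ : OnePoint E) = ∞) :
    orderOf g ≤ Nat.card (translations P) := by
  obtain ⟨g, hgP⟩ := g
  obtain ⟨a, b, rfl⟩ := exists_affinePerm (hPm hgP) hg
  rw [Subgroup.orderOf_mk]
  have hk : Nat.card (multipliers P) + 1 ≤ Nat.card (translations P) :=
    (card_multipliers_lt h1).trans
      (Nat.card_le_card_of_injective _ (AddSubgroup.inclusion_injective (scalarField_le h1)))
  have hpow : ∀ n : ℕ, ∃ c, affinePerm a b ^ n = affinePerm (a ^ n) c := by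
    intro n
    induction n with
    | zero => exact ⟨0, by simp⟩
    | succ n ih =>
      obtain ⟨c, hc⟩ := ih
      exact ⟨_, by rw [pow_succ, hc, affinePerm_mul, pow_succ]⟩
  by_cases ha : a = 1
  · subst ha
    have hb : ∀ n : ℕ, affinePerm (1 : Eˣ) b ^ n = affinePerm 1 (n • b) := by
      intro n
      induction n with
      | zero => simp
      | succ n ih => rw [pow_succ, ih, affinePerm_mul]; simp [add_mul, add_comm]
    refine Nat.le_of_dvd Nat.card_pos (orderOf_dvd_of_pow_eq_one ?_)
    have : Nat.card (translations P) • (⟨b, hgP⟩ : translations P) = 0 := card_nsmul_eq_zero'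
    rw [hb, show Nat.card (translations P) • b = 0 from congrArg Subtype.val this]
    simp
  · have ham : a ∈ multipliers P := ⟨b, hgP⟩
    have hak : a ^ Nat.card (multipliers P) = 1 :=
      congrArg Subtype.val (pow_card_eq_one' (x := (⟨a, ham⟩ : multipliers P)))
    refine le_trans (Nat.le_of_dvd Nat.card_pos
      (orderOf_dvd_of_pow_eq_one (n := Nat.card (multipliers P)) ?_)) (by omega)
    obtain ⟨c, hc⟩ := hpow (Nat.card (multipliers P))
    rw [hak] at hc
    by_contra hne
    rw [hc] at hne
    have hne' : affinePerm a b ≠ 1 := by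
      intro h
      rw [h, one_pow] at hc
      exact hne hc.symm
    have hfix := (((affinePerm_fixed hne').resolve_left fun h => ha h.1).2
      ((b / (1 - a) : E) : OnePoint E)).2 (Or.inr rfl)
    have hfix' : affinePerm 1 c ((b / (1 - a) : E) : OnePoint E) = ((b / (1 - a) : E) : OnePoint E) := by
      rw [← hc]
      exact Function.IsFixedPt.perm_pow (e := affinePerm a b) hfix _
    exact OnePoint.coe_ne_infty _
      ((((affinePerm_fixed hne).resolve_right fun h => h.1 rfl).2 _).1 hfix')

end AffinePart

section Structure

variable {E : Type*} [Field E] [DecidableEq E] [IsAlgClosed E]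
  {P : Subgroup (Equiv.Perm (OnePoint E))}

/-- The traces and the order of `P` are those of a projective linear group over `K`. -/
def IsOfSubfieldType (P : Subgroup (Equiv.Perm (OnePoint E))) (K : Subfield E) : Prop :=
  Finite K ∧ (∀ γ : GL (Fin 2) E, MulAction.toPermHom (GL (Fin 2) E) (OnePoint E) γ ∈ P →
    γ.val.trace ^ 2 / γ.val.det ∈ K) ∧
  ∃ k, Nat.card P = Nat.card K * (Nat.card K + 1) * k ∧
    (2 * k = Nat.card K - 1 ∨ k = Nat.card K - 1)

lemma exists_fixed_point_of_le (hPm : P ≤ moebius E) (s : P) : ∃ z : OnePoint E, s • z = z := by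
  obtain ⟨γ, hγ⟩ := hPm s.2
  obtain ⟨z, hz⟩ := exists_fixed_point γ
  refine ⟨z, ?_⟩
  rw [Subgroup.smul_def, ← hγ]
  exact hz

lemma isOfSubfieldType_scalarField [Finite P] (hPm : P ≤ moebius E) (h1 : (1 : E) ∈ translations P)
    (h0 : ((0 : E) : OnePoint E) ∈ orbit P (∞ : OnePoint E)) {s : P} (hs : 6 ≤ orderOf s)
    (hP : IsNondegenerate P (OnePoint E) s) : IsOfSubfieldType P (scalarField P) := by
  have hD := hasOneOrTwoFixedPoints_of_le hPm
  have hk := card_multipliers_lt h1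
  have hk0 : 0 < Nat.card (multipliers P) := Nat.card_pos
  have hKr : Nat.card (scalarField P).toAddSubgroup ∣ Nat.card (translations P) :=
    AddSubgroup.card_dvd_of_le (scalarField_le h1)
  have hr0 : 0 < Nat.card (translations P) := Nat.card_pos
  have hKr' := Nat.le_of_dvd hr0 hKr
  obtain ⟨t, ht, hn, hS⟩ := exists_ncard_orbit_infty h0
  have hr2 : 2 ≤ (parabolicSet P (∞ : OnePoint E)).ncard := by
    rw [ncard_parabolicSet_infty hPm]
    omega
  obtain ⟨y, hy, hym, hcov⟩ := exists_second_orbit hD hP hr2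
  obtain ⟨z, hz⟩ := exists_fixed_point_of_le hPm s
  have hznf : z ∈ nonfree P (OnePoint E) := by
    intro hb
    have : s ∈ stabilizer P z := hz
    rw [hb, Subgroup.mem_bot] at this
    rw [this, orderOf_one] at hs
    omega
  have hcard := ncard_orbit_mul_card_stabilizer (P := P) (∞ : OnePoint E)
  have hcardy := ncard_orbit_mul_card_stabilizer (P := P) y
  rw [ncard_parabolicSet_infty hPm, hn] at hym
  rw [← hcard, hn, card_stabilizer_infty hPm] at hcardy
  have h6 : 6 ≤ Nat.card (stabilizer P y) ∨ 6 ≤ Nat.card (translations P) := by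
    rcases hcov z hznf with h | h
    · right
      obtain ⟨g, rfl⟩ := h
      have hfix : (g⁻¹ * s * g) • (∞ : OnePoint E) = ∞ := by
        rw [mul_smul, mul_smul, inv_smul_eq_iff]
        exact hz
      have ho := orderOf_le_card_translations hPm h1 hfix
      have : orderOf (g⁻¹ * s * g) = orderOf s := by
        have := (MulAut.conj g⁻¹).orderOf_eq s
        simpa [MulAut.conj_apply] using this
      omega
    · left
      rw [← card_stabilizer_of_mem_orbit h]
      exact hs.trans (orderOf_le_card_stabilizer hz)
  rcases orbit_arithmetic (by omega) hk0 (by omega) ht hym hcardy h6 with ⟨h2, hm⟩ | ⟨ht1, hk2⟩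
  · exfalso
    rcases hcov z hznf with h | h
    · have h6' := orderOf_le_card_stabilizer hz
      rw [card_stabilizer_of_mem_orbit h, card_stabilizer_infty hPm, h2] at h6'
      omega
    · rw [← orbit_eq_iff.2 h] at hm
      exact ncard_orbit_ne_two hP hz hm
  · have hKcard : Nat.card (scalarField P).toAddSubgroup = Nat.card (translations P) := by
      obtain ⟨c, hc⟩ := hKr
      have : c = 1 := by
        by_contra hc1
        have : 2 ≤ c := by
          rcases c with _ | _ | c <;> omega
        have : Nat.card (scalarField P).toAddSubgroup * 2 ≤ Nat.card (translations P) :=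
          hc ▸ Nat.mul_le_mul_left _ this
        omega
      rw [hc, this, mul_one]
    have hKA : (scalarField P).toAddSubgroup = translations P :=
      AddSubgroup.eq_of_le_of_card_ge (scalarField_le h1) hKcard.ge
    have hKcard' : Nat.card (scalarField P) = Nat.card (translations P) := hKcard
    have horb : ∀ x : OnePoint E, x ∈ orbit P (∞ : OnePoint E) ↔
        x = ∞ ∨ ∃ k ∈ scalarField P, x = ((k : E) : OnePoint E) := by
      have hmem : ∀ k : E, k ∈ scalarField P ↔ k ∈ translations P := fun k => by
        rw [← hKA]
        rfl
      intro x
      cases x with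
      | infty => simp [mem_orbit_self]
      | coe x =>
        simp only [OnePoint.coe_ne_infty, OnePoint.coe_eq_coe, false_or, exists_eq_right', hmem]
        refine ⟨hS ht1 x, fun hx => ?_⟩
        have := mem_orbit_of_mem_orbit (⟨affinePerm 1 x, hx⟩ : P) h0
        simpa [Subgroup.smul_def] using this
    refine ⟨Nat.finite_of_card_ne_zero (by omega), fun γ hγ => ?_,
      Nat.card (multipliers P), ?_, by omega⟩
    · refine sq_trace_div_det_mem (fun x hx => ?_) ?_
      · rw [← horb] at hx ⊢
        exact mem_orbit_of_mem_orbit (⟨_, hγ⟩ : P) hx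
      · rw [← horb]
        exact mem_orbit (∞ : OnePoint E) ((⟨_, hγ⟩ : P)⁻¹)
    · rw [← hcard, hn, card_stabilizer_infty hPm, ht1, hKcard']
      ring

/-- A finite group of Möbius transformations that is neither small nor reducible is of
subfield type. -/
theorem exists_isOfSubfieldType [Finite P] (hPm : P ≤ moebius E) {s : P} (hs : 6 ≤ orderOf s)
    (hP : IsNondegenerate P (OnePoint E) s) : ∃ K : Subfield E, IsOfSubfieldType P K := by
  have hD := hasOneOrTwoFixedPoints_of_le hPm
  obtain ⟨z, hz⟩ := exists_fixed_point_of_le hPm s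
  obtain ⟨x, hx⟩ := exists_parabolic hD hs hP hz
  obtain ⟨g, hg⟩ := hP.not_fixed x
  obtain ⟨u, hu, hu1⟩ := Set.exists_ne_of_one_lt_ncard hx 1
  have hu := hu.resolve_left hu1
  have hux : u • x = x := (hu x).2 rfl
  have hug : u • g • x ≠ g • x := fun h => hg ((hu _).1 h)
  have hxu : x ≠ u • g • x := fun h => hg (smul_left_cancel u (by rw [← h, hux]))
  obtain ⟨_, ⟨δ, rfl⟩, hδx, hδg, hδu⟩ := exists_moebius_triple hg.symm hxu hug.symm
  set Δ := MulAction.toPermHom (GL (Fin 2) E) (OnePoint E) δ with hΔ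
  let e : P ≃* P.map (MulAut.conj Δ).toMonoidHom :=
    P.equivMapOfInjective _ (MulAut.conj Δ).injective
  have he : ∀ (a : P) (w : OnePoint E), e a • Δ w = Δ (a • w) := by
    intro a w
    change (Δ * a * Δ⁻¹) (Δ w) = _
    simp [Subgroup.smul_def]
  have he' : ∀ (a : P) (w : OnePoint E), e a • w = Δ (a • Δ⁻¹ w) := by
    intro a w
    rw [← he]
    simp
  have : Finite (P.map (MulAut.conj Δ).toMonoidHom) := Finite.of_equiv _ e.toEquiv
  have hPm' : P.map (MulAut.conj Δ).toMonoidHom ≤ moebius E := by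
    rintro _ ⟨a, ha, rfl⟩
    exact mul_mem (mul_mem (toPerm_mem_moebius δ) (hPm ha)) (inv_mem (toPerm_mem_moebius δ))
  have hN : IsNondegenerate (P.map (MulAut.conj Δ).toMonoidHom) (OnePoint E) (e s) := by
    refine ⟨fun w => ?_, fun w w' hww hw hw' h => ?_⟩
    · obtain ⟨a, ha⟩ := hP.not_fixed (Δ⁻¹ w)
      refine ⟨e a, fun h => ha ?_⟩
      rw [he', ← Equiv.Perm.eq_inv_iff_eq] at h
      exact h
    · rw [he', ← Equiv.Perm.eq_inv_iff_eq] at hw hw'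
      refine hP.not_pair (Δ⁻¹ w) (Δ⁻¹ w') (fun h => hww (Δ⁻¹.injective h)) hw hw' fun a => ?_
      have := h (e a)
      simpa only [he', ← Equiv.Perm.eq_inv_iff_eq] using this
  have h0 : ((0 : E) : OnePoint E) ∈ orbit (P.map (MulAut.conj Δ).toMonoidHom) (∞ : OnePoint E) := by
    refine ⟨e g, ?_⟩
    change e g • (∞ : OnePoint E) = _
    rw [← hδx, he, hδg]
  have h1 : (1 : E) ∈ translations (P.map (MulAut.conj Δ).toMonoidHom) := by
    obtain ⟨a, b, hab⟩ := exists_affinePerm (hPm' (e u).2) (show e u • (∞ : OnePoint E) = ∞ by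
      rw [← hδx, he, hux])
    have hne : affinePerm a b ≠ 1 := by
      rw [← hab]
      intro h
      exact hu1 (e.injective (by rw [map_one]; exact Subtype.ext h))
    have ha : a = 1 := by
      rcases affinePerm_fixed hne with h | h
      · exact h.1
      · exfalso
        have h2 := (h.2 ((b / (1 - a) : E) : OnePoint E)).2 (Or.inr rfl)
        rw [← hab] at h2
        have h2 : e u • ((b / (1 - a) : E) : OnePoint E) = ((b / (1 - a) : E) : OnePoint E) := h2
        rw [he', ← Equiv.Perm.eq_inv_iff_eq, hu, Equiv.Perm.inv_eq_iff_eq, hδx] at h2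
        exact OnePoint.coe_ne_infty _ h2
    have hb : b = 1 := by
      have h2 : e u • ((0 : E) : OnePoint E) = ((1 : E) : OnePoint E) := by
        rw [← hδg, he, hδu]
      rw [Subgroup.smul_def, hab, Equiv.Perm.smul_def, affinePerm_coe] at h2
      simpa using h2
    rw [mem_translations, ← hb, ← ha, ← hab]
    exact (e u).2
  obtain ⟨hK, htr, k, hcard, hk⟩ := isOfSubfieldType_scalarField hPm' h1 h0
    (by rwa [MulEquiv.orderOf_eq]) hN
  refine ⟨_, hK, fun γ hγ => ?_, k, ?_, hk⟩
  · have := htr (δ * γ * δ⁻¹) ⟨_, hγ, by rw [map_mul, map_mul, map_inv]; rfl⟩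
    have ht : (δ * γ * δ⁻¹).val.trace = γ.val.trace := by
      rw [Units.val_mul, Units.val_mul, Matrix.trace_mul_comm, ← mul_assoc, ← Units.val_mul,
        inv_mul_cancel, Units.val_one, one_mul]
    have hd : (δ * γ * δ⁻¹).val.det = γ.val.det := by
      rw [Units.val_mul, Units.val_mul, det_mul_right_comm, ← Units.val_mul, mul_inv_cancel,
        Units.val_one, one_mul]
    rwa [ht, hd] at this
  · rw [← hcard]
    exact Nat.card_congr e.toEquiv

end Structure

section SquareSubfield

variable {F : Type*} [Field F]

/-- The elements whose square satisfies `u ^ p ^ m = u` for some `m ≤ n` with `4 ≤ p ^ m`. -/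
def squareSubfieldSet (F : Type*) [Field F] (p n : ℕ) : Set F :=
  {t | ∃ m, 1 ≤ m ∧ m ≤ n ∧ 4 ≤ p ^ m ∧ (t ^ 2) ^ p ^ m = t ^ 2}

lemma ncard_pow_eq_self_le {N : ℕ} (hN : 2 ≤ N) :
    {t : F | t ^ N = t}.Finite ∧ {t : F | t ^ N = t}.ncard ≤ N := by
  classical
  have h : (Polynomial.X ^ N - Polynomial.X : Polynomial F) ≠ 0 :=
    FiniteField.X_pow_card_sub_X_ne_zero F hN
  have hsub : {t : F | t ^ N = t} ⊆
      ((Polynomial.X ^ N - Polynomial.X : Polynomial F).roots.toFinset : Set F) := by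
    intro t ht
    simpa [h, sub_eq_zero] using ht
  refine ⟨(Finset.finite_toSet _).subset hsub, (Set.ncard_le_ncard hsub).trans ?_⟩
  rw [Set.ncard_coe_finset]
  exact (Multiset.toFinset_card_le _).trans ((Polynomial.card_roots' _).trans
    (FiniteField.X_pow_card_sub_X_natDegree_eq F hN).le)

lemma ncard_sq_pow_eq_self_le {N : ℕ} (hN : 2 ≤ N) :
    {t : F | (t ^ 2) ^ N = t ^ 2}.ncard ≤ 2 * N - 1 := by
  have hsub : {t : F | (t ^ 2) ^ N = t ^ 2} ⊆ {t : F | t ^ (2 * N - 1) = t} := by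
    intro t ht
    rcases eq_or_ne t 0 with rfl | h0
    · simp
      omega
    · have ht : (t ^ 2) ^ N = t ^ 2 := ht
      refine mul_right_cancel₀ h0 ?_
      rw [← pow_succ, ← pow_two, ← ht, ← pow_mul]
      congr 1
      omega
  have := ncard_pow_eq_self_le (F := F) (N := 2 * N - 1) (by omega)
  exact (Set.ncard_le_ncard hsub this.1).trans this.2

lemma ncard_sq_pow_eq_self_le_of_charP_two [CharP F 2] {N : ℕ} (hN : 2 ≤ N) :
    {t : F | (t ^ 2) ^ N = t ^ 2}.ncard ≤ N := by
  have hsub : {t : F | (t ^ 2) ^ N = t ^ 2} ⊆ {t : F | t ^ N = t} := by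
    intro t ht
    have ht : (t ^ 2) ^ N = t ^ 2 := ht
    rw [← pow_mul, mul_comm, pow_mul] at ht
    exact CharTwo.sq_injective ht
  have := ncard_pow_eq_self_le (F := F) hN
  exact (Set.ncard_le_ncard hsub this.1).trans this.2

lemma squareSubfieldSet_eq_empty {p n : ℕ} (h : ∀ m, 1 ≤ m → m ≤ n → p ^ m < 4) :
    squareSubfieldSet F p n = ∅ := by
  refine Set.eq_empty_of_forall_notMem ?_
  rintro t ⟨m, h1, h2, h3, -⟩
  have := h m h1 h2
  omega

lemma ncard_squareSubfieldSet_succ_le [Finite F] (p n : ℕ) :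
    (squareSubfieldSet F p (n + 1)).ncard ≤ (squareSubfieldSet F p n).ncard +
      {t : F | (t ^ 2) ^ p ^ (n + 1) = t ^ 2}.ncard := by
  refine (Set.ncard_le_ncard (t := squareSubfieldSet F p n ∪
    {t : F | (t ^ 2) ^ p ^ (n + 1) = t ^ 2}) ?_ (Set.toFinite _)).trans (Set.ncard_union_le _ _)
  rintro t ⟨m, h1, h2, h3, h4⟩
  rcases h2.lt_or_eq with h | rfl
  · exact Or.inl ⟨m, h1, by omega, h3, h4⟩
  · exact Or.inr h4

lemma ncard_squareSubfieldSet_two [Finite F] [CharP F 2] (n : ℕ) :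
    (squareSubfieldSet F 2 (n + 1)).ncard + 4 ≤ 2 * 2 ^ (n + 1) := by
  induction n with
  | zero =>
    rw [squareSubfieldSet_eq_empty]
    · simp
    · intro m h1 h2
      obtain rfl : m = 1 := by omega
      norm_num
  | succ n ih =>
    have h1 := ncard_squareSubfieldSet_succ_le (F := F) 2 (n + 1)
    have h2 := ncard_sq_pow_eq_self_le_of_charP_two (F := F) (N := 2 ^ (n + 1 + 1))
      (by rw [pow_succ]; have := Nat.one_le_two_pow (n := n + 1); omega)
    omega

lemma ncard_squareSubfieldSet_three [Finite F] (n : ℕ) :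
    (squareSubfieldSet F 3 (n + 1)).ncard + 9 ≤ 3 * 3 ^ (n + 1) := by
  induction n with
  | zero =>
    rw [squareSubfieldSet_eq_empty]
    · simp
    · intro m h1 h2
      obtain rfl : m = 1 := by omega
      norm_num
  | succ n ih =>
    have h1 := ncard_squareSubfieldSet_succ_le (F := F) 3 (n + 1)
    have h3 : 1 ≤ 3 ^ (n + 1) := Nat.one_le_pow _ _ (by norm_num)
    have h2 := ncard_sq_pow_eq_self_le (F := F) (N := 3 ^ (n + 1 + 1))
      (by rw [pow_succ]; omega)
    omega

lemma ncard_squareSubfieldSet_of_five_le [Finite F] {p : ℕ} (hp : 5 ≤ p) (n : ℕ) :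
    (squareSubfieldSet F p (n + 1)).ncard + 6 ≤ 3 * p ^ (n + 1) := by
  induction n with
  | zero =>
    have h1 := ncard_squareSubfieldSet_succ_le (F := F) p 0
    have h2 := ncard_sq_pow_eq_self_le (F := F) (N := p ^ (0 + 1)) (by rw [zero_add, pow_one]; omega)
    rw [squareSubfieldSet_eq_empty (n := 0) (by omega), Set.ncard_empty] at h1
    rw [zero_add, pow_one] at *
    omega
  | succ n ih =>
    have h1 := ncard_squareSubfieldSet_succ_le (F := F) p (n + 1)
    have h3 : 1 ≤ p ^ (n + 1) := Nat.one_le_pow _ _ (by omega)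
    have h4 : 5 * p ^ (n + 1) ≤ p ^ (n + 1 + 1) := by
      rw [pow_succ, mul_comm]
      exact Nat.mul_le_mul_left _ hp
    have h2 := ncard_sq_pow_eq_self_le (F := F) (N := p ^ (n + 1 + 1)) (by omega)
    omega

lemma ncard_squareSubfieldSet_lt [Finite F] {p f : ℕ} (hp : p.Prime) [CharP F p]
    (hq : 7 ≤ p ^ f) :
    2 * (3 * p ^ f + (squareSubfieldSet F p (f / 2)).ncard * (p ^ f + 1)) < (p ^ f) ^ 2 - 1 := by
  have hy : (p ^ (f / 2)) ^ 2 ≤ p ^ f := by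
    rw [← pow_mul]
    exact Nat.pow_le_pow_right hp.pos (by omega)
  rcases hn : f / 2 with _ | n
  · rw [squareSubfieldSet_eq_empty (by omega), Set.ncard_empty]
    obtain ⟨e, he⟩ := Nat.exists_eq_add_of_le hq
    rw [he]
    apply lt_tsub_of_add_lt_right
    nlinarith
  rw [hn] at hy
  obtain ⟨e, he⟩ := Nat.exists_eq_add_of_le hy
  generalize hB : (squareSubfieldSet F p (n + 1)).ncard = B
  rcases (show p = 2 ∨ p = 3 ∨ 5 ≤ p by
    have := hp.two_le
    by_contra! h
    obtain rfl : p = 4 := by omega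
    exact absurd hp (by decide)) with rfl | rfl | h5
  · have := ncard_squareSubfieldSet_two (F := F) n
    rw [hB] at this
    have hyn : 2 ^ (n + 1) = 2 ∨ 4 ≤ 2 ^ (n + 1) := by
      rcases n with _ | n
      · exact Or.inl rfl
      · have := Nat.one_le_two_pow (n := n)
        omega
    generalize hyy : 2 ^ (n + 1) = y at *
    rw [he] at hq ⊢
    apply lt_tsub_of_add_lt_right
    have h2 : B * (y ^ 2 + e + 1) + 4 * (y ^ 2 + e + 1) ≤ 2 * y * (y ^ 2 + e + 1) := by
      rw [← add_mul]
      exact Nat.mul_le_mul_right _ this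
    rcases hyn with rfl | hyn
    · nlinarith
    · obtain ⟨w, rfl⟩ := Nat.exists_eq_add_of_le hyn
      zify at h2 ⊢
      nlinarith [show (0 : ℤ) ≤ w from by positivity, show (0 : ℤ) ≤ e * w from by positivity,
        show (0 : ℤ) ≤ e * w ^ 2 from by positivity, show (0 : ℤ) ≤ w ^ 2 from by positivity,
        show (0 : ℤ) ≤ w ^ 3 from by positivity, show (0 : ℤ) ≤ w ^ 4 from by positivity,
        show (0 : ℤ) ≤ (e : ℤ) ^ 2 from by positivity, show (0 : ℤ) ≤ e from by positivity]
  · have := ncard_squareSubfieldSet_three (F := F) n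
    rw [hB] at this
    have hy3 : 3 ≤ 3 ^ (n + 1) := Nat.le_self_pow (by omega) 3
    generalize hyy : 3 ^ (n + 1) = y at *
    rw [he] at hq ⊢
    apply lt_tsub_of_add_lt_right
    have h2 : B * (y ^ 2 + e + 1) + 9 * (y ^ 2 + e + 1) ≤ 3 * y * (y ^ 2 + e + 1) := by
      rw [← add_mul]
      exact Nat.mul_le_mul_right _ this
    obtain ⟨w, rfl⟩ := Nat.exists_eq_add_of_le hy3
    zify at h2 ⊢
    nlinarith [show (0 : ℤ) ≤ w from by positivity, show (0 : ℤ) ≤ e * w from by positivity,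
      show (0 : ℤ) ≤ e * w ^ 2 from by positivity, show (0 : ℤ) ≤ w ^ 2 from by positivity,
      show (0 : ℤ) ≤ w ^ 3 from by positivity, show (0 : ℤ) ≤ w ^ 4 from by positivity,
      show (0 : ℤ) ≤ (e : ℤ) ^ 2 from by positivity, show (0 : ℤ) ≤ e from by positivity]
  · have := ncard_squareSubfieldSet_of_five_le (F := F) h5 n
    rw [hB] at this
    have hy5 : 5 ≤ p ^ (n + 1) := h5.trans (Nat.le_self_pow (by omega) p)
    generalize hyy : p ^ (n + 1) = y at *
    rw [he] at hq ⊢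
    apply lt_tsub_of_add_lt_right
    have h2 : B * (y ^ 2 + e + 1) + 6 * (y ^ 2 + e + 1) ≤ 3 * y * (y ^ 2 + e + 1) := by
      rw [← add_mul]
      exact Nat.mul_le_mul_right _ this
    obtain ⟨w, rfl⟩ := Nat.exists_eq_add_of_le hy5
    zify at h2 ⊢
    nlinarith [show (0 : ℤ) ≤ w from by positivity, show (0 : ℤ) ≤ e * w from by positivity,
      show (0 : ℤ) ≤ e * w ^ 2 from by positivity, show (0 : ℤ) ≤ w ^ 2 from by positivity,
      show (0 : ℤ) ≤ w ^ 3 from by positivity, show (0 : ℤ) ≤ w ^ 4 from by positivity,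
      show (0 : ℤ) ≤ (e : ℤ) ^ 2 from by positivity, show (0 : ℤ) ≤ e from by positivity]

end SquareSubfield

section SpecialLinear

variable {F : Type*} [Field F]

lemma slTwo_det (g : SpecialLinearGroup (Fin 2) F) :
    g 0 0 * g 1 1 - g 0 1 * g 1 0 = 1 := by
  rw [← det_fin_two]
  exact g.det_coe

lemma slTwo_ext {g h : SpecialLinearGroup (Fin 2) F} (h00 : g 0 0 = h 0 0)
    (h01 : g 0 1 = h 0 1) (h10 : g 1 0 = h 1 0) (h11 : g 1 1 = h 1 1) : g = h := by
  ext i j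
  fin_cases i <;> fin_cases j <;> assumption

lemma slTwo_mul_inv (g h : SpecialLinearGroup (Fin 2) F) :
    (g * h⁻¹).1 = !![g 0 0 * h 1 1 - g 0 1 * h 1 0, g 0 1 * h 0 0 - g 0 0 * h 0 1;
      g 1 0 * h 1 1 - g 1 1 * h 1 0, g 1 1 * h 0 0 - g 1 0 * h 0 1] := by
  rw [Matrix.SpecialLinearGroup.coe_mul, Matrix.SpecialLinearGroup.coe_inv, adjugate_fin_two]
  ext i j
  fin_cases i <;> fin_cases j <;> simp [mul_apply, Fin.sum_univ_two] <;> ring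

/-- In `SL₂(F)`, there are at most `q² + q` elements with a given trace. -/
lemma ncard_trace_eq_le [Finite F] (t : F) :
    {g : SpecialLinearGroup (Fin 2) F | g.1.trace = t}.ncard ≤ Nat.card F ^ 2 + Nat.card F := by
  classical
  have hq : 2 ≤ Nat.card F := Finite.one_lt_card
  have hA : {g : SpecialLinearGroup (Fin 2) F | g.1.trace = t ∧ g 0 1 ≠ 0}.ncard ≤
      Nat.card F * (Nat.card F - 1) := by
    have h := Set.ncard_le_ncard_of_injOn (t := (Set.univ : Set F) ×ˢ ({0}ᶜ : Set F))
      (s := {g : SpecialLinearGroup (Fin 2) F | g.1.trace = t ∧ g 0 1 ≠ 0})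
      (fun g => (g 0 0, g 0 1)) (fun g hg => by simpa using hg.2) ?_ (Set.toFinite _)
    · rwa [Set.ncard_prod, Set.ncard_univ, Set.ncard_compl, Set.ncard_singleton] at h
    · rintro g ⟨hg, hg0⟩ h ⟨hh, hh0⟩ hgh
      obtain ⟨h1, h2⟩ := Prod.mk.inj hgh
      rw [trace_fin_two] at hg hh
      have h3 : g 1 1 = h 1 1 := by
        have : g 0 0 + g 1 1 = h 0 0 + h 1 1 := hg.trans hh.symm
        rw [h1] at this
        exact add_left_cancel this
      refine slTwo_ext h1 h2 (mul_left_cancel₀ hg0 ?_) h3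
      have e1 := slTwo_det g
      have e2 := slTwo_det h
      rw [h1, h3] at e1
      have : g 0 1 * g 1 0 = h 0 1 * h 1 0 := by linear_combination e2 - e1
      rw [this, h2]
  have hB : {g : SpecialLinearGroup (Fin 2) F | g.1.trace = t ∧ g 0 1 = 0}.ncard ≤
      2 * Nat.card F := by
    set R : Set F := {a | a * a - t * a + 1 = 0}
    have hR : R.ncard ≤ 2 := by
      by_contra! h
      obtain ⟨a, b, c, ha, hb, hc, hab, hac, hbc⟩ := (Set.two_lt_ncard_iff (Set.toFinite R)).1 h
      have ha : a * a - t * a + 1 = 0 := ha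
      have hb : b * b - t * b + 1 = 0 := hb
      have hc : c * c - t * c + 1 = 0 := hc
      have h1 : a + b = t := by
        refine mul_left_cancel₀ (sub_ne_zero.2 hab) ?_
        linear_combination ha - hb
      have h2 : a + c = t := by
        refine mul_left_cancel₀ (sub_ne_zero.2 hac) ?_
        linear_combination ha - hc
      exact hbc (add_left_cancel (h1.trans h2.symm))
    have h := Set.ncard_le_ncard_of_injOn (t := R ×ˢ (Set.univ : Set F))
      (s := {g : SpecialLinearGroup (Fin 2) F | g.1.trace = t ∧ g 0 1 = 0})
      (fun g => (g 0 0, g 1 0)) (fun g hg => ?_) ?_ (Set.toFinite _)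
    · rw [Set.ncard_prod, Set.ncard_univ] at h
      exact h.trans (Nat.mul_le_mul_right _ hR)
    · have e := slTwo_det g
      have h1 := hg.1
      rw [trace_fin_two] at h1
      rw [hg.2] at e
      have : g 0 0 * g 0 0 - t * g 0 0 + 1 = 0 := by
        rw [← h1]
        linear_combination -e
      simpa [R] using this
    · rintro g ⟨hg, hg0⟩ h ⟨hh, hh0⟩ hgh
      obtain ⟨h1, h2⟩ := Prod.mk.inj hgh
      rw [trace_fin_two] at hg hh
      have h3 : g 1 1 = h 1 1 := by
        have : g 0 0 + g 1 1 = h 0 0 + h 1 1 := hg.trans hh.symm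
        rw [h1] at this
        exact add_left_cancel this
      exact slTwo_ext h1 (hg0.trans hh0.symm) h2 h3
  have hsub : {g : SpecialLinearGroup (Fin 2) F | g.1.trace = t} ⊆
      {g | g.1.trace = t ∧ g 0 1 ≠ 0} ∪ {g | g.1.trace = t ∧ g 0 1 = 0} := by
    intro g hg
    by_cases h : g 0 1 = 0
    · exact Or.inr ⟨hg, h⟩
    · exact Or.inl ⟨hg, h⟩
  have := (Set.ncard_le_ncard hsub (Set.toFinite _)).trans (Set.ncard_union_le _ _)
  obtain ⟨e, he⟩ := Nat.exists_eq_add_of_le hq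
  rw [he] at hA hB ⊢
  rw [show 2 + e - 1 = 1 + e by omega] at hA
  nlinarith

lemma card_specialLinearGroup_fin_two [Finite F] :
    Nat.card (SpecialLinearGroup (Fin 2) F) = Nat.card F * (Nat.card F ^ 2 - 1) := by
  have := Fintype.ofFinite F
  have hq : 2 ≤ Nat.card F := Finite.one_lt_card
  have hGL := card_GL_field (𝔽 := F) 2
  rw [Fin.prod_univ_two, ← Nat.card_eq_fintype_card] at hGL
  have hker : (GeneralLinearGroup.det : GL (Fin 2) F →* Fˣ).ker =
      (Matrix.SpecialLinearGroup.toGL : SpecialLinearGroup (Fin 2) F →* GL (Fin 2) F).range := by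
    ext g
    constructor
    · intro hg
      exact ⟨⟨g.1, congrArg Units.val (MonoidHom.mem_ker.1 hg)⟩, Units.ext rfl⟩
    · rintro ⟨h, rfl⟩
      exact Units.ext h.det_coe
  have h1 := (GeneralLinearGroup.det : GL (Fin 2) F →* Fˣ).ker.card_mul_index
  rw [Subgroup.index_ker, MonoidHom.range_eq_top.2 GeneralLinearGroup.det_surjective,
    Subgroup.card_top, Nat.card_units, hGL, hker,
    ← Nat.card_congr (MonoidHom.ofInjective Matrix.SpecialLinearGroup.toGL_injective).toEquiv] at h1
  refine Nat.eq_of_mul_eq_mul_right (show 0 < Nat.card F - 1 by omega) (h1.trans ?_)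
  obtain ⟨e, he⟩ := Nat.exists_eq_add_of_le hq
  rw [he]
  simp only [Fin.val_zero, Fin.val_one, pow_zero, pow_one]
  have : (2 + e) ^ 2 - (2 + e) = (2 + e) * (2 + e - 1) := by
    rw [Nat.mul_sub, mul_one, pow_two]
  rw [this]
  ring

end SpecialLinear

section Action

variable {F : Type*} [Field F] (E : Type*) [Field E] [DecidableEq E] [Algebra F E]

/-- The action of `SL₂(F)` on the projective line over an extension `E` of `F`. -/
noncomputable def slPerm : SpecialLinearGroup (Fin 2) F →* Equiv.Perm (OnePoint E) :=
  (MulAction.toPermHom (GL (Fin 2) E) (OnePoint E)).comp (Matrix.SpecialLinearGroup.mapGL E)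

variable {E}

lemma slPerm_mem_moebius (g : SpecialLinearGroup (Fin 2) F) : slPerm E g ∈ moebius E := ⟨_, rfl⟩

lemma slPerm_infty (g : SpecialLinearGroup (Fin 2) F) :
    slPerm E g ∞ = if algebraMap F E (g 1 0) = 0 then ∞ else
      ((algebraMap F E (g 0 0) / algebraMap F E (g 1 0) : E) : OnePoint E) :=
  smul_infty_eq_ite (Matrix.SpecialLinearGroup.mapGL E g)

lemma slPerm_coe (g : SpecialLinearGroup (Fin 2) F) (x : E) :
    slPerm E g (x : OnePoint E) =
      if algebraMap F E (g 1 0) * x + algebraMap F E (g 1 1) = 0 then ∞ else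
        (((algebraMap F E (g 0 0) * x + algebraMap F E (g 0 1)) /
          (algebraMap F E (g 1 0) * x + algebraMap F E (g 1 1)) : E) : OnePoint E) :=
  smul_some_eq_ite (g := Matrix.SpecialLinearGroup.mapGL E g)

/-- At most `q²` elements of `SL₂(F)` map a given point to another given point. -/
lemma ncard_slPerm_apply_eq_le [Finite F] (x y : OnePoint E) :
    {g : SpecialLinearGroup (Fin 2) F | slPerm E g x = y}.ncard ≤ Nat.card F ^ 2 := by
  have key : ∀ f : SpecialLinearGroup (Fin 2) F → F × F,
      Set.InjOn f {g | slPerm E g x = y} →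
      {g : SpecialLinearGroup (Fin 2) F | slPerm E g x = y}.ncard ≤ Nat.card F ^ 2 := by
    intro f hf
    have := Set.ncard_le_ncard_of_injOn (t := Set.univ) f (fun _ _ => Set.mem_univ _) hf
      (Set.toFinite _)
    rwa [Set.ncard_univ, Nat.card_prod, ← pow_two] at this
  have hfix : ∀ g h : SpecialLinearGroup (Fin 2) F, slPerm E g x = y → slPerm E h x = y →
      slPerm E (g * h⁻¹) y = y := by
    intro g h hg hh
    rw [map_mul, map_inv, Equiv.Perm.mul_apply, Equiv.Perm.inv_eq_iff_eq.2 hh.symm, hg]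
  cases y with
  | infty =>
    refine key (fun g => (g 0 0, g 0 1)) fun g hg h hh hgh => ?_
    obtain ⟨h1, h2⟩ := Prod.mk.inj hgh
    have h3 := hfix g h hg hh
    rw [slPerm_infty] at h3
    split_ifs at h3 with h4
    · rw [map_eq_zero, slTwo_mul_inv] at h4
      have h4 : g 1 0 * h 1 1 - g 1 1 * h 1 0 = 0 := h4
      have e1 := slTwo_det g
      have e2 := slTwo_det h
      rw [h1, h2] at e1
      refine slTwo_ext h1 h2 ?_ ?_
      · linear_combination h 1 0 * e1 - g 1 0 * e2 + h 0 0 * h4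
      · linear_combination h 1 1 * e1 - g 1 1 * e2 + h 0 1 * h4
    · exact absurd h3 (OnePoint.coe_ne_infty _)
  | coe y =>
    refine key (fun g => (g 1 0, g 1 1)) fun g hg h hh hgh => ?_
    obtain ⟨h1, h2⟩ := Prod.mk.inj hgh
    have h3 := hfix g h hg hh
    have e1 := slTwo_det g
    have e2 := slTwo_det h
    rw [h1, h2] at e1
    have h10 : (g * h⁻¹).1 1 0 = 0 := by
      rw [slTwo_mul_inv]
      change g 1 0 * h 1 1 - g 1 1 * h 1 0 = 0
      rw [h1, h2]
      ring
    have h11 : (g * h⁻¹).1 1 1 = 1 := by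
      rw [slTwo_mul_inv]
      change g 1 1 * h 0 0 - g 1 0 * h 0 1 = 1
      rw [h1, h2]
      linear_combination e2
    have h00 : (g * h⁻¹).1 0 0 = 1 := by
      rw [slTwo_mul_inv]
      change g 0 0 * h 1 1 - g 0 1 * h 1 0 = 1
      exact e1
    have h01 : (g * h⁻¹).1 0 1 = 0 := by
      rw [slPerm_coe, h10, h11, h00] at h3
      simpa using h3
    have : g * h⁻¹ = 1 := slTwo_ext h00 h01 h10 h11
    exact mul_inv_eq_one.1 this

lemma ker_slPerm : (slPerm (F := F) E).ker = Subgroup.center (SpecialLinearGroup (Fin 2) F) := by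
  ext g
  rw [MonoidHom.mem_ker, Matrix.SpecialLinearGroup.mem_center_iff]
  constructor
  · intro h
    have hi := congrArg (fun σ => σ ∞) h
    have h0 := congrArg (fun σ => σ ((0 : E) : OnePoint E)) h
    have h1 := congrArg (fun σ => σ ((1 : E) : OnePoint E)) h
    simp only [slPerm_infty, slPerm_coe, Equiv.Perm.one_apply] at hi h0 h1
    have hc : g 1 0 = 0 := by
      split_ifs at hi with h
      · exact (map_eq_zero _).1 h
      · exact absurd hi (OnePoint.coe_ne_infty _)
    have hdet := slTwo_det g
    rw [hc, mul_zero, sub_zero] at hdet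
    have ha : g 0 0 ≠ 0 := left_ne_zero_of_mul_eq_one hdet
    have hd : g 1 1 ≠ 0 := right_ne_zero_of_mul_eq_one hdet
    have hb : g 0 1 = 0 := by simpa [hc, hd] using h0
    have had : g 0 0 = g 1 1 := by simpa [hc, hb, hd, div_eq_one_iff_eq] using h1
    refine ⟨g 1 1, ?_, ?_⟩
    · rw [Fintype.card_fin, pow_two]
      rwa [had] at hdet
    · ext i j
      fin_cases i <;> fin_cases j <;> simp [had, hb, hc]
  · rintro ⟨r, hr, hg⟩
    have hr0 : r ≠ 0 := by
      rintro rfl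
      simp at hr
    have e : ∀ i j, g i j = scalar (Fin 2) r i j := fun i j => by rw [hg]
    ext x
    cases x with
    | infty => simp [slPerm_infty, e]
    | coe x => simp [slPerm_coe, e, hr0]

end Action

section Order

variable {F : Type*} [Field F]

lemma mk_pow_eq_one_of_coe_pow_eq {S : SpecialLinearGroup (Fin 2) F} {n : ℕ} {r : F}
    (h : S.1 ^ n = r • (1 : Matrix (Fin 2) (Fin 2) F)) :
    (QuotientGroup.mk S : ProjectiveSpecialLinearGroup (Fin 2) F) ^ n = 1 := by
  rw [← QuotientGroup.mk_pow, QuotientGroup.eq_one_iff, Matrix.SpecialLinearGroup.mem_center_iff]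
  have hS : (S ^ n).1 = r • (1 : Matrix (Fin 2) (Fin 2) F) := by
    rw [Matrix.SpecialLinearGroup.coe_pow, h]
  refine ⟨r, ?_, ?_⟩
  · have := (S ^ n).det_coe
    rwa [hS, det_smul, det_one, mul_one] at this
  · rw [hS, scalar_apply, smul_one_eq_diagonal]

/-- An element of order greater than five in `PSL₂(F)` is not the image of a matrix whose trace
is twice the cosine of a rational angle with small denominator. -/
lemma trace_ne_of_five_lt_orderOf {S : SpecialLinearGroup (Fin 2) F}
    (hS : 5 < orderOf (QuotientGroup.mk S : ProjectiveSpecialLinearGroup (Fin 2) F)) :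
    S.1.trace ≠ 0 ∧ S.1.trace ^ 2 ≠ 1 ∧ S.1.trace ^ 2 ≠ 2 ∧
      S.1.trace ^ 4 - 3 * S.1.trace ^ 2 + 1 ≠ 0 := by
  have hpow : ∀ n, 0 < n → n ≤ 5 → ∀ r : F, S.1 ^ n ≠ r • (1 : Matrix (Fin 2) (Fin 2) F) := by
    intro n h0 h5 r h
    have := orderOf_le_of_pow_eq_one h0 (mk_pow_eq_one_of_coe_pow_eq h)
    omega
  have hdet := slTwo_det S
  have h2 : S.1 ^ 2 = S.1.trace • S.1 - (1 : Matrix (Fin 2) (Fin 2) F) := by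
    rw [trace_fin_two, pow_two]
    ext i j
    fin_cases i <;> fin_cases j <;> simp [mul_apply, Fin.sum_univ_two] <;>
      first | linear_combination -hdet | ring1
  generalize S.1.trace = t at *
  have h3 : S.1 ^ 3 = (t ^ 2 - 1) • S.1 - t • (1 : Matrix (Fin 2) (Fin 2) F) := by
    rw [pow_succ, h2, sub_mul, smul_mul_assoc, ← pow_two, h2, one_mul]
    module
  have h4 : S.1 ^ 4 = (t ^ 3 - 2 * t) • S.1 - (t ^ 2 - 1) • (1 : Matrix (Fin 2) (Fin 2) F) := by
    rw [pow_succ, h3, sub_mul, smul_mul_assoc, ← pow_two, h2, smul_mul_assoc, one_mul]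
    module
  have h5 : S.1 ^ 5 = (t ^ 4 - 3 * t ^ 2 + 1) • S.1 -
      (t ^ 3 - 2 * t) • (1 : Matrix (Fin 2) (Fin 2) F) := by
    rw [pow_succ, h4, sub_mul, smul_mul_assoc, ← pow_two, h2, smul_mul_assoc, one_mul]
    module
  refine ⟨fun h => ?_, fun h => ?_, fun h => ?_, fun h => ?_⟩
  · refine hpow 2 (by norm_num) (by norm_num) (-1) ?_
    rw [h2, h]
    module
  · refine hpow 3 (by norm_num) (by norm_num) (-t) ?_
    rw [h3, h]
    module
  · refine hpow 4 (by norm_num) (by norm_num) (-1) ?_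
    rw [h4, pow_succ, h]
    module
  · refine hpow 5 (by norm_num) (by norm_num) (-(t ^ 3 - 2 * t)) ?_
    rw [h5, h]
    module

variable {p f : ℕ}

lemma seven_le_of_five_lt_orderOf [Finite F] (hp : p.Prime) (hcard : Nat.card F = p ^ f)
    {S : SpecialLinearGroup (Fin 2) F}
    (hS : 5 < orderOf (QuotientGroup.mk S : ProjectiveSpecialLinearGroup (Fin 2) F)) :
    7 ≤ p ^ f := by
  have := Fintype.ofFinite F
  obtain ⟨h0, h1, h2, h5⟩ := trace_ne_of_five_lt_orderOf hS
  generalize S.1.trace = t at *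
  have hq : 2 ≤ Nat.card F := Finite.one_lt_card
  have ht := FiniteField.pow_card t
  have hz := FiniteField.cast_card_eq_zero F
  rw [← Nat.card_eq_fintype_card] at ht hz
  by_contra! h
  rw [← hcard] at h
  have ht1 : t - 1 ≠ 0 := fun h => h1 (by rw [sub_eq_zero.1 h, one_pow])
  have ht2 : t ^ 2 - 1 ≠ 0 := sub_ne_zero.2 h1
  interval_cases hc : Nat.card F
  · exact mul_ne_zero h0 ht1 (by linear_combination ht)
  · exact mul_ne_zero h0 ht2 (by linear_combination ht)
  · refine mul_ne_zero (mul_ne_zero h0 ht1) h5 ?_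
    have hz : (4 : F) = 0 := by exact_mod_cast hz
    have hz : (2 : F) = 0 := by
      have : (2 : F) ^ 2 = 0 := by linear_combination hz
      exact pow_eq_zero_iff (two_ne_zero) |>.1 this
    linear_combination (t ^ 2 - t + 1) * ht + (t ^ 3 - 2 * t ^ 4 + t ^ 3) * hz
  · have hz : (5 : F) = 0 := by exact_mod_cast hz
    refine mul_ne_zero (mul_ne_zero h0 ht2) h5 ?_
    linear_combination (t ^ 2 - 4) * ht + (t ^ 3 - t) * hz
  · have h2 := (Nat.prime_dvd_prime_iff_eq Nat.prime_two hp).1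
      (Nat.prime_two.dvd_of_dvd_pow (show 2 ∣ p ^ f from hcard ▸ by decide))
    have h3 := (Nat.prime_dvd_prime_iff_eq Nat.prime_three hp).1
      (Nat.prime_three.dvd_of_dvd_pow (show 3 ∣ p ^ f from hcard ▸ by decide))
    omega

end Order

section Subfield

variable {F : Type*} [Field F] {p f : ℕ}

lemma exists_card_subfield_eq_pow [Finite F] (hp : p.Prime) [CharP F p]
    (hcard : Nat.card F = p ^ f) {K : Subfield F} (hK : K ≠ ⊤) :
    ∃ m, 1 ≤ m ∧ m ≤ f / 2 ∧ Nat.card K = p ^ m := by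
  have := Fact.mk hp
  have := Fintype.ofFinite K
  have hf : f ≠ 0 := by
    rintro rfl
    exact Finite.one_lt_card.ne' (hcard.trans (pow_zero p))
  obtain ⟨m, hm, hKm⟩ := FiniteField.card K p
  rw [← Nat.card_eq_fintype_card] at hKm
  have hfin : Nat.card F = Nat.card K ^ Module.finrank K F := Module.natCard_eq_pow_finrank
  have hd1 : Module.finrank K F ≠ 1 := by
    intro h
    rw [h, pow_one] at hfin
    refine hK (SetLike.coe_injective ?_)
    refine Set.eq_of_subset_of_ncard_le (Set.subset_univ _) ?_ (Set.toFinite _)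
    rw [Subfield.coe_top, Set.ncard_univ, hfin]
    exact le_of_eq (Nat.card_coe_set_eq _)
  rw [hcard, hKm, ← pow_mul] at hfin
  have hfm := Nat.pow_right_injective hp.two_le hfin
  have hd : 2 ≤ Module.finrank K F := by
    have : Module.finrank K F ≠ 0 := by
      intro h
      rw [h, mul_zero] at hfm
      exact hf hfm
    omega
  refine ⟨m, m.2, ?_, hKm⟩
  rw [Nat.le_div_iff_mul_le two_pos, hfm]
  exact Nat.mul_le_mul_left _ hd

lemma mem_squareSubfieldSet_of_sq_mem [Finite F] (hp : p.Prime) [CharP F p]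
    (hcard : Nat.card F = p ^ f) {K : Subfield F} (hK : K ≠ ⊤) {u t : F} (hu : u ∈ K)
    (hu0 : u ≠ 0) (hu1 : u ≠ 1) (hu2 : u ≠ 2) (ht : t ^ 2 ∈ K) :
    t ∈ squareSubfieldSet F p (f / 2) := by
  obtain ⟨m, hm1, hmf, hKm⟩ := exists_card_subfield_eq_pow hp hcard hK
  have hpow : ∀ x ∈ K, x ^ p ^ m = x := by
    intro x hx
    have := Fintype.ofFinite K
    have h := FiniteField.pow_card (⟨x, hx⟩ : K)
    rw [← Nat.card_eq_fintype_card, hKm] at h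
    exact congrArg Subtype.val h
  refine ⟨m, hm1, hmf, ?_, hpow _ ht⟩
  have hu' := hpow u hu
  have hK0 : ((p ^ m : ℕ) : F) = 0 := by
    rw [Nat.cast_pow, CharP.cast_eq_zero, zero_pow (by omega)]
  have h2 : 2 ≤ p ^ m := hKm ▸ Finite.one_lt_card
  by_contra! h4
  interval_cases hc : p ^ m
  · exact mul_ne_zero hu0 (sub_ne_zero.2 hu1) (by linear_combination hu')
  · have h3 : (3 : F) = 0 := by exact_mod_cast hK0
    refine mul_ne_zero (mul_ne_zero hu0 (sub_ne_zero.2 hu1)) (sub_ne_zero.2 hu2) ?_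
    linear_combination hu' + (u - u ^ 2) * h3

end Subfield

section Transfer

variable {F : Type*} [Field F] {E : Type*} [Field E] [DecidableEq E] [Algebra F E]

lemma slPerm_neg_one : slPerm (F := F) E (-1) = 1 := by
  ext x
  cases x with
  | infty => simp [slPerm_infty]
  | coe x => simp [slPerm_coe]

lemma eq_top_of_isOfSubfieldType [Finite F] {L : Subgroup (SpecialLinearGroup (Fin 2) F)}
    (hL : -1 ∈ L) {K : Subfield E} (hP : IsOfSubfieldType (L.map (slPerm E)) K)
    (hK : K.comap (algebraMap F E) = ⊤) : L = ⊤ := by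
  obtain ⟨hKfin, -, k, hk, hk'⟩ := hP
  have := Fintype.ofFinite F
  have hFK : Nat.card F ≤ Nat.card K := by
    refine Nat.card_le_card_of_injective
      (fun a : F => (⟨algebraMap F E a, ?_⟩ : K)) fun a b h => ?_
    · exact (hK ▸ Subfield.mem_top a : a ∈ K.comap (algebraMap F E))
    · exact (algebraMap F E).injective (congrArg Subtype.val h)
  have hq : 2 ≤ Nat.card F := Finite.one_lt_card
  have hcard : Nat.card L =
      Nat.card ((slPerm E).domRestrict L).ker * Nat.card (L.map (slPerm E)) := by
    rw [← Subgroup.card_mul_index ((slPerm E).domRestrict L).ker, Subgroup.index_ker,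
      MonoidHom.domRestrict_range]
  have hker : Nat.card K - 1 ≤ Nat.card ((slPerm E).domRestrict L).ker * k := by
    rcases hk' with hk' | hk'
    · rw [← hk']
      refine Nat.mul_le_mul_right _ ?_
      have hne : (-1 : SpecialLinearGroup (Fin 2) F) ≠ 1 := by
        intro h
        have h11 : (-1 : F) = 1 := by
          simpa using congrArg (fun g : SpecialLinearGroup (Fin 2) F => g 0 0) h
        have hchar : ringChar K = 2 := by
          have h2 : (2 : F) = 0 := by linear_combination -h11
          have h2 : (2 : K) = 0 := Subtype.ext <|
            (map_ofNat (algebraMap F E) 2).symm.trans (by rw [h2, map_zero]; rfl)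
          have := CharTwo.of_one_ne_zero_of_two_eq_zero one_ne_zero h2
          exact ringChar.eq K 2
        have := Fintype.ofFinite K
        have he := FiniteField.even_card_of_char_two hchar
        rw [← Nat.card_eq_fintype_card] at he
        omega
      refine Finite.one_lt_card_iff_nontrivial.2 ⟨⟨⟨-1, hL⟩, ?_⟩, 1, fun h => hne ?_⟩
      · exact slPerm_neg_one
      · exact congrArg (fun g => g.1.1) h
    · rw [← hk']
      exact Nat.le_mul_of_pos_left _ Nat.card_pos
  refine Subgroup.eq_top_of_le_card _ ?_
  rw [card_specialLinearGroup_fin_two, hcard, hk]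
  obtain ⟨e, he⟩ := Nat.exists_eq_add_of_le (hq.trans hFK)
  obtain ⟨d, hd⟩ := Nat.exists_eq_add_of_le hFK
  calc Nat.card F * (Nat.card F ^ 2 - 1) ≤ Nat.card K * (Nat.card K ^ 2 - 1) := by gcongr
    _ = Nat.card K * (Nat.card K + 1) * (Nat.card K - 1) := by
      rw [mul_assoc, ← Nat.sq_sub_sq, one_pow]
    _ ≤ Nat.card K * (Nat.card K + 1) * (Nat.card ((slPerm E).domRestrict L).ker * k) := by
      gcongr
    _ = _ := by ring

lemma trace_sq_mem_comap {L : Subgroup (SpecialLinearGroup (Fin 2) F)} {K : Subfield E}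
    (hP : IsOfSubfieldType (L.map (slPerm E)) K) {g : SpecialLinearGroup (Fin 2) F} (hg : g ∈ L) :
    g.1.trace ^ 2 ∈ K.comap (algebraMap F E) := by
  have h := hP.2.1 (Matrix.SpecialLinearGroup.mapGL E g) (Subgroup.mem_map_of_mem _ hg)
  have hdet : (Matrix.SpecialLinearGroup.mapGL E g).val.det = 1 := by
    rw [Matrix.SpecialLinearGroup.mapGL_coe_matrix]
    exact Matrix.SpecialLinearGroup.det_coe _
  have htr : (Matrix.SpecialLinearGroup.mapGL E g).val.trace = algebraMap F E g.1.trace := by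
    rw [Matrix.SpecialLinearGroup.mapGL_coe_matrix, trace_fin_two, trace_fin_two, map_add]
    rfl
  rw [hdet, htr, div_one, ← map_pow] at h
  exact h

end Transfer

section Generation

variable {F : Type*} [Field F] {E : Type*} [Field E] [DecidableEq E] [Algebra F E]

lemma orderOf_slPerm (S : SpecialLinearGroup (Fin 2) F) :
    orderOf (slPerm E S) =
      orderOf (QuotientGroup.mk S : ProjectiveSpecialLinearGroup (Fin 2) F) := by
  refine orderOf_eq_orderOf_iff.2 fun n => ?_
  rw [← map_pow, ← MonoidHom.mem_ker, ker_slPerm, ← QuotientGroup.mk_pow, QuotientGroup.eq_one_iff]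

lemma exists_forall_closure_pair_ne_top_imp [Finite F] [IsAlgClosed E] {p f : ℕ} (hp : p.Prime)
    [CharP F p] (hcard : Nat.card F = p ^ f) {S : SpecialLinearGroup (Fin 2) F}
    (hS : 5 < orderOf (QuotientGroup.mk S : ProjectiveSpecialLinearGroup (Fin 2) F)) :
    ∃ x y : OnePoint E, ∀ g : SpecialLinearGroup (Fin 2) F,
      Subgroup.closure {(QuotientGroup.mk g : ProjectiveSpecialLinearGroup (Fin 2) F),
        QuotientGroup.mk S} ≠ ⊤ →
      slPerm E g x = x ∨ slPerm E g y = y ∨ slPerm E g x = y ∨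
        g.1.trace ∈ squareSubfieldSet F p (f / 2) := by
  have hS1 : slPerm E S ≠ 1 := by
    intro h
    rw [← orderOf_slPerm (E := E), h, orderOf_one] at hS
    omega
  obtain ⟨x, y, hxy⟩ : ∃ x y, ∀ z, slPerm E S z = z → z = x ∨ z = y := by
    rcases moebius_fixed (slPerm_mem_moebius S) hS1 with ⟨x, hx⟩ | ⟨x, y, -, hxy⟩
    · exact ⟨x, x, fun z hz => Or.inl ((hx z).1 hz)⟩
    · exact ⟨x, y, fun z hz => (hxy z).1 hz⟩
  refine ⟨x, y, fun g hg => ?_⟩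
  by_contra! hcon
  obtain ⟨hx, hy, hne, htr⟩ := hcon
  set L := (Subgroup.closure {(QuotientGroup.mk g : ProjectiveSpecialLinearGroup (Fin 2) F),
    QuotientGroup.mk S}).comap (QuotientGroup.mk' _) with hLdef
  have hgL : g ∈ L := Subgroup.subset_closure (Set.mem_insert _ _)
  have hSL : S ∈ L := Subgroup.subset_closure (Set.mem_insert_of_mem _ rfl)
  have hneg : -1 ∈ L := by
    rw [hLdef, Subgroup.mem_comap]
    convert Subgroup.one_mem _
    rw [QuotientGroup.mk'_apply, QuotientGroup.eq_one_iff, ← ker_slPerm (E := E)]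
    exact slPerm_neg_one
  have hLtop : L ≠ ⊤ := by
    intro h
    refine hg ?_
    rw [← Subgroup.map_comap_eq_self_of_surjective (QuotientGroup.mk'_surjective _)
      (Subgroup.closure _), ← hLdef, h, ← MonoidHom.range_eq_map, MonoidHom.range_eq_top]
    exact QuotientGroup.mk'_surjective _
  have hPm : L.map (slPerm E) ≤ moebius E := by
    rintro - ⟨h, -, rfl⟩
    exact slPerm_mem_moebius h
  have : Finite (L.map (slPerm E)) :=
    ((L : Set (SpecialLinearGroup (Fin 2) F)).toFinite.image (slPerm E)).to_subtype
  let g' : L.map (slPerm E) := ⟨slPerm E g, Subgroup.mem_map_of_mem _ hgL⟩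
  let s : L.map (slPerm E) := ⟨slPerm E S, Subgroup.mem_map_of_mem _ hSL⟩
  have hs : 6 ≤ orderOf s := by
    rw [Subgroup.orderOf_mk, orderOf_slPerm]
    exact hS
  have hP : IsNondegenerate (L.map (slPerm E)) (OnePoint E) s := by
    refine ⟨fun z => ?_, fun z z' hzz hz hz' h => ?_⟩
    · by_contra! h
      rcases hxy z (h s) with rfl | rfl
      · exact hx (h g')
      · exact hy (h g')
    · obtain ⟨h1, h2⟩ := h g'
      rcases hxy z hz with rfl | rfl <;> rcases hxy z' hz' with rfl | rfl
      · exact hzz rfl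
      · exact h1.elim hx hne
      · exact h2.elim hne hx
      · exact hzz rfl
  obtain ⟨K, hK⟩ := exists_isOfSubfieldType hPm hs hP
  obtain ⟨h0, h1, h2, -⟩ := trace_ne_of_five_lt_orderOf hS
  refine htr (mem_squareSubfieldSet_of_sq_mem hp hcard (K := K.comap (algebraMap F E))
    (fun h => hLtop (eq_top_of_isOfSubfieldType hneg hK h)) (trace_sq_mem_comap hK hSL)
    (pow_ne_zero 2 h0) h1 h2 (trace_sq_mem_comap hK hgL))

end Generation

section Counting

variable {F : Type*} [Field F]

lemma ncard_trace_mem_le [Finite F] (B : Set F) :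
    {g : SpecialLinearGroup (Fin 2) F | g.1.trace ∈ B}.ncard ≤
      B.ncard * (Nat.card F ^ 2 + Nat.card F) := by
  classical
  have h := Finset.card_le_mul_card_image_of_maps_to
    (s := (Set.toFinite {g : SpecialLinearGroup (Fin 2) F | g.1.trace ∈ B}).toFinset)
    (t := (Set.toFinite B).toFinset) (f := fun g => g.1.trace) (by simp)
    (Nat.card F ^ 2 + Nat.card F) fun t ht => ?_
  · rwa [← Set.ncard_eq_toFinset_card, ← Set.ncard_eq_toFinset_card, mul_comm] at h
  · rw [← Set.ncard_coe_finset]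
    refine (Set.ncard_le_ncard ?_ (Set.toFinite _)).trans (ncard_trace_eq_le t)
    intro g hg
    simp only [Finset.coe_filter] at hg
    exact hg.2

/-- Most elements of `PSL₂(F)` generate the group together with a given element of order greater
than five. -/
lemma two_mul_ncard_closure_pair_ne_top_lt [Finite F] {p f : ℕ} (hp : p.Prime) [CharP F p]
    (hcard : Nat.card F = p ^ f) {s : ProjectiveSpecialLinearGroup (Fin 2) F}
    (hs : 5 < orderOf s) :
    2 * {g : ProjectiveSpecialLinearGroup (Fin 2) F | Subgroup.closure {g, s} ≠ ⊤}.ncard <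
      Nat.card (ProjectiveSpecialLinearGroup (Fin 2) F) := by
  classical
  obtain ⟨S, rfl⟩ := QuotientGroup.mk_surjective s
  set bad := {g : ProjectiveSpecialLinearGroup (Fin 2) F |
    Subgroup.closure {g, (QuotientGroup.mk S : ProjectiveSpecialLinearGroup (Fin 2) F)} ≠ ⊤}
  obtain ⟨x, y, hxy⟩ := exists_forall_closure_pair_ne_top_imp (E := AlgebraicClosure F) hp hcard hs
  have hq := seven_le_of_five_lt_orderOf hp hcard hs
  have hB := ncard_squareSubfieldSet_lt (F := F) hp hq
  have hsub : (QuotientGroup.mk : _ → ProjectiveSpecialLinearGroup (Fin 2) F) ⁻¹' bad ⊆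
      {g | slPerm (AlgebraicClosure F) g x = x} ∪ ({g | slPerm (AlgebraicClosure F) g y = y} ∪
      ({g | slPerm (AlgebraicClosure F) g x = y} ∪
      {g | g.1.trace ∈ squareSubfieldSet F p (f / 2)})) := fun g hg => hxy g hg
  have hle := Set.ncard_le_ncard hsub (Set.toFinite _)
  have h1 := ncard_slPerm_apply_eq_le (F := F) x x
  have h2 := ncard_slPerm_apply_eq_le (F := F) y y
  have h3 := ncard_slPerm_apply_eq_le (F := F) x y
  have h4 := ncard_trace_mem_le (squareSubfieldSet F p (f / 2))
  have hu := Set.ncard_union_le {g | slPerm (AlgebraicClosure F) g x = x}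
    ({g | slPerm (AlgebraicClosure F) g y = y} ∪
      ({g | slPerm (AlgebraicClosure F) g x = y} ∪
      {g : SpecialLinearGroup (Fin 2) F | g.1.trace ∈ squareSubfieldSet F p (f / 2)}))
  have hu' := Set.ncard_union_le {g | slPerm (AlgebraicClosure F) g y = y}
      ({g | slPerm (AlgebraicClosure F) g x = y} ∪
      {g : SpecialLinearGroup (Fin 2) F | g.1.trace ∈ squareSubfieldSet F p (f / 2)})
  have hu'' := Set.ncard_union_le {g | slPerm (AlgebraicClosure F) g x = y}
      {g : SpecialLinearGroup (Fin 2) F | g.1.trace ∈ squareSubfieldSet F p (f / 2)}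
  have hpre : ((QuotientGroup.mk : _ → ProjectiveSpecialLinearGroup (Fin 2) F) ⁻¹' bad).ncard =
      Nat.card (Subgroup.center (SpecialLinearGroup (Fin 2) F)) * bad.ncard := by
    rw [← Nat.card_coe_set_eq, ← Nat.card_coe_set_eq, ← Nat.card_prod]
    exact Nat.card_congr (QuotientGroup.preimageMkEquivSubgroupProdSet _ _)
  have hSL := Subgroup.card_eq_card_quotient_mul_card_subgroup
    (Subgroup.center (SpecialLinearGroup (Fin 2) F))
  rw [card_specialLinearGroup_fin_two] at hSL
  have hlt : 2 * (Nat.card (Subgroup.center (SpecialLinearGroup (Fin 2) F)) * bad.ncard) <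
      Nat.card F * (Nat.card F ^ 2 - 1) := by
    rw [← hpre]
    rw [← hcard] at hB hq
    have hm := Nat.mul_lt_mul_of_pos_left hB (show 0 < Nat.card F by omega)
    refine lt_of_le_of_lt ?_ hm
    nlinarith
  rw [hSL] at hlt
  refine lt_of_mul_lt_mul_right
    (a := Nat.card (Subgroup.center (SpecialLinearGroup (Fin 2) F))) ?_ (Nat.zero_le _)
  rwa [mul_assoc, mul_comm bad.ncard]

end Counting

/-- if `s ∈ G = PSL(2,q)` has order greater than `5`, then the
number of `g ∈ G` with `⟨g, s⟩ = G` is greater than `|G|/2`. -/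
theorem stmt_13 (p f : ℕ) [Fact p.Prime] (hf : f ≠ 0)
    (s : ProjectiveSpecialLinearGroup (Fin 2) (GaloisField p f))
    (hs : 5 < orderOf s) :
    (({g : ProjectiveSpecialLinearGroup (Fin 2) (GaloisField p f) |
        Subgroup.closure {g, s} = ⊤}.ncard : ℝ)) >
      (Nat.card (ProjectiveSpecialLinearGroup (Fin 2) (GaloisField p f)) : ℝ) / 2 := by
  have hbad := two_mul_ncard_closure_pair_ne_top_lt (Fact.out : p.Prime) (GaloisField.card p f hf) hs
  have hadd := Set.ncard_add_ncard_compl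
    {g : ProjectiveSpecialLinearGroup (Fin 2) (GaloisField p f) | Subgroup.closure {g, s} = ⊤}
  rw [Set.compl_ofPred] at hadd
  have h : Nat.card (ProjectiveSpecialLinearGroup (Fin 2) (GaloisField p f)) <
      {g : ProjectiveSpecialLinearGroup (Fin 2) (GaloisField p f) |
        Subgroup.closure {g, s} = ⊤}.ncard * 2 := by
    change _ + {g | Subgroup.closure {g, s} ≠ ⊤}.ncard = _ at hadd
    omega
  rw [gt_iff_lt, div_lt_iff₀ two_pos]
  exact_mod_cast h
end
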